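/- arXiv:0801.0063 — 16 statements merged into one kernel-verified Lean document; each statement's English description precedes it below -/
import Mathlib

section
/- Let C be a category with cokernel pairs of morphisms in E (i.e., the pushout of any e ∈ E along itself exists), and let (E, M) be a weak factorization system of C. Then the following are equivalent: (i) (E, M) is a factorization system; (ii) E is closed under all colimits in the morphism category C²; (iii) for every e : A → B in E the canonical morphism e' : B +_A B → B from the codomain of the cokernel pair of e lies in E; (iv) if gf ∈ E and f ∈ E then g ∈ E; (v) if gf = 1 with f ∈ E, then g ∈ E. -/
/-!
Statement 0 (Proposition 2.3 of Rosický–Tholen, "Factorization, Fibration and Torsion"):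
For a weak factorization system (E, M) in a category C with cokernel pairs of morphisms
in E, TFAE: (i) (E,M) is a factorization system; (ii) E is closed under colimits in the
arrow category; (iii) the codiagonal of the cokernel pair of any e ∈ E lies in E;
(iv) gf ∈ E and f ∈ E imply g ∈ E; (v) gf = 1 and f ∈ E imply g ∈ E.
-/

open CategoryTheory CategoryTheory.Limits List

universe v u

namespace Stmt0

variable {C : Type u} [Category.{v} C]

/-- `e` has the (non-unique) left lifting property with respect to `m`. -/
def WeakLift {A B X Y : C} (e : A ⟶ B) (m : X ⟶ Y) : Prop :=
  ∀ (u : A ⟶ X) (v : B ⟶ Y), u ≫ m = e ≫ v →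
    ∃ d : B ⟶ X, e ≫ d = u ∧ d ≫ m = v

/-- `e` is orthogonal to `m`: unique diagonal fillers. -/
def UniqueLift {A B X Y : C} (e : A ⟶ B) (m : X ⟶ Y) : Prop :=
  ∀ (u : A ⟶ X) (v : B ⟶ Y), u ≫ m = e ≫ v →
    ∃! d : B ⟶ X, e ≫ d = u ∧ d ≫ m = v

/-- `(E, M)` is a weak factorization system. -/
structure IsWFS (E M : MorphismProperty C) : Prop where
  factor : ∀ {X Y : C} (f : X ⟶ Y),
    ∃ (Z : C) (e : X ⟶ Z) (m : Z ⟶ Y), E e ∧ M m ∧ e ≫ m = f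
  left_iff : ∀ {X Y : C} (f : X ⟶ Y),
    E f ↔ ∀ {A B : C} (m : A ⟶ B), M m → WeakLift f m
  right_iff : ∀ {X Y : C} (g : X ⟶ Y),
    M g ↔ ∀ {A B : C} (e : A ⟶ B), E e → WeakLift e g

/-- `(E, M)` is an (orthogonal) factorization system. -/
structure IsFS (E M : MorphismProperty C) : Prop where
  factor : ∀ {X Y : C} (f : X ⟶ Y),
    ∃ (Z : C) (e : X ⟶ Z) (m : Z ⟶ Y), E e ∧ M m ∧ e ≫ m = f
  left_iff : ∀ {X Y : C} (f : X ⟶ Y),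
    E f ↔ ∀ {A B : C} (m : A ⟶ B), M m → UniqueLift f m
  right_iff : ∀ {X Y : C} (g : X ⟶ Y),
    M g ↔ ∀ {A B : C} (e : A ⟶ B), E e → UniqueLift e g

section

variable {E M : MorphismProperty C}

lemma UniqueLift.weakLift {A B X Y : C} {e : A ⟶ B} {m : X ⟶ Y} (h : UniqueLift e m) :
    WeakLift e m :=
  fun u v w => (h u v w).exists

lemma IsWFS.id_mem (h : IsWFS E M) (X : C) : E (𝟙 X) :=
  (h.left_iff _).2 fun _ _ u v w => ⟨u, by simp, by simpa using w⟩

lemma IsWFS.of_isPushout (h : IsWFS E M) {A B X P : C} {e : A ⟶ B} {f : A ⟶ X}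
    {i : B ⟶ P} {e' : X ⟶ P} (he : E e) (hP : IsPushout e f i e') : E e' := by
  refine (h.left_iff _).2 fun m hm u v w => ?_
  obtain ⟨d, hd, hd'⟩ := (h.left_iff _).1 he m hm (f ≫ u) (i ≫ v) (by
    rw [Category.assoc, w, ← Category.assoc, ← hP.w, Category.assoc])
  refine ⟨hP.desc d u hd, hP.inr_desc _ _ _, hP.hom_ext ?_ ?_⟩
  · rw [hP.inl_desc_assoc, hd']
  · rw [hP.inr_desc_assoc, w]

/-- A morphism `f = e ≫ m` with `e` in the left class is a retract of `e` as soon as `m` has a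
section under the domain of `f`. -/
lemma IsWFS.of_section (h : IsWFS E M) {A B Z : C} {f : A ⟶ B} {e : A ⟶ Z} {m : Z ⟶ B}
    (he : E e) (hf : e ≫ m = f) (t : B ⟶ Z) (ht : f ≫ t = e) (htm : t ≫ m = 𝟙 B) : E f := by
  refine (h.left_iff _).2 fun n hn u v w => ?_
  obtain ⟨d, hd, hd'⟩ := (h.left_iff _).1 he n hn u (m ≫ v) (by rw [w, ← hf, Category.assoc])
  refine ⟨t ≫ d, ?_, ?_⟩
  · rw [← Category.assoc, ht, hd]
  · rw [Category.assoc, hd', ← Category.assoc, htm, Category.id_comp]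

lemma IsFS.cancel_left (h : IsFS E M) (hw : IsWFS E M) {X Y Z : C} {f : X ⟶ Y} {g : Y ⟶ Z}
    (hfg : E (f ≫ g)) (hf : E f) : E g := by
  refine (hw.left_iff _).2 fun m hm u v w => ?_
  obtain ⟨d, hd, hd'⟩ := (hw.left_iff _).1 hfg m hm (f ≫ u) v (by simp [w])
  refine ⟨d, ?_, hd'⟩
  exact ((h.left_iff _).1 hf m hm (f ≫ u) (g ≫ v) (by simp [w])).unique
    ⟨by simpa using hd, by simp [hd']⟩ ⟨rfl, w⟩

lemma IsFS.closed_colimit (h : IsFS E M) (hw : IsWFS E M) {J : Type*} [Category J]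
    {F : J ⥤ Arrow C} {c : Cocone F} (hc : IsColimit c) (hF : ∀ j, E (F.obj j).hom) :
    E c.pt.hom := by
  obtain ⟨Z, e, m, he, hm, hem⟩ := h.factor c.pt.hom
  have hlift (j : J) : ∃! d : (F.obj j).right ⟶ Z,
      (F.obj j).hom ≫ d = (c.ι.app j).left ≫ e ∧ d ≫ m = (c.ι.app j).right :=
    (h.left_iff _).1 (hF j) m hm _ _ (by
      rw [Category.assoc, hem]
      exact Arrow.w (c.ι.app j))
  choose d hd _ using hlift
  let s : Cocone F :=
    { pt := Arrow.mk e
      ι :=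
        { app := fun j => Arrow.homMk (c.ι.app j).left (d j) (hd j).1.symm
          naturality := fun i j φ => by
            have hl : (F.map φ).left ≫ (c.ι.app j).left = (c.ι.app i).left :=
              congrArg Arrow.Hom.left (c.w φ)
            have hr : (F.map φ).right ≫ (c.ι.app j).right = (c.ι.app i).right :=
              congrArg Arrow.Hom.right (c.w φ)
            have hdd : (F.map φ).right ≫ d j = d i := by
              refine ((h.left_iff _).1 (hF i) m hm ((c.ι.app i).left ≫ e)
                (c.ι.app i).right ?_).unique ⟨?_, ?_⟩ (hd i)
              · rw [Category.assoc, hem]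
                exact Arrow.w (c.ι.app i)
              · rw [← Category.assoc, ← Arrow.w (F.map φ), Category.assoc, (hd j).1,
                  ← Category.assoc, hl]
              · rw [Category.assoc, (hd j).2, hr]
            ext
            · simpa using hl
            · simpa using hdd } }
  let p : Arrow.mk e ⟶ c.pt := Arrow.homMk (𝟙 _) m (by simpa using hem.symm)
  have hp : hc.desc s ≫ p = 𝟙 c.pt := hc.hom_ext fun j => by
    rw [hc.fac_assoc, Category.comp_id]
    ext
    · simp [s, p]
    · simpa [s, p] using (hd j).2
  have hl : (hc.desc s).left = 𝟙 _ := by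
    simpa [p, s] using congrArg Arrow.Hom.left hp
  have hr : (hc.desc s).right ≫ m = 𝟙 _ := congrArg Arrow.Hom.right hp
  refine hw.of_section he hem (hc.desc s).right ?_ hr
  rw [← Arrow.w (hc.desc s), hl]
  exact Category.id_comp e

/-- The codiagonal of a cokernel pair of `e` is the pushout, in the arrow category, of the
morphism `e ⟶ 𝟙 B` along itself. -/
lemma exists_isColimit_codiagonal {A B P : C} {e : A ⟶ B} {p₁ p₂ : B ⟶ P} {e' : P ⟶ B}
    (hP : IsPushout e e p₁ p₂) (h₁ : p₁ ≫ e' = 𝟙 B) (h₂ : p₂ ≫ e' = 𝟙 B)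
    (φ : Arrow.mk e ⟶ Arrow.mk (𝟙 B)) (hl : φ.left = e) (hr : φ.right = 𝟙 B) :
    ∃ c : Cocone (span φ φ), Nonempty (IsColimit c) ∧ c.pt = Arrow.mk e' := by
  let i₁ : Arrow.mk (𝟙 B) ⟶ Arrow.mk e' := Arrow.homMk p₁ (𝟙 B) (by simp [h₁])
  let i₂ : Arrow.mk (𝟙 B) ⟶ Arrow.mk e' := Arrow.homMk p₂ (𝟙 B) (by simp [h₂])
  have hw : φ ≫ i₁ = φ ≫ i₂ := by
    ext
    · simpa [i₁, i₂, hl] using hP.w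
    · simp [i₁, i₂]
  have hleft (s : PushoutCocone φ φ) : e ≫ s.inl.left = e ≫ s.inr.left := by
    simpa [hl] using congrArg Arrow.Hom.left s.condition
  have hright (s : PushoutCocone φ φ) : s.inl.right = s.inr.right := by
    have h : φ.right ≫ s.inl.right = φ.right ≫ s.inr.right :=
      congrArg Arrow.Hom.right s.condition
    rw [hr] at h
    exact (Category.id_comp _).symm.trans (h.trans (Category.id_comp _))
  have hinl (s : PushoutCocone φ φ) : s.inl.left ≫ s.pt.hom = s.inl.right :=
    (Arrow.w s.inl).trans (Category.id_comp _)
  have hinr (s : PushoutCocone φ φ) : s.inr.left ≫ s.pt.hom = s.inr.right :=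
    (Arrow.w s.inr).trans (Category.id_comp _)
  refine ⟨PushoutCocone.mk i₁ i₂ hw, ⟨PushoutCocone.IsColimit.mk hw
    (fun s => Arrow.homMk (hP.desc s.inl.left s.inr.left (hleft s)) s.inl.right
      (hP.hom_ext ?_ ?_)) ?_ ?_ ?_⟩, rfl⟩
  · refine (hP.inl_desc_assoc _ _ _ _).trans ((hinl s).trans ?_)
    exact ((Category.assoc _ _ _).symm.trans
      ((congrArg (· ≫ s.inl.right) h₁).trans (Category.id_comp _))).symm
  · refine (hP.inr_desc_assoc _ _ _ _).trans ((hinr s).trans ((hright s).symm.trans ?_))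
    exact ((Category.assoc _ _ _).symm.trans
      ((congrArg (· ≫ s.inl.right) h₂).trans (Category.id_comp _))).symm
  · intro s
    ext
    · exact hP.inl_desc _ _ _
    · exact Category.id_comp _
  · intro s
    ext
    · exact hP.inr_desc _ _ _
    · exact (Category.id_comp _).trans (hright s)
  · intro s m hm₁ hm₂
    have hm₁l : p₁ ≫ m.left = s.inl.left := congrArg Arrow.Hom.left hm₁
    have hm₂l : p₂ ≫ m.left = s.inr.left := congrArg Arrow.Hom.left hm₂
    have hm₁r : 𝟙 B ≫ m.right = s.inl.right := congrArg Arrow.Hom.right hm₁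
    ext
    · exact hP.hom_ext (hm₁l.trans (hP.inl_desc _ _ _).symm)
        (hm₂l.trans (hP.inr_desc _ _ _).symm)
    · exact (Category.id_comp _).symm.trans hm₁r

/-- If `e` lifts against `m` and so does the codiagonal of its cokernel pair, then lifts of `e`
against `m` are unique. -/
lemma WeakLift.uniqueLift_of_codiagonal {A B P X Y : C} {e : A ⟶ B} {p₁ p₂ : B ⟶ P}
    {e' : P ⟶ B} {m : X ⟶ Y} (h : WeakLift e m) (hP : IsPushout e e p₁ p₂)
    (h₁ : p₁ ≫ e' = 𝟙 B) (h₂ : p₂ ≫ e' = 𝟙 B) (h' : WeakLift e' m) : UniqueLift e m := by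
  intro u v w
  refine existsUnique_of_exists_of_unique (h u v w) ?_
  rintro d₁ d₂ ⟨hd₁, hd₁'⟩ ⟨hd₂, hd₂'⟩
  obtain ⟨t, ht, -⟩ := h' (hP.desc d₁ d₂ (hd₁.trans hd₂.symm)) v (hP.hom_ext
    (by rw [hP.inl_desc_assoc, hd₁', ← Category.assoc, h₁, Category.id_comp])
    (by rw [hP.inr_desc_assoc, hd₂', ← Category.assoc, h₂, Category.id_comp]))
  have e₁ : d₁ = t := by
    rw [← hP.inl_desc d₁ d₂ (hd₁.trans hd₂.symm), ← ht, ← Category.assoc, h₁, Category.id_comp]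
  have e₂ : d₂ = t := by
    rw [← hP.inr_desc d₁ d₂ (hd₁.trans hd₂.symm), ← ht, ← Category.assoc, h₂, Category.id_comp]
  exact e₁.trans e₂.symm

lemma IsWFS.isFS_of_uniqueLift (h : IsWFS E M)
    (hu : ∀ {A B X Y : C} (e : A ⟶ B) (m : X ⟶ Y), E e → M m → UniqueLift e m) : IsFS E M where
  factor := h.factor
  left_iff f := ⟨fun hf _ _ m hm => hu f m hf hm,
    fun H => (h.left_iff f).2 fun m hm => (H m hm).weakLift⟩
  right_iff g := ⟨fun hg _ _ e he => hu e g he hg,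
    fun H => (h.right_iff g).2 fun e he => (H e he).weakLift⟩

end

theorem statement0 (E M : MorphismProperty C) (hwfs : IsWFS E M)
    (hpo : ∀ {A B : C} (e : A ⟶ B), E e → HasPushout e e) :
    [ -- (i) (E, M) is a factorization system
      IsFS E M,
      -- (ii) E is closed under all colimits in the morphism category C²
      ∀ (J : Type) (_ : SmallCategory J) (F : J ⥤ Arrow C) (c : Cocone F),
        IsColimit c → (∀ j : J, E (F.obj j).hom) → E c.pt.hom,
      -- (iii) for every e : A ⟶ B in E, the codiagonal e' : B +_A B ⟶ B of the
      -- cokernel pair of e lies in E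
      ∀ {A B P : C} (e : A ⟶ B) (p₁ p₂ : B ⟶ P) (e' : P ⟶ B),
        E e → IsPushout e e p₁ p₂ → p₁ ≫ e' = 𝟙 B → p₂ ≫ e' = 𝟙 B → E e',
      -- (iv) if gf ∈ E and f ∈ E then g ∈ E
      ∀ {X Y Z : C} (f : X ⟶ Y) (g : Y ⟶ Z), E (f ≫ g) → E f → E g,
      -- (v) if gf = 1 with f ∈ E, then g ∈ E
      ∀ {X Y : C} (f : X ⟶ Y) (g : Y ⟶ X), f ≫ g = 𝟙 X → E f → E g ].TFAE := by
  tfae_have 1 → 2 := fun h J _ F c hc hF => h.closed_colimit hwfs hc hF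
  tfae_have 2 → 3 := by
    intro h A B P e p₁ p₂ e' _ hP h₁ h₂
    let φ : Arrow.mk e ⟶ Arrow.mk (𝟙 B) := Arrow.homMk e (𝟙 B) rfl
    obtain ⟨c, ⟨hc⟩, hpt⟩ := exists_isColimit_codiagonal hP h₁ h₂ φ rfl rfl
    have hE : E c.pt.hom := h WalkingSpan inferInstance (span φ φ) c hc (by
      rintro (_ | _ | _)
      · assumption
      · exact hwfs.id_mem B
      · exact hwfs.id_mem B)
    rw [hpt] at hE
    exact hE
  tfae_have 3 → 1 := by
    intro h
    refine hwfs.isFS_of_uniqueLift fun e m he hm => ?_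
    have := hpo e he
    have hP := IsPushout.of_hasPushout e e
    have h₁ := hP.inl_desc (𝟙 _) (𝟙 _) rfl
    have h₂ := hP.inr_desc (𝟙 _) (𝟙 _) rfl
    exact ((hwfs.left_iff e).1 he m hm).uniqueLift_of_codiagonal hP h₁ h₂
      ((hwfs.left_iff _).1 (h e _ _ _ he hP h₁ h₂) m hm)
  tfae_have 1 → 4 := fun h _ _ _ _ _ hfg hf => h.cancel_left hwfs hfg hf
  tfae_have 4 → 5 := fun h X _ f g hfg hf => h f g (hfg ▸ hwfs.id_mem X) hf
  tfae_have 5 → 3 := fun h _ _ _ _ p₁ _ e' he hP h₁ _ =>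
    h p₁ e' h₁ (hwfs.of_isPushout he hP.flip)
  tfae_finish

end Stmt0
end

section
/- In a category with kernel pairs of morphisms in M, a pair (E, M) of classes of morphisms is a factorization system if, and only if, it is a weak factorization system satisfying: if gf = 1 with g ∈ M, then f ∈ M. -/
/-!
Statement 1 (Corollary 2.4): In a category with kernel pairs of morphisms in M,
(E, M) is a factorization system iff it is a weak factorization system satisfying:
if gf = 1 with g ∈ M, then f ∈ M.
-/

open CategoryTheory CategoryTheory.Limits

universe v u

namespace Stmt1

variable {C : Type u} [Category.{v} C]

def WeakLift {A B X Y : C} (e : A ⟶ B) (m : X ⟶ Y) : Prop :=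
  ∀ (u : A ⟶ X) (v : B ⟶ Y), u ≫ m = e ≫ v →
    ∃ d : B ⟶ X, e ≫ d = u ∧ d ≫ m = v

def UniqueLift {A B X Y : C} (e : A ⟶ B) (m : X ⟶ Y) : Prop :=
  ∀ (u : A ⟶ X) (v : B ⟶ Y), u ≫ m = e ≫ v →
    ∃! d : B ⟶ X, e ≫ d = u ∧ d ≫ m = v

structure IsWFS (E M : MorphismProperty C) : Prop where
  factor : ∀ {X Y : C} (f : X ⟶ Y),
    ∃ (Z : C) (e : X ⟶ Z) (m : Z ⟶ Y), E e ∧ M m ∧ e ≫ m = f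
  left_iff : ∀ {X Y : C} (f : X ⟶ Y),
    E f ↔ ∀ {A B : C} (m : A ⟶ B), M m → WeakLift f m
  right_iff : ∀ {X Y : C} (g : X ⟶ Y),
    M g ↔ ∀ {A B : C} (e : A ⟶ B), E e → WeakLift e g

structure IsFS (E M : MorphismProperty C) : Prop where
  factor : ∀ {X Y : C} (f : X ⟶ Y),
    ∃ (Z : C) (e : X ⟶ Z) (m : Z ⟶ Y), E e ∧ M m ∧ e ≫ m = f
  left_iff : ∀ {X Y : C} (f : X ⟶ Y),
    E f ↔ ∀ {A B : C} (m : A ⟶ B), M m → UniqueLift f m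
  right_iff : ∀ {X Y : C} (g : X ⟶ Y),
    M g ↔ ∀ {A B : C} (e : A ⟶ B), E e → UniqueLift e g

theorem UniqueLift.weakLift {A B X Y : C} {e : A ⟶ B} {m : X ⟶ Y} (h : UniqueLift e m) :
    WeakLift e m :=
  fun u v w => (h u v w).exists

theorem UniqueLift.hom_ext {A B X Y : C} {e : A ⟶ B} {m : X ⟶ Y} (h : UniqueLift e m)
    {d₁ d₂ : B ⟶ X} (he : e ≫ d₁ = e ≫ d₂) (hm : d₁ ≫ m = d₂ ≫ m) : d₁ = d₂ :=
  (h (e ≫ d₂) (d₂ ≫ m) (Category.assoc _ _ _)).unique ⟨he, hm⟩ ⟨rfl, rfl⟩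

theorem WeakLift.uniqueLift {A B X Y : C} {e : A ⟶ B} {m : X ⟶ Y} (h : WeakLift e m)
    (ext : ∀ d₁ d₂ : B ⟶ X, e ≫ d₁ = e ≫ d₂ → d₁ ≫ m = d₂ ≫ m → d₁ = d₂) :
    UniqueLift e m := fun u v w =>
  existsUnique_of_exists_of_unique (h u v w) fun d₁ d₂ h₁ h₂ =>
    ext d₁ d₂ (h₁.1.trans h₂.1.symm) (h₁.2.trans h₂.2.symm)

theorem WeakLift.of_isPullback {A B P X Y Z : C} {e : A ⟶ B} {fst : P ⟶ X} {snd : P ⟶ Y}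
    {f : X ⟶ Z} {g : Y ⟶ Z} (sq : IsPullback fst snd f g) (h : WeakLift e g) :
    WeakLift e fst := by
  intro u v w
  obtain ⟨d, hd, hd'⟩ := h (u ≫ snd) (v ≫ f) (by
    rw [Category.assoc, ← sq.w, reassoc_of% w])
  refine ⟨sq.lift v d hd'.symm, sq.hom_ext ?_ ?_, sq.lift_fst _ _ _⟩
  · rw [Category.assoc, sq.lift_fst, w]
  · rw [Category.assoc, sq.lift_snd, hd]

section FactorizationSystems

variable {E M : MorphismProperty C}

theorem IsFS.uniqueLift (h : IsFS E M) {A B X Y : C} {e : A ⟶ B} {m : X ⟶ Y}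
    (he : E e) (hm : M m) : UniqueLift e m :=
  (h.left_iff e).1 he m hm

theorem IsWFS.weakLift (h : IsWFS E M) {A B X Y : C} {e : A ⟶ B} {m : X ⟶ Y}
    (he : E e) (hm : M m) : WeakLift e m :=
  (h.left_iff e).1 he m hm

theorem IsFS.left_of_weakLift (h : IsFS E M) {X Y : C} (f : X ⟶ Y)
    (hf : ∀ {A B : C} (m : A ⟶ B), M m → WeakLift f m) : E f := by
  obtain ⟨Z, e, m, he, hm, rfl⟩ := h.factor f
  obtain ⟨s, hs, hs'⟩ := hf m hm e (𝟙 Y) (Category.comp_id _).symm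
  refine (h.left_iff _).2 fun n hn => (hf n hn).uniqueLift fun d₁ d₂ h₁ h₂ => ?_
  have key : m ≫ d₁ = m ≫ d₂ :=
    (h.uniqueLift he hn).hom_ext (by simpa using h₁) (by simp [h₂])
  simpa [reassoc_of% hs'] using s ≫= key

theorem IsFS.right_of_weakLift (h : IsFS E M) {X Y : C} (g : X ⟶ Y)
    (hg : ∀ {A B : C} (e : A ⟶ B), E e → WeakLift e g) : M g := by
  obtain ⟨Z, e, m, he, hm, rfl⟩ := h.factor g
  obtain ⟨r, hr, hr'⟩ := hg e he (𝟙 X) m (Category.id_comp _)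
  refine (h.right_iff _).2 fun n hn => (hg n hn).uniqueLift fun d₁ d₂ h₁ h₂ => ?_
  have key : d₁ ≫ e = d₂ ≫ e :=
    (h.uniqueLift hn hm).hom_ext (by simp [reassoc_of% h₁]) (by simpa using h₂)
  simpa [hr] using key =≫ r

theorem IsFS.isWFS (h : IsFS E M) : IsWFS E M where
  factor := h.factor
  left_iff f := ⟨fun hf _ _ _ hm => (h.uniqueLift hf hm).weakLift, h.left_of_weakLift f⟩
  right_iff g := ⟨fun hg _ _ _ he => (h.uniqueLift he hg).weakLift, h.right_of_weakLift g⟩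

theorem IsFS.right_of_comp_eq_id (h : IsFS E M) {X Y : C} {f : X ⟶ Y} {g : Y ⟶ X}
    (hfg : f ≫ g = 𝟙 X) (hg : M g) : M f := by
  refine h.right_of_weakLift f fun e he u v w => ⟨v ≫ g, ?_, ?_⟩
  · rw [← reassoc_of% w, hfg, Category.comp_id]
  · refine (h.uniqueLift he hg).hom_ext ?_ (by simp [hfg])
    rw [Category.assoc, ← reassoc_of% w, reassoc_of% hfg, w]

theorem IsWFS.right_of_isPullback (h : IsWFS E M) {P X Y Z : C} {fst : P ⟶ X} {snd : P ⟶ Y}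
    {f : X ⟶ Z} {g : Y ⟶ Z} (sq : IsPullback fst snd f g) (hg : M g) : M fst :=
  (h.right_iff _).2 fun _ he => (h.weakLift he hg).of_isPullback sq

theorem IsWFS.uniqueLift (h : IsWFS E M)
    (hM : ∀ {X Y : C} (f : X ⟶ Y) (g : Y ⟶ X), f ≫ g = 𝟙 X → M g → M f)
    {A B X Y : C} {e : A ⟶ B} {m : X ⟶ Y} [HasPullback m m] (he : E e) (hm : M m) :
    UniqueLift e m := by
  refine (h.weakLift he hm).uniqueLift fun d₁ d₂ h₁ h₂ => ?_
  have hdiag : M (pullback.diagonal m) :=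
    hM _ (pullback.fst m m) (pullback.diagonal_fst m)
      (h.right_of_isPullback (IsPullback.of_hasPullback m m) hm)
  obtain ⟨d, -, hd⟩ := h.weakLift he hdiag (e ≫ d₁) (pullback.lift d₁ d₂ h₂)
    (by ext <;> simp [h₁, pullback.lift_fst, pullback.lift_snd])
  have hd₁ : d = d₁ := by simpa [pullback.lift_fst] using hd =≫ pullback.fst m m
  have hd₂ : d = d₂ := by simpa [pullback.lift_snd] using hd =≫ pullback.snd m m
  exact hd₁.symm.trans hd₂

theorem IsWFS.isFS (h : IsWFS E M)
    (hkp : ∀ {X Y : C} (m : X ⟶ Y), M m → HasPullback m m)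
    (hM : ∀ {X Y : C} (f : X ⟶ Y) (g : Y ⟶ X), f ≫ g = 𝟙 X → M g → M f) : IsFS E M where
  factor := h.factor
  left_iff f :=
    ⟨fun hf _ _ m hm => have := hkp m hm; h.uniqueLift hM hf hm,
      fun hf => (h.left_iff f).2 fun m hm => (hf m hm).weakLift⟩
  right_iff g :=
    ⟨fun hg _ _ _ he => have := hkp g hg; h.uniqueLift hM he hg,
      fun hg => (h.right_iff g).2 fun e he => (hg e he).weakLift⟩

end FactorizationSystems

theorem statement1 (E M : MorphismProperty C)
    (hkp : ∀ {X Y : C} (m : X ⟶ Y), M m → HasPullback m m) :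
    IsFS E M ↔
      (IsWFS E M ∧
        ∀ {X Y : C} (f : X ⟶ Y) (g : Y ⟶ X), f ≫ g = 𝟙 X → M g → M f) :=
  ⟨fun h => ⟨h.isWFS, fun _ _ => h.right_of_comp_eq_id⟩, fun h => h.1.isFS hkp h.2⟩

end Stmt1
end

section
/- Let C be a category with binary coproducts and let Sum be the class of all coproduct injections. If Sum is stable under pullback in C (i.e., any pullback of a coproduct injection along an arbitrary morphism that exists is again a coproduct injection, and the relevant pullbacks exist), then (Sum, SplitEpi) is a weak factorization system in C, where SplitEpi is the class of split epimorphisms. In particular, every morphism having the left lifting property with respect to all split epimorphisms is a coproduct injection. -/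
/-!
Statement 3 (Theorem 2.7, first case): If C has binary coproducts and the class
Sum of coproduct injections is stable under pullback, then (Sum, SplitEpi) is a
weak factorization system; in particular every morphism with the left lifting
property w.r.t. all split epimorphisms is a coproduct injection.
-/

open CategoryTheory CategoryTheory.Limits

universe v u

namespace Stmt3

variable {C : Type u} [Category.{v} C]

def WeakLift {A B X Y : C} (e : A ⟶ B) (m : X ⟶ Y) : Prop :=
  ∀ (u : A ⟶ X) (v : B ⟶ Y), u ≫ m = e ≫ v →
    ∃ d : B ⟶ X, e ≫ d = u ∧ d ≫ m = v

structure IsWFS (E M : MorphismProperty C) : Prop where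
  factor : ∀ {X Y : C} (f : X ⟶ Y),
    ∃ (Z : C) (e : X ⟶ Z) (m : Z ⟶ Y), E e ∧ M m ∧ e ≫ m = f
  left_iff : ∀ {X Y : C} (f : X ⟶ Y),
    E f ↔ ∀ {A B : C} (m : A ⟶ B), M m → WeakLift f m
  right_iff : ∀ {X Y : C} (g : X ⟶ Y),
    M g ↔ ∀ {A B : C} (e : A ⟶ B), E e → WeakLift e g

def IsCoprodInj {A B : C} (f : A ⟶ B) : Prop :=
  ∃ (Z : C) (g : Z ⟶ B), Nonempty (IsColimit (BinaryCofan.mk f g))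

theorem isCoprodInj_inl [HasBinaryCoproducts C] (A B : C) :
    IsCoprodInj (coprod.inl : A ⟶ A ⨿ B) :=
  ⟨B, coprod.inr, ⟨coprodIsCoprod A B⟩⟩

theorem IsCoprodInj.weakLift_of_isSplitEpi {A B X Y : C} {f : A ⟶ B} {m : X ⟶ Y}
    (hf : IsCoprodInj f) (hm : IsSplitEpi m) : WeakLift f m := by
  obtain ⟨Z, g, ⟨hc⟩⟩ := hf
  intro u v huv
  obtain ⟨(d : B ⟶ X), (hd₁ : f ≫ d = u), (hd₂ : g ≫ d = g ≫ v ≫ section_ m)⟩ :=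
    BinaryCofan.IsColimit.desc' hc u (g ≫ v ≫ section_ m)
  refine ⟨d, hd₁, BinaryCofan.IsColimit.hom_ext hc ?_ ?_⟩
  · change f ≫ d ≫ m = f ≫ v
    rw [reassoc_of% hd₁, huv]
  · change g ≫ d ≫ m = g ≫ v
    simp [reassoc_of% hd₂]

theorem isSplitEpi_coprod_desc_id [HasBinaryCoproducts C] {A B : C} (f : A ⟶ B) :
    IsSplitEpi (coprod.desc f (𝟙 B)) :=
  IsSplitEpi.mk' ⟨coprod.inr, coprod.inr_desc _ _⟩

/-- A morphism lifting against `coprod.desc f (𝟙 B)` is a pullback of `coprod.inl`. -/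
theorem exists_isPullback_coprod_inl [HasBinaryCoproducts C] {A B : C} (f : A ⟶ B)
    (hf : WeakLift f (coprod.desc f (𝟙 B))) :
    ∃ d : B ⟶ A ⨿ B, IsPullback (𝟙 A) f coprod.inl d := by
  obtain ⟨d, hd₁, hd₂⟩ := hf coprod.inl (𝟙 B) (by simp [coprod.inl_desc])
  refine ⟨d, ⟨⟨by simp [hd₁]⟩, ⟨PullbackCone.IsLimit.mk _ (fun s => s.fst) (by simp) ?_ ?_⟩⟩⟩
  · intro s
    have h := s.condition =≫ coprod.desc f (𝟙 B)
    simpa [hd₂, coprod.inl_desc] using h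
  · intro s m hm _
    simpa using hm

theorem isSplitEpi_of_weakLift_coprod_inl [HasBinaryCoproducts C] {X Y : C} (g : X ⟶ Y)
    (hg : WeakLift (coprod.inl : X ⟶ X ⨿ Y) g) : IsSplitEpi g := by
  obtain ⟨d, -, hd⟩ := hg (𝟙 X) (coprod.desc g (𝟙 Y)) (by simp [coprod.inl_desc])
  exact IsSplitEpi.mk' ⟨coprod.inr ≫ d, by simp [hd, coprod.inr_desc]⟩

theorem statement3 [HasBinaryCoproducts C]
    -- Sum is stable under pullback: in any pullback square, the pullback of a
    -- coproduct injection along an arbitrary morphism is a coproduct injection.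
    (hstab : ∀ {P X Y Z : C} (p₁ : P ⟶ X) (p₂ : P ⟶ Y) (f : X ⟶ Z) (g : Y ⟶ Z),
      IsPullback p₁ p₂ f g → IsCoprodInj f → IsCoprodInj p₂) :
    IsWFS (C := C) (fun _ _ f => IsCoprodInj f) (fun _ _ m => IsSplitEpi m) ∧
    (∀ {A B : C} (f : A ⟶ B),
      (∀ {X Y : C} (m : X ⟶ Y), IsSplitEpi m → WeakLift f m) → IsCoprodInj f) := by
  have hleft : ∀ {A B : C} (f : A ⟶ B),
      (∀ {X Y : C} (m : X ⟶ Y), IsSplitEpi m → WeakLift f m) → IsCoprodInj f := by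
    intro A B f hf
    obtain ⟨d, hd⟩ := exists_isPullback_coprod_inl f (hf _ (isSplitEpi_coprod_desc_id f))
    exact hstab _ _ _ _ hd (isCoprodInj_inl A B)
  refine ⟨⟨fun {X Y} f => ?_, fun f => ⟨fun hf _ _ _ hm => hf.weakLift_of_isSplitEpi hm, hleft f⟩,
    fun g => ⟨fun hg _ _ _ he => he.weakLift_of_isSplitEpi hg, fun hg => ?_⟩⟩, hleft⟩
  · exact ⟨X ⨿ Y, coprod.inl, coprod.desc f (𝟙 Y), isCoprodInj_inl X Y,
      isSplitEpi_coprod_desc_id f, coprod.inl_desc _ _⟩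
  · exact isSplitEpi_of_weakLift_coprod_inl g (hg _ (isCoprodInj_inl _ _))

end Stmt3
end

section
/- Let C be a pointed category (having a zero object) with binary coproducts, and suppose that every split monomorphism of C is a coproduct injection. Then (Sum, SplitEpi) is a weak factorization system in C, where Sum is the class of all coproduct injections and SplitEpi the class of split epimorphisms. In particular, every morphism having the left lifting property with respect to all split epimorphisms is a coproduct injection. (The hypothesis holds, for instance, in any additive category with finite coproducts.) -/
/-!
Statement 4 (Theorem 2.7, pointed case): If C is pointed with binary coproducts
and every split monomorphism is a coproduct injection, then (Sum, SplitEpi) is a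
weak factorization system; in particular every morphism with the left lifting
property w.r.t. all split epimorphisms is a coproduct injection.
-/

open CategoryTheory CategoryTheory.Limits

universe v u

namespace Stmt4

variable {C : Type u} [Category.{v} C]

def WeakLift {A B X Y : C} (e : A ⟶ B) (m : X ⟶ Y) : Prop :=
  ∀ (u : A ⟶ X) (v : B ⟶ Y), u ≫ m = e ≫ v →
    ∃ d : B ⟶ X, e ≫ d = u ∧ d ≫ m = v

structure IsWFS (E M : MorphismProperty C) : Prop where
  factor : ∀ {X Y : C} (f : X ⟶ Y),
    ∃ (Z : C) (e : X ⟶ Z) (m : Z ⟶ Y), E e ∧ M m ∧ e ≫ m = f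
  left_iff : ∀ {X Y : C} (f : X ⟶ Y),
    E f ↔ ∀ {A B : C} (m : A ⟶ B), M m → WeakLift f m
  right_iff : ∀ {X Y : C} (g : X ⟶ Y),
    M g ↔ ∀ {A B : C} (e : A ⟶ B), E e → WeakLift e g

def IsCoprodInj {A B : C} (f : A ⟶ B) : Prop :=
  ∃ (Z : C) (g : Z ⟶ B), Nonempty (IsColimit (BinaryCofan.mk f g))

theorem IsCoprodInj.weakLift {A B X Y : C} {f : A ⟶ B} (hf : IsCoprodInj f) (m : X ⟶ Y)
    [IsSplitEpi m] : WeakLift f m := by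
  obtain ⟨Z, g, ⟨hc⟩⟩ := hf
  intro a b hab
  obtain ⟨d, hfd, hgd⟩ : ∃ d : B ⟶ X, f ≫ d = a ∧ g ≫ d = g ≫ b ≫ section_ m :=
    have ⟨d, hd⟩ := BinaryCofan.IsColimit.desc' hc a (g ≫ b ≫ section_ m)
    ⟨d, hd⟩
  have hf : f ≫ d ≫ m = f ≫ b := by rw [← Category.assoc, hfd, hab]
  have hg : g ≫ d ≫ m = g ≫ b := by
    rw [← Category.assoc, hgd, Category.assoc, Category.assoc, IsSplitEpi.id, Category.comp_id]
  exact ⟨d, hfd, BinaryCofan.IsColimit.hom_ext hc hf hg⟩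

theorem isCoprodInj_inl (X Y : C) [HasBinaryCoproduct X Y] :
    IsCoprodInj (coprod.inl : X ⟶ X ⨿ Y) :=
  ⟨Y, coprod.inr, ⟨coprodIsCoprod X Y⟩⟩

theorem isSplitEpi_coprod_desc_id {X Y : C} [HasBinaryCoproduct X Y] (f : X ⟶ Y) :
    IsSplitEpi (coprod.desc f (𝟙 Y)) :=
  IsSplitEpi.mk' ⟨coprod.inr, coprod.inr_desc _ _⟩

theorem isSplitEpi_of_weakLift_inl {X Y : C} [HasBinaryCoproduct X Y] {g : X ⟶ Y}
    (h : WeakLift (coprod.inl : X ⟶ X ⨿ Y) g) : IsSplitEpi g := by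
  obtain ⟨d, -, hd⟩ := h (𝟙 X) (coprod.desc g (𝟙 Y))
    (by rw [Category.id_comp, coprod.inl_desc])
  exact IsSplitEpi.mk' ⟨coprod.inr ≫ d, by rw [Category.assoc, hd, coprod.inr_desc]⟩

open ZeroObject in
theorem isSplitMono_of_weakLift_zero [HasZeroObject C] [HasZeroMorphisms C] {A B : C}
    {f : A ⟶ B} (h : WeakLift f (0 : A ⟶ 0)) : IsSplitMono f := by
  obtain ⟨d, hd, -⟩ := h (𝟙 A) 0 (by simp)
  exact IsSplitMono.mk' ⟨d, hd⟩

open ZeroObject in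
theorem isSplitEpi_to_zero [HasZeroObject C] [HasZeroMorphisms C] (A : C) :
    IsSplitEpi (0 : A ⟶ 0) :=
  IsSplitEpi.mk' ⟨0, Subsingleton.elim _ _⟩

theorem statement4 [HasZeroObject C] [HasZeroMorphisms C] [HasBinaryCoproducts C]
    (hsplit : ∀ {A B : C} (f : A ⟶ B), IsSplitMono f → IsCoprodInj f) :
    IsWFS (C := C) (fun _ _ f => IsCoprodInj f) (fun _ _ m => IsSplitEpi m) ∧
    (∀ {A B : C} (f : A ⟶ B),
      (∀ {X Y : C} (m : X ⟶ Y), IsSplitEpi m → WeakLift f m) → IsCoprodInj f) := by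
  have hllp : ∀ {A B : C} (f : A ⟶ B),
      (∀ {X Y : C} (m : X ⟶ Y), IsSplitEpi m → WeakLift f m) → IsCoprodInj f :=
    fun f h => hsplit f (isSplitMono_of_weakLift_zero (h _ (isSplitEpi_to_zero _)))
  refine ⟨⟨fun {X Y} f => ?_, fun f => ?_, fun g => ?_⟩, hllp⟩
  · exact ⟨X ⨿ Y, coprod.inl, coprod.desc f (𝟙 Y), isCoprodInj_inl X Y,
      isSplitEpi_coprod_desc_id f, coprod.inl_desc _ _⟩
  · exact ⟨fun hf _ _ m hm => haveI : IsSplitEpi m := hm; hf.weakLift m, hllp f⟩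
  · exact ⟨fun hg _ _ _ he => haveI : IsSplitEpi g := hg; IsCoprodInj.weakLift he g,
      fun h => isSplitEpi_of_weakLift_inl (h _ (isCoprodInj_inl _ _))⟩

end Stmt4
end

section
/- In every category with binary products and enough injectives, the pair (Mono, Mono□) is a weak factorization system, where Mono is the class of all monomorphisms and Mono□ is the class of morphisms having the right lifting property with respect to all monomorphisms. -/
/-!
Statement 5 (Proposition 2.8): In every category with binary products and enough
injectives, (Mono, Mono□) is a weak factorization system.
-/

open CategoryTheory CategoryTheory.Limits

universe v u

namespace Stmt5

variable {C : Type u} [Category.{v} C]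

def WeakLift {A B X Y : C} (e : A ⟶ B) (m : X ⟶ Y) : Prop :=
  ∀ (u : A ⟶ X) (v : B ⟶ Y), u ≫ m = e ≫ v →
    ∃ d : B ⟶ X, e ≫ d = u ∧ d ≫ m = v

structure IsWFS (E M : MorphismProperty C) : Prop where
  factor : ∀ {X Y : C} (f : X ⟶ Y),
    ∃ (Z : C) (e : X ⟶ Z) (m : Z ⟶ Y), E e ∧ M m ∧ e ≫ m = f
  left_iff : ∀ {X Y : C} (f : X ⟶ Y),
    E f ↔ ∀ {A B : C} (m : A ⟶ B), M m → WeakLift f m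
  right_iff : ∀ {X Y : C} (g : X ⟶ Y),
    M g ↔ ∀ {A B : C} (e : A ⟶ B), E e → WeakLift e g

/-- Mono□ : the morphisms with the right lifting property w.r.t. all monomorphisms. -/
def RlpMono : MorphismProperty C :=
  fun _ _ g => ∀ {A B : C} (f : A ⟶ B), Mono f → WeakLift f g

/-- The projection `J ⨯ Y ⟶ Y` with `J` injective lies in `Mono□`. -/
lemma rlpMono_snd [HasBinaryProducts C] (J Y : C) [Injective J] :
    RlpMono (prod.snd : J ⨯ Y ⟶ Y) := by
  intro A B f hf a b w
  refine ⟨prod.lift (Injective.factorThru (a ≫ prod.fst) f) b, ?_, prod.lift_snd _ _⟩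
  ext
  · simp [prod.lift_fst]
  · simp [prod.lift_snd, w]

theorem statement5 [HasBinaryProducts C] [EnoughInjectives C] :
    IsWFS (C := C) (fun _ _ f => Mono f) (RlpMono (C := C)) := by
  refine ⟨fun {X Y} f => ?_, fun {X Y} f => ⟨fun hf _ _ m hm => hm f hf, fun h => ?_⟩,
    fun _ => Iff.rfl⟩
  · exact ⟨Injective.under X ⨯ Y, prod.lift (Injective.ι X) f, prod.snd,
      prod.mono_lift_of_mono_left _ _, rlpMono_snd _ _, prod.lift_snd _ _⟩
  · obtain ⟨d, hd, -⟩ := h prod.snd (rlpMono_snd (Injective.under X) Y)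
      (prod.lift (Injective.ι X) f) (𝟙 Y) (by simp [prod.lift_snd])
    exact mono_of_mono_fac hd

end Stmt5
end

section
/- Let (E, M) be a factorization system of a category C with terminal object 1, and let F be an E-reflective full subcategory of C (i.e., F is reflective and all reflection morphisms lie in E), with reflector R and reflection morphisms ρ_A : A → RA. Then the following are equivalent: (i) F = F(M), the full subcategory of objects B with (B → 1) ∈ M; (ii) F is firmly E-reflective in C, meaning that any morphism A → B in E with B ∈ F serves as a reflection of A into F; (iii) E ⊆ R⁻¹(Iso C), i.e., R sends every morphism of E to an isomorphism. -/
/-!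
Statement 6 (Proposition 3.2, main part): For a factorization system (E, M) in a
category C with terminal object and an E-reflective full (replete) subcategory F
with reflector R and reflections ρ_A : A ⟶ RA, TFAE:
(i) F = F(M); (ii) F is firmly E-reflective; (iii) E ⊆ R⁻¹(Iso C).
-/

open CategoryTheory CategoryTheory.Limits List

universe v u

namespace Stmt6

variable {C : Type u} [Category.{v} C]

def UniqueLift {A B X Y : C} (e : A ⟶ B) (m : X ⟶ Y) : Prop :=
  ∀ (u : A ⟶ X) (v : B ⟶ Y), u ≫ m = e ≫ v →
    ∃! d : B ⟶ X, e ≫ d = u ∧ d ≫ m = v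

structure IsFS (E M : MorphismProperty C) : Prop where
  factor : ∀ {X Y : C} (f : X ⟶ Y),
    ∃ (Z : C) (e : X ⟶ Z) (m : Z ⟶ Y), E e ∧ M m ∧ e ≫ m = f
  left_iff : ∀ {X Y : C} (f : X ⟶ Y),
    E f ↔ ∀ {A B : C} (m : A ⟶ B), M m → UniqueLift f m
  right_iff : ∀ {X Y : C} (g : X ⟶ Y),
    M g ↔ ∀ {A B : C} (e : A ⟶ B), E e → UniqueLift e g

theorem UniqueLift.comp_left {A B D X Y : C} {e : A ⟶ B} {e' : B ⟶ D} {m : X ⟶ Y}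
    (h : UniqueLift e m) (h' : UniqueLift e' m) : UniqueLift (e ≫ e') m := by
  intro u v huv
  obtain ⟨d, ⟨hd, hdm⟩, hd_unique⟩ := h u (e' ≫ v) (by simpa using huv)
  obtain ⟨d', ⟨hd', hdm'⟩, hd_unique'⟩ := h' d v hdm
  refine ⟨d', ⟨by rw [Category.assoc, hd', hd], hdm'⟩, ?_⟩
  rintro k ⟨hk, hkm⟩
  exact hd_unique' k ⟨hd_unique (e' ≫ k) ⟨by simpa using hk, by simp [hkm]⟩, hkm⟩

theorem IsFS.comp_left {E M : MorphismProperty C} (hfs : IsFS E M) {A B D : C}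
    {e : A ⟶ B} {e' : B ⟶ D} (he : E e) (he' : E e') : E (e ≫ e') :=
  (hfs.left_iff _).2 fun m hm =>
    ((hfs.left_iff e).1 he m hm).comp_left ((hfs.left_iff e').1 he' m hm)

theorem uniqueLift_terminal_iff [HasTerminal C] {A B X : C} (e : A ⟶ B) :
    UniqueLift e (terminal.from X) ↔ ∀ u : A ⟶ X, ∃! d : B ⟶ X, e ≫ d = u := by
  refine ⟨fun h u => ?_, fun h u v _ => ?_⟩
  · simpa [Subsingleton.elim _ (terminal.from B)] using
      h u (terminal.from B) (Subsingleton.elim _ _)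
  · simpa [Subsingleton.elim _ v] using h u

theorem IsFS.right_terminal_iff [HasTerminal C] {E M : MorphismProperty C} (hfs : IsFS E M)
    (X : C) : M (terminal.from X) ↔
      ∀ {A B : C} (e : A ⟶ B), E e → ∀ u : A ⟶ X, ∃! d : B ⟶ X, e ≫ d = u := by
  simp only [hfs.right_iff, uniqueLift_terminal_iff]

theorem statement6 [HasTerminal C] (E M : MorphismProperty C) (hfs : IsFS E M)
    -- F : full replete subcategory, given by its class of objects
    (F : C → Prop) (hrep : ∀ {A B : C}, (A ≅ B) → F A → F B)
    -- reflector R with reflections ρ_A and action on morphisms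
    (R : C → C) (ρ : ∀ A : C, A ⟶ R A)
    (Rmap : ∀ {A B : C}, (A ⟶ B) → (R A ⟶ R B))
    (hRF : ∀ A : C, F (R A))
    (huniv : ∀ (A : C) {B : C}, F B → ∀ f : A ⟶ B, ∃! g : R A ⟶ B, ρ A ≫ g = f)
    (hnat : ∀ {A B : C} (f : A ⟶ B), ρ A ≫ Rmap f = f ≫ ρ B)
    -- F is E-reflective: all reflection morphisms lie in E
    (hEρ : ∀ A : C, E (ρ A)) :
    [ -- (i) F = F(M)
      ∀ B : C, F B ↔ M (terminal.from B),
      -- (ii) F is firmly E-reflective: every E-morphism into an object of F is a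
      -- reflection into F
      ∀ {A B : C} (e : A ⟶ B), E e → F B →
        ∀ {X : C}, F X → ∀ f : A ⟶ X, ∃! g : B ⟶ X, e ≫ g = f,
      -- (iii) E ⊆ R⁻¹(Iso C)
      ∀ {A B : C} (e : A ⟶ B), E e → IsIso (Rmap e) ].TFAE := by
  tfae_have 1 → 2 := fun h A B e he _ X hX =>
    (hfs.right_terminal_iff X).1 ((h X).1 hX) e he
  tfae_have 2 → 3 := by
    intro h A B e he
    have refl := @h _ _ (e ≫ ρ B) (hfs.comp_left he (hEρ B)) (hRF B)
    obtain ⟨g, hg, -⟩ := refl (hRF A) (ρ A)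
    refine ⟨g, (huniv A (hRF A) (ρ A)).unique ?_ (Category.comp_id _),
      (refl (hRF B) (e ≫ ρ B)).unique ?_ (Category.comp_id _)⟩
    · rw [← Category.assoc, hnat, hg]
    · rw [← Category.assoc, hg, hnat]
  tfae_have 3 → 1 := by
    intro h B
    rw [hfs.right_terminal_iff]
    refine ⟨fun hB A A' e he u => ?_, fun hB => ?_⟩
    · have := h e he
      obtain ⟨u', hu', -⟩ := huniv A hB u
      refine existsUnique_of_exists_of_unique
        ⟨ρ A' ≫ inv (Rmap e) ≫ u', ?_⟩ fun d d' hd hd' => ?_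
      · rw [← Category.assoc, ← hnat, Category.assoc, IsIso.hom_inv_id_assoc, hu']
      · obtain ⟨g, rfl, -⟩ := huniv A' hB d
        obtain ⟨g', rfl, -⟩ := huniv A' hB d'
        have hg : Rmap e ≫ g = Rmap e ≫ g' := (huniv A hB u).unique
          (by rw [← Category.assoc, hnat, Category.assoc, hd])
          (by rw [← Category.assoc, hnat, Category.assoc, hd'])
        rw [(cancel_epi (Rmap e)).1 hg]
    · obtain ⟨r, hr, -⟩ := hB (ρ B) (hEρ B) (𝟙 B)
      have hr' : r ≫ ρ B = 𝟙 (R B) := (huniv B (hRF B) (ρ B)).unique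
        (by rw [← Category.assoc, hr, Category.id_comp]) (Category.comp_id _)
      exact hrep ⟨r, ρ B, hr', hr⟩ (hRF B)
  tfae_finish

end Stmt6
end

section
/- Let (E, M) be a factorization system of a category C with terminal object 1, and let F be an E-reflective full subcategory of C with reflector R satisfying the equivalent conditions (F = F(M); F firmly E-reflective; E ⊆ R⁻¹(Iso C)). Then E = R⁻¹(Iso C) (the class of morphisms sent by R to isomorphisms) if, and only if, E satisfies the cancellation property: if gf ∈ E and g ∈ E, then f ∈ E. -/
/-!
Statement 7 (Proposition 3.2, addendum): For a factorization system (E, M) in a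
category C with terminal object and an E-reflective full subcategory F with
reflector R satisfying E ⊆ R⁻¹(Iso C) (one of the equivalent conditions of
Proposition 3.2), one has E = R⁻¹(Iso C) iff E satisfies:
gf ∈ E and g ∈ E imply f ∈ E.
-/

open CategoryTheory CategoryTheory.Limits

universe v u

namespace Stmt7

variable {C : Type u} [Category.{v} C]

def UniqueLift {A B X Y : C} (e : A ⟶ B) (m : X ⟶ Y) : Prop :=
  ∀ (u : A ⟶ X) (v : B ⟶ Y), u ≫ m = e ≫ v →
    ∃! d : B ⟶ X, e ≫ d = u ∧ d ≫ m = v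

structure IsFS (E M : MorphismProperty C) : Prop where
  factor : ∀ {X Y : C} (f : X ⟶ Y),
    ∃ (Z : C) (e : X ⟶ Z) (m : Z ⟶ Y), E e ∧ M m ∧ e ≫ m = f
  left_iff : ∀ {X Y : C} (f : X ⟶ Y),
    E f ↔ ∀ {A B : C} (m : A ⟶ B), M m → UniqueLift f m
  right_iff : ∀ {X Y : C} (g : X ⟶ Y),
    M g ↔ ∀ {A B : C} (e : A ⟶ B), E e → UniqueLift e g

/-- The left class of a factorization system is closed under composition with isomorphisms. -/
theorem IsFS.comp_isIso {E M : MorphismProperty C} (hfs : IsFS E M) {X Y Z : C}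
    {e : X ⟶ Y} (he : E e) (i : Y ⟶ Z) [IsIso i] : E (e ≫ i) := by
  rw [hfs.left_iff]
  intro A B m hm u v h
  obtain ⟨d, ⟨hd₁, hd₂⟩, hd⟩ := (hfs.left_iff e).1 he m hm u (i ≫ v) (by simpa using h)
  refine ⟨inv i ≫ d, ⟨by simpa using hd₁, by simp [hd₂]⟩, ?_⟩
  rintro d' ⟨h₁, h₂⟩
  rw [IsIso.eq_inv_comp]
  exact hd _ ⟨by simpa using h₁, by simp [h₂]⟩

theorem statement7 [HasTerminal C] (E M : MorphismProperty C) (hfs : IsFS E M)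
    (F : C → Prop) (hrep : ∀ {A B : C}, (A ≅ B) → F A → F B)
    (R : C → C) (ρ : ∀ A : C, A ⟶ R A)
    (Rmap : ∀ {A B : C}, (A ⟶ B) → (R A ⟶ R B))
    (hRF : ∀ A : C, F (R A))
    (huniv : ∀ (A : C) {B : C}, F B → ∀ f : A ⟶ B, ∃! g : R A ⟶ B, ρ A ≫ g = f)
    (hnat : ∀ {A B : C} (f : A ⟶ B), ρ A ≫ Rmap f = f ≫ ρ B)
    (hEρ : ∀ A : C, E (ρ A))
    -- the equivalent conditions of Proposition 3.2: E ⊆ R⁻¹(Iso C)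
    (hE_inv : ∀ {A B : C} (e : A ⟶ B), E e → IsIso (Rmap e)) :
    (∀ {A B : C} (f : A ⟶ B), E f ↔ IsIso (Rmap f)) ↔
      (∀ {X Y Z : C} (f : X ⟶ Y) (g : Y ⟶ Z), E (f ≫ g) → E g → E f) := by
  constructor
  · intro h X Y Z f g hfg hg
    have hcomp : Rmap (f ≫ g) = Rmap f ≫ Rmap g :=
      (huniv X (hRF Z) ((f ≫ g) ≫ ρ Z)).unique (hnat _) (by
        rw [← Category.assoc, hnat f, Category.assoc, hnat g, Category.assoc])
    have : IsIso (Rmap g) := hE_inv g hg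
    have : IsIso (Rmap f ≫ Rmap g) := hcomp ▸ hE_inv _ hfg
    exact (h f).2 (IsIso.of_isIso_comp_right (Rmap f) (Rmap g))
  · intro h A B f
    refine ⟨hE_inv f, fun _ => h f (ρ B) ?_ (hEρ B)⟩
    rw [← hnat f]
    exact hfs.comp_isIso (hEρ A) (Rmap f)

end Stmt7
end

section
/- Let F be a reflective full subcategory of a finitely complete category C, with reflector R and reflection morphisms ρ_A : A → RA. Then the pair (E, M) = (R⁻¹(Iso C), Cart(R, ρ)) is a factorization system of C if, and only if, for every morphism f : A → B the induced morphism e = (f, ρ_A) : A → B ×_{RB} RA into the pullback of Rf along ρ_B lies in E = R⁻¹(Iso C). In this case F = F(M). -/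
/-!
Statement 8 (Proposition 3.4, = Theorem 4.1 of [CHK]): For a reflective full
subcategory F of a finitely complete category C with reflector R and reflections
ρ_A : A ⟶ RA, the pair (R⁻¹(Iso C), Cart(R, ρ)) is a factorization system iff for
every f : A ⟶ B the comparison morphism (f, ρ_A) : A ⟶ B ×_{RB} RA lies in
R⁻¹(Iso C); in that case F = F(Cart(R, ρ)).
-/

open CategoryTheory CategoryTheory.Limits

universe v u

namespace Stmt8

variable {C : Type u} [Category.{v} C]

def UniqueLift {A B X Y : C} (e : A ⟶ B) (m : X ⟶ Y) : Prop :=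
  ∀ (u : A ⟶ X) (v : B ⟶ Y), u ≫ m = e ≫ v →
    ∃! d : B ⟶ X, e ≫ d = u ∧ d ≫ m = v

structure IsFS (E M : MorphismProperty C) : Prop where
  factor : ∀ {X Y : C} (f : X ⟶ Y),
    ∃ (Z : C) (e : X ⟶ Z) (m : Z ⟶ Y), E e ∧ M m ∧ e ≫ m = f
  left_iff : ∀ {X Y : C} (f : X ⟶ Y),
    E f ↔ ∀ {A B : C} (m : A ⟶ B), M m → UniqueLift f m
  right_iff : ∀ {X Y : C} (g : X ⟶ Y),
    M g ↔ ∀ {A B : C} (e : A ⟶ B), E e → UniqueLift e g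

/-! ### Unique lifting -/

theorem UniqueLift.of_isPullback {A B X Y X' Y' : C} {e : A ⟶ B} {m : X ⟶ Y} {m' : X' ⟶ Y'}
    {p : X ⟶ X'} {q : Y ⟶ Y'} (h : UniqueLift e m') (sq : IsPullback m p q m') :
    UniqueLift e m := by
  intro u v w
  obtain ⟨d, ⟨hd₁, hd₂⟩, hd⟩ := h (u ≫ p) (v ≫ q) (by
    rw [Category.assoc, ← sq.w, reassoc_of% w])
  refine ⟨sq.lift v d hd₂.symm, ⟨sq.hom_ext ?_ ?_, sq.lift_fst _ _ _⟩, ?_⟩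
  · rw [Category.assoc, sq.lift_fst, w]
  · rw [Category.assoc, sq.lift_snd, hd₁]
  · rintro t ⟨ht₁, ht₂⟩
    refine sq.hom_ext ?_ ?_
    · rw [sq.lift_fst, ht₂]
    · rw [sq.lift_snd]
      refine hd _ ⟨?_, ?_⟩
      · rw [reassoc_of% ht₁]
      · rw [Category.assoc, ← sq.w, reassoc_of% ht₂]

/-- The right factor of a morphism that lifts against it is an isomorphism. -/
theorem UniqueLift.isIso_right {X Y Z : C} {e : X ⟶ Z} {m : Z ⟶ Y} (hem : UniqueLift e m)
    (hf : UniqueLift (e ≫ m) m) : IsIso m := by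
  obtain ⟨d, ⟨hd₁, hd₂⟩, -⟩ := hf e (𝟙 Y) (Category.comp_id _).symm
  refine ⟨d, ?_, hd₂⟩
  refine (hem e m rfl).unique ⟨?_, ?_⟩ ⟨Category.comp_id _, Category.id_comp _⟩
  · rw [← Category.assoc, hd₁]
  · rw [Category.assoc, hd₂, Category.comp_id]

/-- The left factor of a morphism that it lifts against is an isomorphism. -/
theorem UniqueLift.isIso_left {X Y Z : C} {e : X ⟶ Z} {m : Z ⟶ Y} (hem : UniqueLift e m)
    (hf : UniqueLift e (e ≫ m)) : IsIso e := by
  obtain ⟨d, ⟨hd₁, hd₂⟩, -⟩ := hf (𝟙 X) m (Category.id_comp _)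
  refine ⟨d, hd₁, ?_⟩
  refine (hem e m rfl).unique ⟨?_, ?_⟩ ⟨Category.comp_id _, Category.id_comp _⟩
  · rw [reassoc_of% hd₁]
  · rw [Category.assoc, hd₂]

/-- A factorization into classes which lift against each other and absorb isomorphisms on the
appropriate side is a factorization system. -/
theorem IsFS.of_uniqueLift {E M : MorphismProperty C}
    (factor : ∀ {X Y : C} (f : X ⟶ Y),
      ∃ (Z : C) (e : X ⟶ Z) (m : Z ⟶ Y), E e ∧ M m ∧ e ≫ m = f)
    (lift : ∀ {A B X Y : C} (e : A ⟶ B) (m : X ⟶ Y), E e → M m → UniqueLift e m)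
    (hE : ∀ {X Z Y : C} (e : X ⟶ Z) (i : Z ⟶ Y) [IsIso i], E e → E (e ≫ i))
    (hM : ∀ {X Z Y : C} (i : X ⟶ Z) (m : Z ⟶ Y) [IsIso i], M m → M (i ≫ m)) :
    IsFS E M where
  factor := factor
  left_iff f := by
    refine ⟨fun he _ _ m hm => lift f m he hm, fun h => ?_⟩
    obtain ⟨Z, e, m, he, hm, rfl⟩ := factor f
    have := (lift e m he hm).isIso_right (h m hm)
    exact hE e m he
  right_iff f := by
    refine ⟨fun hm _ _ e he => lift e f he hm, fun h => ?_⟩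
    obtain ⟨Z, e, m, he, hm, rfl⟩ := factor f
    have := (lift e m he hm).isIso_left (h e he)
    exact hM e m hm

/-! ### Reflections -/

section Reflection

variable {F : C → Prop} {R : C → C} {ρ : ∀ A : C, A ⟶ R A}
  {Rmap : ∀ {A B : C}, (A ⟶ B) → (R A ⟶ R B)}

theorem reflection_hom_ext
    (huniv : ∀ (A : C) {B : C}, F B → ∀ f : A ⟶ B, ∃! g : R A ⟶ B, ρ A ≫ g = f)
    {A B : C} (hB : F B) {g h : R A ⟶ B} (w : ρ A ≫ g = ρ A ≫ h) : g = h :=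
  (huniv A hB _).unique w rfl

theorem isIso_reflection (hRF : ∀ A : C, F (R A))
    (huniv : ∀ (A : C) {B : C}, F B → ∀ f : A ⟶ B, ∃! g : R A ⟶ B, ρ A ≫ g = f)
    {B : C} {g : R B ⟶ B} (hg : ρ B ≫ g = 𝟙 B) : IsIso (ρ B) :=
  ⟨g, hg, reflection_hom_ext huniv (hRF B) (by rw [reassoc_of% hg, Category.comp_id])⟩

theorem mem_iff_isIso_reflection (hrep : ∀ {A B : C}, (A ≅ B) → F A → F B)
    (hRF : ∀ A : C, F (R A))
    (huniv : ∀ (A : C) {B : C}, F B → ∀ f : A ⟶ B, ∃! g : R A ⟶ B, ρ A ≫ g = f) (B : C) :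
    F B ↔ IsIso (ρ B) := by
  refine ⟨fun hB => ?_, fun _ => hrep (asIso (ρ B)).symm (hRF B)⟩
  obtain ⟨g, hg, -⟩ := huniv B hB (𝟙 B)
  exact isIso_reflection hRF huniv hg

theorem isIso_reflection_terminal [HasTerminal C] (hRF : ∀ A : C, F (R A))
    (huniv : ∀ (A : C) {B : C}, F B → ∀ f : A ⟶ B, ∃! g : R A ⟶ B, ρ A ≫ g = f) :
    IsIso (ρ (⊤_ C)) :=
  isIso_reflection hRF huniv (g := terminal.from _) (Subsingleton.elim _ _)

theorem reflector_map_comp (hRF : ∀ A : C, F (R A))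
    (huniv : ∀ (A : C) {B : C}, F B → ∀ f : A ⟶ B, ∃! g : R A ⟶ B, ρ A ≫ g = f)
    (hnat : ∀ {A B : C} (f : A ⟶ B), ρ A ≫ Rmap f = f ≫ ρ B)
    {X Y Z : C} (f : X ⟶ Y) (g : Y ⟶ Z) : Rmap (f ≫ g) = Rmap f ≫ Rmap g :=
  reflection_hom_ext huniv (hRF Z) (by
    rw [hnat, ← Category.assoc, hnat, Category.assoc, Category.assoc, hnat])

theorem reflector_map_id (hRF : ∀ A : C, F (R A))
    (huniv : ∀ (A : C) {B : C}, F B → ∀ f : A ⟶ B, ∃! g : R A ⟶ B, ρ A ≫ g = f)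
    (hnat : ∀ {A B : C} (f : A ⟶ B), ρ A ≫ Rmap f = f ≫ ρ B) (X : C) :
    Rmap (𝟙 X) = 𝟙 (R X) :=
  reflection_hom_ext huniv (hRF X) (by rw [hnat, Category.id_comp, Category.comp_id])

theorem isIso_reflector_map (hRF : ∀ A : C, F (R A))
    (huniv : ∀ (A : C) {B : C}, F B → ∀ f : A ⟶ B, ∃! g : R A ⟶ B, ρ A ≫ g = f)
    (hnat : ∀ {A B : C} (f : A ⟶ B), ρ A ≫ Rmap f = f ≫ ρ B)
    {X Y : C} (f : X ⟶ Y) [IsIso f] : IsIso (Rmap f) := by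
  refine ⟨Rmap (inv f), ?_, ?_⟩ <;>
    rw [← reflector_map_comp hRF huniv hnat] <;> simp [reflector_map_id hRF huniv hnat]

/-- Morphisms inverted by the reflector are orthogonal to the objects of the subcategory. -/
theorem existsUnique_extension
    (huniv : ∀ (A : C) {B : C}, F B → ∀ f : A ⟶ B, ∃! g : R A ⟶ B, ρ A ≫ g = f)
    (hnat : ∀ {A B : C} (f : A ⟶ B), ρ A ≫ Rmap f = f ≫ ρ B)
    {A B X : C} (e : A ⟶ B) (he : IsIso (Rmap e)) (hX : F X) (u : A ⟶ X) :
    ∃! d : B ⟶ X, e ≫ d = u := by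
  obtain ⟨g, rfl, -⟩ := huniv A hX u
  refine ⟨ρ B ≫ inv (Rmap e) ≫ g, ?_, ?_⟩
  · change e ≫ ρ B ≫ inv (Rmap e) ≫ g = ρ A ≫ g
    rw [← Category.assoc, ← hnat, Category.assoc, IsIso.hom_inv_id_assoc]
  · intro t ht
    obtain ⟨s, rfl, -⟩ := huniv B hX t
    congr 1
    rw [IsIso.eq_inv_comp]
    refine reflection_hom_ext huniv hX ?_
    rw [← Category.assoc, hnat, Category.assoc, ht]

theorem uniqueLift_of_isIso_reflector_map
    (huniv : ∀ (A : C) {B : C}, F B → ∀ f : A ⟶ B, ∃! g : R A ⟶ B, ρ A ≫ g = f)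
    (hnat : ∀ {A B : C} (f : A ⟶ B), ρ A ≫ Rmap f = f ≫ ρ B)
    {A B X Y : C} (e : A ⟶ B) (he : IsIso (Rmap e)) (hX : F X) (hY : F Y) (m : X ⟶ Y) :
    UniqueLift e m := by
  intro u v w
  obtain ⟨d, hd, hd'⟩ := existsUnique_extension huniv hnat e he hX u
  refine ⟨d, ⟨hd, ?_⟩, fun t ht => hd' t ht.1⟩
  refine (existsUnique_extension huniv hnat e he hY (e ≫ v)).unique ?_ rfl
  rw [← Category.assoc, hd, w]

/-- If the comparison morphism of `f` is inverted by the reflector, then the pullback of `Rmap f`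
along the reflection is cartesian. -/
theorem isPullback_fst_of_isIso_reflector_map_lift [HasPullbacks C] (hRF : ∀ A : C, F (R A))
    (huniv : ∀ (A : C) {B : C}, F B → ∀ f : A ⟶ B, ∃! g : R A ⟶ B, ρ A ≫ g = f)
    (hnat : ∀ {A B : C} (f : A ⟶ B), ρ A ≫ Rmap f = f ≫ ρ B) {A B : C} (f : A ⟶ B)
    (hf : IsIso (Rmap (pullback.lift f (ρ A) (hnat f).symm : A ⟶ pullback (ρ B) (Rmap f)))) :
    IsPullback (pullback.fst (ρ B) (Rmap f)) (ρ _) (ρ B)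
      (Rmap (pullback.fst (ρ B) (Rmap f))) := by
  set c : A ⟶ pullback (ρ B) (Rmap f) := pullback.lift f (ρ A) (hnat f).symm with hc
  have hc₂ : c ≫ pullback.snd (ρ B) (Rmap f) = ρ A := pullback.lift_snd _ _ _
  obtain ⟨g, hg, -⟩ := huniv _ (hRF A) (pullback.snd (ρ B) (Rmap f))
  have hcg : Rmap c ≫ g = 𝟙 (R A) := reflection_hom_ext huniv (hRF A) (by
    rw [← Category.assoc, hnat, Category.assoc, hg, hc₂, Category.comp_id])
  have hg_iso : IsIso g := by
    rw [← IsIso.inv_eq_of_hom_inv_id hcg]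
    infer_instance
  have hgf : g ≫ Rmap f = Rmap (pullback.fst (ρ B) (Rmap f)) :=
    reflection_hom_ext huniv (hRF B) (by
      rw [← Category.assoc, hg, hnat, pullback.condition])
  exact (IsPullback.of_hasPullback (ρ B) (Rmap f)).of_iso (Iso.refl _) (Iso.refl _)
    (asIso g).symm (Iso.refl _) (by simp) (by simp [← hg]) (by simp) (by simp [← hgf])

/-- If `e ≫ m` factors through a cartesian `m` with `e` inverted by the reflector, then its
comparison morphism is inverted by the reflector. -/
theorem isIso_reflector_map_lift [HasPullbacks C] (hRF : ∀ A : C, F (R A))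
    (huniv : ∀ (A : C) {B : C}, F B → ∀ f : A ⟶ B, ∃! g : R A ⟶ B, ρ A ≫ g = f)
    (hnat : ∀ {A B : C} (f : A ⟶ B), ρ A ≫ Rmap f = f ≫ ρ B) {A B Z : C}
    (e : A ⟶ Z) (m : Z ⟶ B) (he : IsIso (Rmap e)) (hm : IsPullback m (ρ Z) (ρ B) (Rmap m)) :
    IsIso (Rmap (pullback.lift (e ≫ m) (ρ A) (hnat (e ≫ m)).symm :
      A ⟶ pullback (ρ B) (Rmap (e ≫ m)))) := by
  have sq : IsPullback m (ρ Z ≫ inv (Rmap e)) (ρ B) (Rmap (e ≫ m)) :=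
    hm.of_iso (Iso.refl _) (Iso.refl _) (asIso (Rmap e)).symm (Iso.refl _) (by simp) (by simp)
      (by simp) (by simp [reflector_map_comp hRF huniv hnat])
  have h : pullback.lift (e ≫ m) (ρ A) (hnat (e ≫ m)).symm = e ≫ sq.isoPullback.hom := by
    refine pullback.hom_ext ?_ ?_
    · exact (pullback.lift_fst _ _ _).trans (by simp)
    · exact (pullback.lift_snd _ _ _).trans (by simp [← reassoc_of% hnat e])
  rw [h, reflector_map_comp hRF huniv hnat e sq.isoPullback.hom]
  have := isIso_reflector_map hRF huniv hnat sq.isoPullback.hom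
  infer_instance

end Reflection

theorem statement8 [HasFiniteLimits C]
    -- F : reflective full (replete) subcategory with reflector R, reflection ρ
    (F : C → Prop) (hrep : ∀ {A B : C}, (A ≅ B) → F A → F B)
    (R : C → C) (ρ : ∀ A : C, A ⟶ R A)
    (Rmap : ∀ {A B : C}, (A ⟶ B) → (R A ⟶ R B))
    (hRF : ∀ A : C, F (R A))
    (huniv : ∀ (A : C) {B : C}, F B → ∀ f : A ⟶ B, ∃! g : R A ⟶ B, ρ A ≫ g = f)
    (hnat : ∀ {A B : C} (f : A ⟶ B), ρ A ≫ Rmap f = f ≫ ρ B) :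
    -- (E, M) = (R⁻¹(Iso C), Cart(R, ρ)) is an fs iff all comparison morphisms
    -- A ⟶ B ×_{RB} RA lie in E = R⁻¹(Iso C)
    (IsFS (C := C) (fun _ _ f => IsIso (Rmap f))
        (fun A B f => IsPullback f (ρ A) (ρ B) (Rmap f)) ↔
      ∀ {A B : C} (f : A ⟶ B),
        IsIso (Rmap (pullback.lift f (ρ A) (hnat f).symm :
          A ⟶ pullback (ρ B) (Rmap f)))) ∧
    -- in this case, F = F(M)
    (IsFS (C := C) (fun _ _ f => IsIso (Rmap f))
        (fun A B f => IsPullback f (ρ A) (ρ B) (Rmap f)) →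
      ∀ B : C, F B ↔
        IsPullback (terminal.from B) (ρ B) (ρ (⊤_ C)) (Rmap (terminal.from B))) := by
  refine ⟨⟨fun h A B f => ?_, fun h => ?_⟩, fun _ B => ?_⟩
  · obtain ⟨Z, e, m, he, hm, rfl⟩ := h.factor f
    exact isIso_reflector_map_lift hRF huniv hnat e m he hm
  · refine IsFS.of_uniqueLift (fun {X Y} f => ?_) (fun e m he hm => ?_)
      (fun e i _ he => ?_) (fun i m _ hm => ?_)
    · exact ⟨_, _, _, h f,
        isPullback_fst_of_isIso_reflector_map_lift hRF huniv hnat f (h f),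
        pullback.lift_fst _ _ _⟩
    · exact (uniqueLift_of_isIso_reflector_map huniv hnat e he (hRF _) (hRF _)
        (Rmap m)).of_isPullback hm
    · have he : IsIso (Rmap e) := he
      have := isIso_reflector_map hRF huniv hnat i
      rw [reflector_map_comp hRF huniv hnat]
      infer_instance
    · have := isIso_reflector_map hRF huniv hnat i
      rw [reflector_map_comp hRF huniv hnat]
      exact (IsPullback.of_horiz_isIso ⟨(hnat i).symm⟩).paste_horiz hm
  · have := isIso_reflection_terminal hRF huniv
    rw [mem_iff_isIso_reflection hrep hRF huniv]
    exact ⟨fun _ => IsPullback.of_vert_isIso ⟨(hnat _).symm⟩,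
      fun sq => sq.isIso_snd_of_isIso⟩

end Stmt8
end

section
/- Let (E, M) be a reflective factorization system of a finitely complete category C, with R the reflector of the E-reflective subcategory F(M) and ρ the reflection. Then the following are equivalent: (i) E is stable under pullback along morphisms in M; (ii) R preserves pullbacks of morphisms in M along arbitrary morphisms; (iii) the pullback of a reflection ρ_A : A → RA along a morphism of F(M) is again a reflection morphism. Moreover, these conditions imply that (E, M) is simple, i.e., M = Cart(R, ρ). -/
/-!
Statement 9 (Proposition 3.5, = Theorem 4.3 of [CHK]): For a reflective
factorization system (E, M) of a finitely complete category C, with reflector R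
of F(M) and reflections ρ, TFAE: (i) E is stable under pullback along M;
(ii) R preserves pullbacks of M-morphisms along arbitrary morphisms;
(iii) the pullback of a reflection ρ_A along a morphism of F(M) is again a
reflection morphism. Moreover these conditions imply simplicity: M = Cart(R, ρ).
-/

open CategoryTheory CategoryTheory.Limits List

universe v u

namespace Stmt9

variable {C : Type u} [Category.{v} C]

def UniqueLift {A B X Y : C} (e : A ⟶ B) (m : X ⟶ Y) : Prop :=
  ∀ (u : A ⟶ X) (v : B ⟶ Y), u ≫ m = e ≫ v →
    ∃! d : B ⟶ X, e ≫ d = u ∧ d ≫ m = v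

structure IsFS (E M : MorphismProperty C) : Prop where
  factor : ∀ {X Y : C} (f : X ⟶ Y),
    ∃ (Z : C) (e : X ⟶ Z) (m : Z ⟶ Y), E e ∧ M m ∧ e ≫ m = f
  left_iff : ∀ {X Y : C} (f : X ⟶ Y),
    E f ↔ ∀ {A B : C} (m : A ⟶ B), M m → UniqueLift f m
  right_iff : ∀ {X Y : C} (g : X ⟶ Y),
    M g ↔ ∀ {A B : C} (e : A ⟶ B), E e → UniqueLift e g

namespace IsFS

variable {E M : MorphismProperty C}

lemma left_comp (h : IsFS E M) {X Y Z : C} {f : X ⟶ Y} {g : Y ⟶ Z} (hf : E f) (hg : E g) :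
    E (f ≫ g) := by
  rw [h.left_iff]
  intro A B m hm u v w
  obtain ⟨d, ⟨hd₁, hd₂⟩, hd⟩ :=
    (h.left_iff f).1 hf m hm u (g ≫ v) (by simpa using w)
  obtain ⟨d', ⟨hd₁', hd₂'⟩, hd'⟩ := (h.left_iff g).1 hg m hm d v hd₂
  refine ⟨d', ⟨by simp [hd₁', hd₁], hd₂'⟩, ?_⟩
  rintro k ⟨hk₁, hk₂⟩
  exact hd' k ⟨hd _ ⟨by simpa using hk₁, by simp [hk₂]⟩, hk₂⟩

lemma right_comp (h : IsFS E M) {X Y Z : C} {f : X ⟶ Y} {g : Y ⟶ Z} (hf : M f) (hg : M g) :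
    M (f ≫ g) := by
  rw [h.right_iff]
  intro A B e he u v w
  obtain ⟨d, ⟨hd₁, hd₂⟩, hd⟩ :=
    (h.right_iff g).1 hg e he (u ≫ f) v (by simpa using w)
  obtain ⟨d', ⟨hd₁', hd₂'⟩, hd'⟩ := (h.right_iff f).1 hf e he u d hd₁.symm
  refine ⟨d', ⟨hd₁', by rw [reassoc_of% hd₂', hd₂]⟩, ?_⟩
  rintro k ⟨hk₁, hk₂⟩
  exact hd' k ⟨hk₁, hd _ ⟨by rw [reassoc_of% hk₁], by simpa using hk₂⟩⟩

lemma left_of_comp (h : IsFS E M) {X Y Z : C} {f : X ⟶ Y} {g : Y ⟶ Z} (hf : E f)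
    (hfg : E (f ≫ g)) : E g := by
  rw [h.left_iff]
  intro A B m hm u v w
  obtain ⟨d, ⟨hd₁, hd₂⟩, hd⟩ :=
    (h.left_iff _).1 hfg m hm (f ≫ u) v (by simp [w])
  refine ⟨d, ⟨?_, hd₂⟩, ?_⟩
  · exact ((h.left_iff f).1 hf m hm (f ≫ u) (g ≫ v) (by simp [w])).unique
      ⟨by simpa using hd₁, by simp [hd₂]⟩ ⟨rfl, w⟩
  · rintro k ⟨hk₁, hk₂⟩
    exact hd k ⟨by simp [hk₁], hk₂⟩

lemma right_of_comp (h : IsFS E M) {X Y Z : C} {f : X ⟶ Y} {g : Y ⟶ Z} (hg : M g)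
    (hfg : M (f ≫ g)) : M f := by
  rw [h.right_iff]
  intro A B e he u v w
  obtain ⟨d, ⟨hd₁, hd₂⟩, hd⟩ :=
    (h.right_iff _).1 hfg e he u (v ≫ g) (by rw [reassoc_of% w])
  refine ⟨d, ⟨hd₁, ?_⟩, ?_⟩
  · exact ((h.right_iff g).1 hg e he (e ≫ v) (v ≫ g) (by simp)).unique
      ⟨by rw [reassoc_of% hd₁, w], by simpa using hd₂⟩ ⟨rfl, rfl⟩
  · rintro k ⟨hk₁, hk₂⟩
    exact hd k ⟨hk₁, by rw [reassoc_of% hk₂]⟩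

lemma right_of_isPullback (h : IsFS E M) {P X Y Z : C} {p₁ : P ⟶ X} {p₂ : P ⟶ Y} {f : X ⟶ Z}
    {g : Y ⟶ Z} (sq : IsPullback p₁ p₂ f g) (hf : M f) : M p₂ := by
  rw [h.right_iff]
  intro A B e he u v w
  obtain ⟨d, ⟨hd₁, hd₂⟩, hd⟩ := (h.right_iff f).1 hf e he (u ≫ p₁) (v ≫ g)
    (by rw [Category.assoc, sq.w, reassoc_of% w])
  refine ⟨sq.lift d v hd₂, ⟨?_, by simp⟩, ?_⟩
  · apply sq.hom_ext <;> simp [hd₁, w]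
  · rintro k ⟨hk₁, hk₂⟩
    apply sq.hom_ext
    · rw [sq.lift_fst]
      exact hd _ ⟨by rw [reassoc_of% hk₁], by rw [Category.assoc, sq.w, reassoc_of% hk₂]⟩
    · simp [hk₂]

lemma left_of_isIso (h : IsFS E M) {X Y : C} (f : X ⟶ Y) [IsIso f] : E f := by
  rw [h.left_iff]
  intro A B m _ u v w
  refine ⟨inv f ≫ u, ⟨by simp, by simp [w]⟩, ?_⟩
  rintro k ⟨rfl, -⟩
  simp

lemma isIso_of_left_right (h : IsFS E M) {X Y : C} {f : X ⟶ Y} (hE : E f) (hM : M f) :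
    IsIso f := by
  obtain ⟨d, ⟨hd₁, hd₂⟩, -⟩ := (h.left_iff f).1 hE f hM (𝟙 X) (𝟙 Y) (by simp)
  exact ⟨d, hd₁, hd₂⟩

section Terminal

variable [HasTerminal C]

/-- Every morphism between objects of `F(M)` is in `M`. -/
lemma right_of_terminal (h : IsFS E M) {X Y : C} (f : X ⟶ Y) (hX : M (terminal.from X))
    (hY : M (terminal.from Y)) : M f :=
  h.right_of_comp hY (by rwa [terminal.comp_from])

lemma terminal_of_right (h : IsFS E M) {X Y : C} {f : X ⟶ Y} (hf : M f)
    (hY : M (terminal.from Y)) : M (terminal.from X) := by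
  rw [← terminal.comp_from f]
  exact h.right_comp hf hY

/-- Morphisms in `E` have the universal property of a reflection with respect to `F(M)`. -/
lemma existsUnique_of_left (h : IsFS E M) {A B X : C} {e : A ⟶ B} (he : E e)
    (hX : M (terminal.from X)) (f : A ⟶ X) : ∃! t : B ⟶ X, e ≫ t = f := by
  obtain ⟨d, ⟨hd₁, -⟩, hd⟩ := (h.left_iff e).1 he _ hX f (terminal.from B) (by simp)
  exact ⟨d, hd₁, fun k hk => hd k ⟨hk, by simp⟩⟩

/-- A morphism into `F(M)` with the universal property of a reflection is in `E`. -/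
lemma left_of_existsUnique (h : IsFS E M) {P B : C} {p : P ⟶ B} (hB : M (terminal.from B))
    (hp : ∀ {X : C}, M (terminal.from X) → ∀ f : P ⟶ X, ∃! t : B ⟶ X, p ≫ t = f) : E p := by
  obtain ⟨Z, e, m, he, hm, rfl⟩ := h.factor p
  have hZ := h.terminal_of_right hm hB
  obtain ⟨t, ht, -⟩ := hp hZ e
  have hmt : m ≫ t = 𝟙 Z :=
    (h.existsUnique_of_left he hZ e).unique (by simpa using ht) (by simp)
  have htm : t ≫ m = 𝟙 B :=
    (hp hB (e ≫ m)).unique (by rw [← Category.assoc, ht]) (by simp)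
  have : IsIso m := ⟨t, hmt, htm⟩
  exact h.left_comp he (h.left_of_isIso m)

end Terminal

section Reflection

variable {R : C → C} {ρ : ∀ A : C, A ⟶ R A}
  {Rmap : ∀ {A B : C}, (A ⟶ B) → (R A ⟶ R B)}

lemma left_of_isIso_map (h : IsFS E M)
    (hrefl : ∀ {X Y Z : C} (f : X ⟶ Y) (g : Y ⟶ Z), E (f ≫ g) → E g → E f)
    (hEρ : ∀ A : C, E (ρ A))
    (hnat : ∀ {A B : C} (f : A ⟶ B), ρ A ≫ Rmap f = f ≫ ρ B) {A B : C} (f : A ⟶ B)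
    [IsIso (Rmap f)] : E f := by
  refine hrefl f (ρ B) ?_ (hEρ B)
  rw [← hnat]
  exact h.left_comp (hEρ A) (h.left_of_isIso _)

variable [HasFiniteLimits C]

lemma isIso_map (h : IsFS E M) (hRF : ∀ A : C, M (terminal.from (R A))) (hEρ : ∀ A : C, E (ρ A))
    (hnat : ∀ {A B : C} (f : A ⟶ B), ρ A ≫ Rmap f = f ≫ ρ B) {A B : C} {f : A ⟶ B} (hf : E f) :
    IsIso (Rmap f) := by
  refine h.isIso_of_left_right (h.left_of_comp (hEρ A) ?_) (h.right_of_terminal _ (hRF A) (hRF B))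
  rw [hnat]
  exact h.left_comp hf (hEρ B)

lemma right_iff_isPullback (h : IsFS E M)
    (hrefl : ∀ {X Y Z : C} (f : X ⟶ Y) (g : Y ⟶ Z), E (f ≫ g) → E g → E f)
    (hRF : ∀ A : C, M (terminal.from (R A))) (hEρ : ∀ A : C, E (ρ A))
    (hnat : ∀ {A B : C} (f : A ⟶ B), ρ A ≫ Rmap f = f ≫ ρ B)
    (hpb : ∀ {P A B : C} (p₁ : P ⟶ B) (p₂ : P ⟶ A) (g : B ⟶ R A),
      M (terminal.from B) → IsPullback p₁ p₂ g (ρ A) → E p₁)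
    {A B : C} (f : A ⟶ B) : M f ↔ IsPullback f (ρ A) (ρ B) (Rmap f) := by
  have hRf : M (Rmap f) := h.right_of_terminal _ (hRF A) (hRF B)
  refine ⟨fun hf => ?_, fun sq => h.right_of_isPullback sq.flip hRf⟩
  have sq := IsPullback.of_hasPullback (Rmap f) (ρ B)
  obtain ⟨c, hc₁, hc₂⟩ := sq.exists_lift (ρ A) f (hnat f)
  have hcE : E c := hrefl c (pullback.fst _ _) (hc₁.symm ▸ hEρ A)
    (hpb _ _ _ (hRF A) sq)
  have hcM : M c := h.right_of_comp (h.right_of_isPullback sq hRf) (hc₂.symm ▸ hf)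
  have := h.isIso_of_left_right hcE hcM
  exact (sq.of_iso (asIso c).symm (Iso.refl _) (Iso.refl _) (Iso.refl _)
    (by simp [hc₁]) (by simp [hc₂]) (by simp) (by simp)).flip

lemma isPullback_map (h : IsFS E M)
    (hrefl : ∀ {X Y Z : C} (f : X ⟶ Y) (g : Y ⟶ Z), E (f ≫ g) → E g → E f)
    (hRF : ∀ A : C, M (terminal.from (R A))) (hEρ : ∀ A : C, E (ρ A))
    (hnat : ∀ {A B : C} (f : A ⟶ B), ρ A ≫ Rmap f = f ≫ ρ B)
    (hRcomp : ∀ {A B D : C} (f : A ⟶ B) (g : B ⟶ D), Rmap (f ≫ g) = Rmap f ≫ Rmap g)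
    (hpb : ∀ {P A B : C} (p₁ : P ⟶ B) (p₂ : P ⟶ A) (g : B ⟶ R A),
      M (terminal.from B) → IsPullback p₁ p₂ g (ρ A) → E p₁)
    {P X Y Z : C} {p₁ : P ⟶ X} {p₂ : P ⟶ Y} {f : X ⟶ Z} {g : Y ⟶ Z}
    (sq : IsPullback p₁ p₂ f g) (hf : M f) :
    IsPullback (Rmap p₁) (Rmap p₂) (Rmap f) (Rmap g) := by
  have w : Rmap p₁ ≫ Rmap f = Rmap p₂ ≫ Rmap g := by rw [← hRcomp, ← hRcomp, sq.w]
  have sqR := IsPullback.of_hasPullback (Rmap f) (Rmap g)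
  have hsnd : M (pullback.snd (Rmap f) (Rmap g)) :=
    h.right_of_isPullback sqR (h.right_of_terminal _ (hRF X) (hRF Z))
  have hQ := h.terminal_of_right hsnd (hRF Y)
  obtain ⟨t, ht₁, ht₂⟩ := sqR.exists_lift _ _ w
  have sqX := ((right_iff_isPullback h hrefl hRF hEρ hnat hpb f).1 hf).flip
  -- `P` is the pullback of `Rmap f` along `g ≫ ρ Z = ρ Y ≫ Rmap g`.
  have sqP : IsPullback (p₁ ≫ ρ X) p₂ (Rmap f) (ρ Y ≫ Rmap g) := by
    rw [hnat]
    exact sq.paste_horiz sqX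
  have sqY : IsPullback (ρ P ≫ t) p₂ (pullback.snd (Rmap f) (Rmap g)) (ρ Y) := by
    refine IsPullback.of_right (h₁₂ := pullback.fst _ _) (h₂₂ := Rmap g) ?_ ?_ sqR
    · rwa [Category.assoc, ht₁, hnat]
    · rw [Category.assoc, ht₂, hnat]
  have htE : E t := h.left_of_comp (hEρ P) (hpb _ _ _ hQ sqY)
  have := h.isIso_of_left_right htE (h.right_of_terminal t (hRF P) hQ)
  exact sqR.of_iso (asIso t).symm (Iso.refl _) (Iso.refl _) (Iso.refl _)
    (by simp [ht₁]) (by simp [ht₂]) (by simp) (by simp)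

lemma left_of_isPullback (h : IsFS E M)
    (hrefl : ∀ {X Y Z : C} (f : X ⟶ Y) (g : Y ⟶ Z), E (f ≫ g) → E g → E f)
    (hRF : ∀ A : C, M (terminal.from (R A))) (hEρ : ∀ A : C, E (ρ A))
    (hnat : ∀ {A B : C} (f : A ⟶ B), ρ A ≫ Rmap f = f ≫ ρ B)
    (hpb : ∀ {P A B : C} (p₁ : P ⟶ B) (p₂ : P ⟶ A) (g : B ⟶ R A),
      M (terminal.from B) → IsPullback p₁ p₂ g (ρ A) → E p₁)
    {P X Y Z : C} {p₁ : P ⟶ X} {p₂ : P ⟶ Y} {f : X ⟶ Z} {g : Y ⟶ Z}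
    (sq : IsPullback p₁ p₂ f g) (hf : E f) (hg : M g) : E p₂ := by
  have sqY := (right_iff_isPullback h hrefl hRF hEρ hnat hpb g).1 hg
  have := isIso_map h hRF hEρ hnat hf
  have sqP : IsPullback (p₂ ≫ ρ Y) p₁ (Rmap g) (ρ X ≫ Rmap f) := by
    rw [hnat]
    exact sq.flip.paste_horiz sqY.flip
  have sqX : IsPullback (p₂ ≫ ρ Y) p₁ (Rmap g ≫ inv (Rmap f)) (ρ X) :=
    sqP.of_iso (Iso.refl _) (Iso.refl _) (Iso.refl _) (asIso (Rmap f)).symm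
      (by simp) (by simp) (by simp) (by simp)
  exact hrefl p₂ (ρ Y) (hpb _ _ _ (hRF Y) sqX) (hEρ Y)

end Reflection

end IsFS

theorem statement9 [HasFiniteLimits C]
    (E M : MorphismProperty C) (hfs : IsFS E M)
    -- (E, M) is reflective: E satisfies the 3-for-2 style cancellation (4)
    (hrefl : ∀ {X Y Z : C} (f : X ⟶ Y) (g : Y ⟶ Z), E (f ≫ g) → E g → E f)
    -- R : reflector of the E-reflective subcategory F(M), with reflections ρ
    (R : C → C) (ρ : ∀ A : C, A ⟶ R A)
    (Rmap : ∀ {A B : C}, (A ⟶ B) → (R A ⟶ R B))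
    (hRF : ∀ A : C, M (terminal.from (R A)))
    (hEρ : ∀ A : C, E (ρ A))
    (huniv : ∀ (A : C) {B : C}, M (terminal.from B) →
      ∀ f : A ⟶ B, ∃! g : R A ⟶ B, ρ A ≫ g = f)
    (hnat : ∀ {A B : C} (f : A ⟶ B), ρ A ≫ Rmap f = f ≫ ρ B)
    (hRid : ∀ A : C, Rmap (𝟙 A) = 𝟙 (R A))
    (hRcomp : ∀ {A B D : C} (f : A ⟶ B) (g : B ⟶ D),
      Rmap (f ≫ g) = Rmap f ≫ Rmap g) :
    ([ -- (i) E is stable under pullback along morphisms in M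
       ∀ {P X Y Z : C} (p₁ : P ⟶ X) (p₂ : P ⟶ Y) (f : X ⟶ Z) (g : Y ⟶ Z),
         IsPullback p₁ p₂ f g → E f → M g → E p₂,
       -- (ii) R preserves pullbacks of morphisms in M along arbitrary morphisms
       ∀ {P X Y Z : C} (p₁ : P ⟶ X) (p₂ : P ⟶ Y) (f : X ⟶ Z) (g : Y ⟶ Z),
         IsPullback p₁ p₂ f g → M f →
           IsPullback (Rmap p₁) (Rmap p₂) (Rmap f) (Rmap g),
       -- (iii) the pullback of a reflection ρ_A along a morphism of F(M) is a
       -- reflection morphism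
       ∀ {P A B : C} (p₁ : P ⟶ B) (p₂ : P ⟶ A) (g : B ⟶ R A),
         M (terminal.from B) → IsPullback p₁ p₂ g (ρ A) →
           ∀ {X : C}, M (terminal.from X) →
             ∀ f : P ⟶ X, ∃! t : B ⟶ X, p₁ ≫ t = f ].TFAE) ∧
    -- these conditions imply simplicity: M = Cart(R, ρ)
    ((∀ {P X Y Z : C} (p₁ : P ⟶ X) (p₂ : P ⟶ Y) (f : X ⟶ Z) (g : Y ⟶ Z),
        IsPullback p₁ p₂ f g → E f → M g → E p₂) →
      ∀ {A B : C} (f : A ⟶ B), M f ↔ IsPullback f (ρ A) (ρ B) (Rmap f)) := by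
  constructor
  · tfae_have 1 → 2 := fun hi P X Y Z p₁ p₂ f g sq hf =>
      hfs.isPullback_map hrefl hRF hEρ hnat hRcomp
        (fun {_ A _} _ _ g hB sq =>
          hi _ _ _ g sq.flip (hEρ A) (hfs.right_of_terminal g hB (hRF A))) sq hf
    tfae_have 2 → 3 := by
      intro hii P A B p₁ p₂ g hB sq X hX f
      have := hfs.isIso_map hRF hEρ hnat (hEρ A)
      have : IsIso (Rmap p₁) :=
        (hii _ _ _ _ sq (hfs.right_of_terminal g hB (hRF A))).isIso_fst_of_isIso
      exact hfs.existsUnique_of_left (hfs.left_of_isIso_map hrefl hEρ hnat p₁) hX f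
    tfae_have 3 → 1 := fun hiii P X Y Z p₁ p₂ f g sq hf hg =>
      hfs.left_of_isPullback hrefl hRF hEρ hnat
        (fun p₁ p₂ g hB sq => hfs.left_of_existsUnique hB (hiii p₁ p₂ g hB sq)) sq hf hg
    tfae_finish
  · intro hi A B f
    exact hfs.right_iff_isPullback hrefl hRF hEρ hnat
      (fun {_ A _} _ _ g hB sq =>
        hi _ _ _ g sq.flip (hEρ A) (hfs.right_of_terminal g hB (hRF A))) f

end Stmt9
end

section
/- In a finitely complete category C, a pair (E, M) is a simple reflective factorization system of C if, and only if, there exists a prefibration P : C → B preserving the terminal object such that E = P⁻¹(Iso B) (the morphisms inverted by P) and M = Cart P (the P-cartesian morphisms). -/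
/-!
Statement 11 (Theorem 3.9, first part): In a finitely complete category C,
(E, M) is a simple reflective factorization system iff there is a prefibration
P : C ⥤ B preserving the terminal object with E = P⁻¹(Iso B) and M = Cart P.
-/

open CategoryTheory CategoryTheory.Limits

universe v u

namespace Stmt11

variable {C : Type u} [Category.{v} C]

def UniqueLift {A B X Y : C} (e : A ⟶ B) (m : X ⟶ Y) : Prop :=
  ∀ (u : A ⟶ X) (v : B ⟶ Y), u ≫ m = e ≫ v →
    ∃! d : B ⟶ X, e ≫ d = u ∧ d ≫ m = v

structure IsFS (E M : MorphismProperty C) : Prop where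
  factor : ∀ {X Y : C} (f : X ⟶ Y),
    ∃ (Z : C) (e : X ⟶ Z) (m : Z ⟶ Y), E e ∧ M m ∧ e ≫ m = f
  left_iff : ∀ {X Y : C} (f : X ⟶ Y),
    E f ↔ ∀ {A B : C} (m : A ⟶ B), M m → UniqueLift f m
  right_iff : ∀ {X Y : C} (g : X ⟶ Y),
    M g ↔ ∀ {A B : C} (e : A ⟶ B), E e → UniqueLift e g

/-- `(E, M)` is a simple reflective factorization system: an fs with E satisfying
the extra cancellation property (so that F(M) is E-reflective with reflector R,
reflection ρ), such that moreover M = Cart(R, ρ). -/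
def IsSimpleReflectiveFS [HasTerminal C] (E M : MorphismProperty C) : Prop :=
  IsFS E M ∧
  (∀ {X Y Z : C} (f : X ⟶ Y) (g : Y ⟶ Z), E (f ≫ g) → E g → E f) ∧
  ∃ (R : C → C) (ρ : ∀ X : C, X ⟶ R X)
    (Rmap : ∀ (X Y : C), (X ⟶ Y) → (R X ⟶ R Y)),
    (∀ X : C, M (terminal.from (R X))) ∧
    (∀ X : C, E (ρ X)) ∧
    (∀ (X : C) {Y : C}, M (terminal.from Y) →
      ∀ f : X ⟶ Y, ∃! g : R X ⟶ Y, ρ X ≫ g = f) ∧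
    (∀ {X Y : C} (f : X ⟶ Y), ρ X ≫ Rmap X Y f = f ≫ ρ Y) ∧
    (∀ {X Y : C} (f : X ⟶ Y), M f ↔ IsPullback f (ρ X) (ρ Y) (Rmap X Y f))

/-- `P : C ⥤ D` is a prefibration: each induced functor `P_X : C/X ⥤ D/PX` has a
right adjoint (expressed elementwise by universal lifts `(Z, v, ε)` of morphisms
`g : Y ⟶ P X`), and the induced monad is idempotent (the unit `η_f` of the
canonical factorization of any `f : A ⟶ X` is inverted by `P`). -/
def IsPrefibration {D : Type u} [Category.{v} D] (P : C ⥤ D) : Prop :=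
  (∀ {X : C} {Y : D} (g : Y ⟶ P.obj X),
    ∃ (Z : C) (v : Z ⟶ X) (ε : P.obj Z ⟶ Y),
      ε ≫ g = P.map v ∧
      ∀ {A : C} (f : A ⟶ X) (u : P.obj A ⟶ Y), u ≫ g = P.map f →
        ∃! t : A ⟶ Z, t ≫ v = f ∧ P.map t ≫ ε = u) ∧
  (∀ {A X : C} (f : A ⟶ X) (Z : C) (v : Z ⟶ X) (ε : P.obj Z ⟶ P.obj A),
      ε ≫ P.map f = P.map v →
      (∀ {A' : C} (f' : A' ⟶ X) (u : P.obj A' ⟶ P.obj A),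
          u ≫ P.map f = P.map f' →
          ∃! t : A' ⟶ Z, t ≫ v = f' ∧ P.map t ≫ ε = u) →
      ∀ η : A ⟶ Z, η ≫ v = f → P.map η ≫ ε = 𝟙 (P.obj A) → IsIso (P.map η))

/-- `f` is `P`-cartesian: the unit `η_f : A ⟶ (Pf)*X` of the canonical
factorization of `f` through an adjoint lift `(Z, v, ε)` of `P f` is an
isomorphism. -/
def PCart {D : Type u} [Category.{v} D] (P : C ⥤ D) {A X : C} (f : A ⟶ X) : Prop :=
  ∃ (Z : C) (v : Z ⟶ X) (ε : P.obj Z ⟶ P.obj A),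
    ε ≫ P.map f = P.map v ∧
    (∀ {A' : C} (f' : A' ⟶ X) (u : P.obj A' ⟶ P.obj A),
        u ≫ P.map f = P.map f' →
        ∃! t : A' ⟶ Z, t ≫ v = f' ∧ P.map t ≫ ε = u) ∧
    ∀ η : A ⟶ Z, η ≫ v = f → P.map η ≫ ε = 𝟙 (P.obj A) → IsIso η

/-- `(Z, v, ε)` is a universal lift of `g : Y ⟶ P X`, i.e. the value at `g` of a right adjoint of
`C/X ⥤ D/PX`. -/
def IsLift {D : Type u} [Category.{v} D] (P : C ⥤ D) {X : C} {Y : D} (g : Y ⟶ P.obj X)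
    (Z : C) (v : Z ⟶ X) (ε : P.obj Z ⟶ Y) : Prop :=
  ε ≫ g = P.map v ∧
    ∀ {A : C} (f : A ⟶ X) (u : P.obj A ⟶ Y), u ≫ g = P.map f →
      ∃! t : A ⟶ Z, t ≫ v = f ∧ P.map t ≫ ε = u

/-- `f` has the usual universal property of a cartesian morphism. -/
def IsCart {D : Type u} [Category.{v} D] (P : C ⥤ D) {A X : C} (f : A ⟶ X) : Prop :=
  ∀ {B : C} (h : B ⟶ X) (u : P.obj B ⟶ P.obj A), u ≫ P.map f = P.map h →
    ∃! t : B ⟶ A, t ≫ f = h ∧ P.map t = u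

namespace UniqueLift

lemma of_isPullback {A B X Y X' Y' : C} {e : A ⟶ B} {m : X ⟶ Y} {m' : X' ⟶ Y'}
    {p : X' ⟶ X} {q : Y' ⟶ Y} (sq : IsPullback m' p q m) (h : UniqueLift e m) :
    UniqueLift e m' := by
  intro a b w
  obtain ⟨d, ⟨hd₁, hd₂⟩, hd₃⟩ := h (a ≫ p) (b ≫ q) (by
    rw [Category.assoc, ← sq.w, reassoc_of% w])
  refine ⟨sq.lift b d hd₂.symm, ⟨sq.hom_ext ?_ ?_, ?_⟩, ?_⟩
  · simp [w]
  · simp [hd₁]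
  · simp
  · rintro d' ⟨h₁, h₂⟩
    refine sq.hom_ext (by simp [h₂]) ?_
    rw [sq.lift_snd]
    exact hd₃ _ ⟨by rw [reassoc_of% h₁], by rw [Category.assoc, ← sq.w, reassoc_of% h₂]⟩

lemma of_comp_right {A B X Y Z : C} {e : A ⟶ B} {g : X ⟶ Y} {k : Y ⟶ Z}
    (hk : UniqueLift e k) (hgk : UniqueLift e (g ≫ k)) : UniqueLift e g := by
  intro a b w
  obtain ⟨d, ⟨hd₁, hd₂⟩, hd₃⟩ := hgk a (b ≫ k) (by rw [reassoc_of% w])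
  refine ⟨d, ⟨hd₁, ?_⟩, ?_⟩
  · refine (hk (a ≫ g) (b ≫ k) (by rw [Category.assoc, reassoc_of% w])).unique
      ⟨by rw [reassoc_of% hd₁], by rw [Category.assoc, hd₂]⟩ ⟨w.symm, rfl⟩
  · rintro d' ⟨h₁, h₂⟩
    exact hd₃ _ ⟨h₁, by rw [reassoc_of% h₂]⟩

lemma comp_left {A B B' X Y : C} {e : A ⟶ B} {e' : B ⟶ B'} {m : X ⟶ Y}
    (he : UniqueLift e m) (he' : UniqueLift e' m) : UniqueLift (e ≫ e') m := by
  intro a b w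
  obtain ⟨d, ⟨hd₁, hd₂⟩, hd₃⟩ := he a (e' ≫ b) (by simpa using w)
  obtain ⟨c, ⟨hc₁, hc₂⟩, hc₃⟩ := he' d b hd₂
  refine ⟨c, ⟨by simp [hc₁, hd₁], hc₂⟩, ?_⟩
  rintro c' ⟨h₁, h₂⟩
  exact hc₃ _ ⟨hd₃ _ ⟨by simpa using h₁, by simp [h₂]⟩, h₂⟩

lemma of_isIso_left {A B X Y : C} (e : A ⟶ B) [IsIso e] (m : X ⟶ Y) : UniqueLift e m := by
  intro a b w
  refine ⟨inv e ≫ a, ⟨by simp, by simp [w]⟩, ?_⟩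
  rintro d ⟨h, -⟩
  simp [← h]

lemma of_isIso_right {A B X Y : C} (e : A ⟶ B) (m : X ⟶ Y) [IsIso m] : UniqueLift e m := by
  intro a b w
  refine ⟨b ≫ inv m, ⟨by simp [← reassoc_of% w], by simp⟩, ?_⟩
  rintro d ⟨-, h⟩
  simp [← h]

lemma existsUnique_of_terminal [HasTerminal C] {A B Y : C} {e : A ⟶ B}
    (h : UniqueLift e (terminal.from Y)) (a : A ⟶ Y) : ∃! d : B ⟶ Y, e ≫ d = a := by
  obtain ⟨d, ⟨hd, -⟩, hd'⟩ := h a (terminal.from B) (Subsingleton.elim _ _)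
  exact ⟨d, hd, fun d' h' ↦ hd' _ ⟨h', Subsingleton.elim _ _⟩⟩

end UniqueLift

section

variable {D : Type u} [Category.{v} D] {P : C ⥤ D}

lemma IsCart.hom_ext {A X B : C} {f : A ⟶ X} (hf : IsCart P f) {s t : B ⟶ A}
    (h : s ≫ f = t ≫ f) (hP : P.map s = P.map t) : s = t :=
  (hf (t ≫ f) (P.map t) (P.map_comp _ _).symm).unique ⟨h, hP⟩ ⟨rfl, rfl⟩

lemma IsCart.uniqueLift {A B X Y : C} {m : X ⟶ Y} (hm : IsCart P m) (e : A ⟶ B)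
    [IsIso (P.map e)] : UniqueLift e m := by
  intro a b w
  obtain ⟨d, ⟨hd₁, hd₂⟩, hd₃⟩ := hm b (inv (P.map e) ≫ P.map a) (by
    rw [Category.assoc, ← P.map_comp, w, P.map_comp, IsIso.inv_hom_id_assoc])
  refine ⟨d, ⟨hm.hom_ext (by simp [hd₁, w]) (by simp [hd₂]), hd₁⟩, ?_⟩
  rintro d' ⟨h₁, h₂⟩
  exact hd₃ _ ⟨h₂, by simp [← h₁]⟩

lemma IsCart.isLift {A X : C} {f : A ⟶ X} (hf : IsCart P f) :
    IsLift P (P.map f) A f (𝟙 _) :=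
  ⟨by simp, fun h u w ↦ by simpa using hf h u w⟩

lemma IsLift.isCart {X Z : C} {Y : D} {g : Y ⟶ P.obj X} {v : Z ⟶ X} {ε : P.obj Z ⟶ Y}
    (h : IsLift P g Z v ε) [IsIso ε] : IsCart P v := by
  intro B k u w
  obtain ⟨t, ⟨ht₁, ht₂⟩, ht₃⟩ := h.2 k (u ≫ ε) (by rw [Category.assoc, h.1, w])
  exact ⟨t, ⟨ht₁, (cancel_mono ε).1 ht₂⟩, fun t' ⟨h₁, h₂⟩ ↦ ht₃ _ ⟨h₁, by rw [h₂]⟩⟩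

/-- If `f = e ≫ m` with `m` cartesian and `P e` invertible, then any universal lift of `P f` is
isomorphic to `m`, compatibly with the units. -/
lemma IsLift.exists_iso {A W X Z : C} {f : A ⟶ X} {e : A ⟶ W} {m : W ⟶ X} (hf : e ≫ m = f)
    [IsIso (P.map e)] (hm : IsCart P m) {v : Z ⟶ X} {ε : P.obj Z ⟶ P.obj A}
    (h : IsLift P (P.map f) Z v ε) {η : A ⟶ Z} (hη : η ≫ v = f)
    (hη' : P.map η ≫ ε = 𝟙 _) : ∃ j : W ≅ Z, e ≫ j.hom = η := by
  obtain ⟨j, ⟨hj₁, hj₂⟩, -⟩ := h.2 m (inv (P.map e)) (by simp [← hf])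
  obtain ⟨k, ⟨hk₁, hk₂⟩, -⟩ := hm v (ε ≫ P.map e) (by simp [← h.1, ← hf])
  refine ⟨⟨j, k, ?_, ?_⟩, ?_⟩
  · exact hm.hom_ext (by simp [hj₁, hk₁]) (by simp [hk₂, reassoc_of% hj₂])
  · exact (h.2 v ε h.1).unique ⟨by simp [hj₁, hk₁], by simp [hj₂, hk₂]⟩ ⟨by simp, by simp⟩
  · exact (h.2 f (𝟙 _) (by simp)).unique ⟨by simp [hj₁, hf], by simp [hj₂]⟩ ⟨hη, hη'⟩

lemma IsLift.exists_unit {A X Z : C} {f : A ⟶ X} {v : Z ⟶ X} {ε : P.obj Z ⟶ P.obj A}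
    (h : IsLift P (P.map f) Z v ε) : ∃ η : A ⟶ Z, η ≫ v = f ∧ P.map η ≫ ε = 𝟙 _ :=
  (h.2 f (𝟙 _) (by simp)).exists

lemma pcart_iff_isCart {A X : C} {f : A ⟶ X} : PCart P f ↔ IsCart P f := by
  constructor
  · rintro ⟨Z, v, ε, h₁, h₂, h₃⟩
    have h : IsLift P (P.map f) Z v ε := ⟨h₁, h₂⟩
    obtain ⟨η, hη, hη'⟩ := h.exists_unit
    have := h₃ η hη hη'
    have : IsIso ε := by
      rw [← IsIso.eq_inv_comp, Category.comp_id] at hη'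
      rw [hη']; infer_instance
    intro B k u w
    obtain ⟨t, ⟨ht₁, ht₂⟩, -⟩ := h.isCart k (u ≫ P.map η) (by
      rw [Category.assoc, ← P.map_comp, hη, w])
    refine ⟨t ≫ inv η, ⟨by simp [← hη, ht₁], by simp [ht₂]⟩, ?_⟩
    rintro t' ⟨ht₁', ht₂'⟩
    rw [IsIso.eq_comp_inv]
    exact IsCart.hom_ext h.isCart (by simp [hη, ht₁, ht₁']) (by simp [ht₂, ht₂'])
  · intro h
    refine ⟨A, f, 𝟙 _, h.isLift.1, h.isLift.2, fun η h₁ h₂ ↦ ?_⟩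
    have : η = 𝟙 A := h.hom_ext (by simpa using h₁) (by simpa using h₂)
    rw [this]; infer_instance

lemma IsPrefibration.exists_factorization (hP : IsPrefibration P) {A X : C} (f : A ⟶ X) :
    ∃ (Z : C) (e : A ⟶ Z) (m : Z ⟶ X), IsIso (P.map e) ∧ IsCart P m ∧ e ≫ m = f := by
  obtain ⟨Z, v, ε, h₁, h₂⟩ := hP.1 (P.map f)
  have h : IsLift P (P.map f) Z v ε := ⟨h₁, h₂⟩
  obtain ⟨η, hη, hη'⟩ := h.exists_unit
  have hi : IsIso (P.map η) := hP.2 f Z v ε h₁ h₂ η hη hη'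
  have : IsIso ε := by
    rw [← IsIso.eq_inv_comp, Category.comp_id] at hη'
    rw [hη']; infer_instance
  exact ⟨Z, η, v, hi, h.isCart, hη⟩

lemma IsPrefibration.isFS (hP : IsPrefibration P) {E M : MorphismProperty C}
    (hE : ∀ {X Y : C} (f : X ⟶ Y), E f ↔ IsIso (P.map f))
    (hM : ∀ {X Y : C} (f : X ⟶ Y), M f ↔ IsCart P f) : IsFS E M where
  factor f := by
    simpa only [hE, hM] using hP.exists_factorization f
  left_iff {X Y} f := by
    rw [hE]
    refine ⟨fun _ _ _ m hm ↦ IsCart.uniqueLift ((hM m).1 hm) f, fun h ↦ ?_⟩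
    obtain ⟨Z, e, m, he, hm, rfl⟩ := hP.exists_factorization f
    obtain ⟨d, ⟨hd₁, hd₂⟩, -⟩ := h m ((hM m).2 hm) e (𝟙 _) (by simp)
    have : m ≫ d = 𝟙 Z := (hm.uniqueLift e e m rfl).unique
      ⟨by simpa using hd₁, by simp [hd₂]⟩ ⟨by simp, by simp⟩
    have : IsIso m := ⟨d, this, hd₂⟩
    rw [P.map_comp]; infer_instance
  right_iff {X Y} g := by
    rw [hM]
    refine ⟨fun hg _ _ e he ↦ ?_, fun h ↦ ?_⟩
    · have := (hE e).1 he
      exact hg.uniqueLift e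
    · obtain ⟨Z, e, m, he, hm, rfl⟩ := hP.exists_factorization g
      obtain ⟨d, ⟨hd₁, hd₂⟩, -⟩ := h e ((hE e).2 he) (𝟙 _) m (by simp)
      have : d ≫ e = 𝟙 Z := (hm.uniqueLift e e m rfl).unique
        ⟨by simp [reassoc_of% hd₁], by simp [hd₂]⟩ ⟨by simp, by simp⟩
      have : IsIso e := ⟨d, hd₁, this⟩
      intro B k u w
      obtain ⟨t, ⟨ht₁, ht₂⟩, -⟩ := hm k (u ≫ P.map e) (by simpa using w)
      refine ⟨t ≫ inv e, ⟨by simp [ht₁], by simp [ht₂]⟩, ?_⟩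
      rintro t' ⟨ht₁', ht₂'⟩
      rw [IsIso.eq_comp_inv]
      exact hm.hom_ext (by simp [ht₁, ht₁']) (by simp [ht₂, ht₂'])

/-- A cartesian morphism is a pullback of any morphism between objects cartesian over the terminal
object to which it is compared by morphisms inverted by `P`. -/
lemma IsCart.isPullback [HasTerminal C] {X Y X' Y' : C}
    {f : X ⟶ Y} (hf : IsCart P f) {r : X ⟶ X'} {s : Y ⟶ Y'} {g : X' ⟶ Y'}
    [IsIso (P.map r)] [IsIso (P.map s)] (hX' : IsCart P (terminal.from X'))
    (w : r ≫ g = f ≫ s) : IsPullback f r s g := by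
  have lift : ∀ {T : C} (a : T ⟶ Y) (b : T ⟶ X'), a ≫ s = b ≫ g →
      ∃ t : T ⟶ X, t ≫ f = a ∧ t ≫ r = b := by
    intro T a b hab
    obtain ⟨t, ⟨ht₁, ht₂⟩, -⟩ := hf a (P.map b ≫ inv (P.map r)) (by
      rw [← cancel_mono (P.map s)]
      simp only [Category.assoc, ← P.map_comp, hab, ← w]
      simp)
    exact ⟨t, ht₁, hX'.hom_ext (Subsingleton.elim _ _) (by simp [ht₂])⟩
  refine ⟨⟨w.symm⟩, ⟨PullbackCone.IsLimit.mk _ (fun c ↦ (lift c.fst c.snd c.condition).choose)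
    (fun c ↦ (lift c.fst c.snd c.condition).choose_spec.1)
    (fun c ↦ (lift c.fst c.snd c.condition).choose_spec.2) fun c t h₁ h₂ ↦ ?_⟩⟩
  obtain ⟨h₁', h₂'⟩ := (lift c.fst c.snd c.condition).choose_spec
  refine hf.hom_ext (h₁.trans h₁'.symm) ?_
  rw [← cancel_mono (P.map r), ← P.map_comp, ← P.map_comp, h₂, h₂']

lemma IsPrefibration.isSimpleReflectiveFS [HasTerminal C] (hP : IsPrefibration P)
    {E M : MorphismProperty C}
    (hE : ∀ {X Y : C} (f : X ⟶ Y), E f ↔ IsIso (P.map f))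
    (hM : ∀ {X Y : C} (f : X ⟶ Y), M f ↔ IsCart P f) : IsSimpleReflectiveFS E M := by
  have hFS := hP.isFS hE hM
  refine ⟨hFS, ?_, ?_⟩
  · intro X Y Z f g hfg hg
    rw [hE] at *
    rw [P.map_comp] at hfg
    exact IsIso.of_isIso_comp_right _ (P.map g)
  · choose R ρ m hρ hm _ using fun X : C ↦ hFS.factor (terminal.from X)
    have hR (X : C) : M (terminal.from (R X)) := by
      rw [← Subsingleton.elim (m X) (terminal.from (R X))]; exact hm X
    have huniv (X : C) {Y : C} (hY : M (terminal.from Y)) (f : X ⟶ Y) :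
        ∃! g : R X ⟶ Y, ρ X ≫ g = f :=
      ((hFS.left_iff _).1 (hρ X) _ hY).existsUnique_of_terminal f
    choose Rmap hRmap _ using fun (X Y : C) (f : X ⟶ Y) ↦ huniv X (hR Y) (f ≫ ρ Y)
    refine ⟨R, ρ, Rmap, hR, hρ, huniv, fun f ↦ hRmap _ _ f,
      fun {X Y} f ↦ ⟨fun hf ↦ ?_, fun sq ↦ ?_⟩⟩
    · have := (hE _).1 (hρ X)
      have := (hE _).1 (hρ Y)
      exact IsCart.isPullback ((hM f).1 hf) ((hM _).1 (hR X)) (hRmap X Y f)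
    · refine (hFS.right_iff f).2 fun e he ↦ .of_isPullback sq (.of_comp_right (k := terminal.from _)
        ((hFS.right_iff _).1 (hR Y) e he) ?_)
      rw [Subsingleton.elim (Rmap X Y f ≫ terminal.from _) (terminal.from _)]
      exact (hFS.right_iff _).1 (hR X) e he

end

/-- The objects `Y` such that `Y ⟶ ⊤_ C` is in `M`. -/
def fibrantObjects [HasTerminal C] (M : MorphismProperty C) : ObjectProperty C :=
  fun Y ↦ M (terminal.from Y)

namespace IsFS

variable {E M : MorphismProperty C}

lemma existsUnique_desc [HasTerminal C] (hFS : IsFS E M) {A B T : C} {e : A ⟶ B} (he : E e)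
    (hT : fibrantObjects M T) (a : A ⟶ T) : ∃! d : B ⟶ T, e ≫ d = a :=
  ((hFS.left_iff e).1 he _ hT).existsUnique_of_terminal a

lemma comp_mem (hFS : IsFS E M) {X Y Z : C} {f : X ⟶ Y} {g : Y ⟶ Z} (hf : E f) (hg : E g) :
    E (f ≫ g) :=
  (hFS.left_iff _).2 fun m hm ↦
    ((hFS.left_iff f).1 hf m hm).comp_left ((hFS.left_iff g).1 hg m hm)

lemma left_of_isIso (hFS : IsFS E M) {X Y : C} (f : X ⟶ Y) [IsIso f] : E f :=
  (hFS.left_iff f).2 fun m _ ↦ .of_isIso_left f m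

lemma fibrantObjects_terminal [HasTerminal C] (hFS : IsFS E M) : fibrantObjects M (⊤_ C) := by
  refine (hFS.right_iff _).2 fun e _ ↦ ?_
  rw [Subsingleton.elim (terminal.from (⊤_ C)) (𝟙 _)]
  exact .of_isIso_right e _

section

variable [HasTerminal C] {P : C ⥤ (fibrantObjects M).FullSubcategory}
  {ρ : ∀ X : C, X ⟶ (P.obj X).obj}

lemma reflector_hom_ext (hFS : IsFS E M) (hρ : ∀ X, E (ρ X)) {X : C}
    {Y : (fibrantObjects M).FullSubcategory} {g k : P.obj X ⟶ Y}
    (h : ρ X ≫ g.hom = ρ X ≫ k.hom) : g = k := by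
  ext
  exact (hFS.existsUnique_desc (hρ X) Y.property (ρ X ≫ k.hom)).unique h rfl

lemma mem_iff_isIso_reflector_map (hFS : IsFS E M)
    (hcancel : ∀ {X Y Z : C} (f : X ⟶ Y) (g : Y ⟶ Z), E (f ≫ g) → E g → E f)
    (hρ : ∀ X, E (ρ X)) (nat : ∀ {X Y : C} (f : X ⟶ Y), ρ X ≫ (P.map f).hom = f ≫ ρ Y)
    {X Y : C} (f : X ⟶ Y) : E f ↔ IsIso (P.map f) := by
  constructor
  · intro hf
    obtain ⟨d, hd, -⟩ :=
      hFS.existsUnique_desc (hFS.comp_mem hf (hρ Y)) (P.obj X).property (ρ X)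
    refine ⟨ObjectProperty.homMk d, hFS.reflector_hom_ext hρ ?_, ?_⟩
    · simpa [reassoc_of% (nat f)] using hd
    · ext
      refine (hFS.existsUnique_desc (hFS.comp_mem hf (hρ Y)) (P.obj Y).property
        (f ≫ ρ Y)).unique ?_ (Category.comp_id _)
      simp only [ObjectProperty.FullSubcategory.comp_hom, ObjectProperty.homMk_hom]
      rw [← Category.assoc, hd, nat]
  · intro hf
    have : IsIso (P.map f).hom := inferInstanceAs (IsIso ((fibrantObjects M).ι.map (P.map f)))
    refine hcancel f (ρ Y) ?_ (hρ Y)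
    rw [← nat]
    exact hFS.comp_mem (hρ X) (hFS.left_of_isIso _)

lemma isCart_of_isPullback (hFS : IsFS E M) (hρ : ∀ X, E (ρ X))
    (nat : ∀ {X Y : C} (f : X ⟶ Y), ρ X ≫ (P.map f).hom = f ≫ ρ Y) {X Y : C} {f : X ⟶ Y}
    (sq : IsPullback f (ρ X) (ρ Y) (P.map f).hom) : IsCart P f := by
  intro B k u w
  have hw : k ≫ ρ Y = (ρ B ≫ u.hom) ≫ (P.map f).hom := by
    rw [← nat, ← w]; simp
  refine ⟨sq.lift k (ρ B ≫ u.hom) hw, ⟨by simp, hFS.reflector_hom_ext hρ (by simp [nat])⟩, ?_⟩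
  rintro t ⟨rfl, rfl⟩
  exact sq.hom_ext (by simp) (by simp [nat])

lemma isPrefibration_reflector [HasPullbacks C] (hFS : IsFS E M)
    (hρ : ∀ X, E (ρ X)) (nat : ∀ {X Y : C} (f : X ⟶ Y), ρ X ≫ (P.map f).hom = f ≫ ρ Y)
    (hE : ∀ {X Y : C} (f : X ⟶ Y), E f → IsIso (P.map f))
    (hM : ∀ {X Y : C} (f : X ⟶ Y), M f → IsCart P f) : IsPrefibration P := by
  constructor
  · intro X Y g
    obtain ⟨ε, hε, -⟩ := hFS.existsUnique_desc (hρ _) Y.property (pullback.snd (ρ X) g.hom)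
    have sq := IsPullback.of_hasPullback (ρ X) g.hom
    refine ⟨pullback (ρ X) g.hom, pullback.fst _ _, ObjectProperty.homMk ε,
      hFS.reflector_hom_ext hρ ?_, ?_⟩
    · simp [nat, reassoc_of% hε, pullback.condition]
    · intro A f u w
      have hw : f ≫ ρ X = (ρ A ≫ u.hom) ≫ g.hom := by
        rw [← nat, ← w]; simp
      refine ⟨sq.lift f (ρ A ≫ u.hom) hw, ⟨by simp, hFS.reflector_hom_ext hρ ?_⟩, ?_⟩
      · simp [reassoc_of% nat, hε]
      · rintro t ⟨rfl, rfl⟩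
        exact sq.hom_ext (by simp) (by simp [reassoc_of% nat, hε])
  · intro A X f Z v ε h₁ h₂ η hη hη'
    obtain ⟨W, e, m, he, hm, hf⟩ := hFS.factor f
    have := hE e he
    obtain ⟨j, rfl⟩ := IsLift.exists_iso hf (hM m hm) ⟨h₁, h₂⟩ hη hη'
    rw [P.map_comp]
    infer_instance

lemma nonempty_isTerminal_reflector (hFS : IsFS E M) (hρ : ∀ X, E (ρ X)) :
    Nonempty (IsTerminal (P.obj (⊤_ C))) := by
  obtain ⟨d, hd, -⟩ := hFS.existsUnique_desc (hρ (⊤_ C)) hFS.fibrantObjects_terminal (𝟙 _)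
  have hd' : d ≫ ρ (⊤_ C) = 𝟙 _ :=
    (hFS.existsUnique_desc (hρ (⊤_ C)) (P.obj _).property (ρ _)).unique
      (by rw [reassoc_of% hd]) (Category.comp_id _)
  refine ⟨IsTerminal.ofUniqueHom
    (fun Y ↦ ObjectProperty.homMk (terminal.from Y.obj ≫ ρ (⊤_ C))) fun Y k ↦ ?_⟩
  ext
  rw [ObjectProperty.homMk_hom, ← Category.comp_id k.hom, ← hd', ← Category.assoc,
    Subsingleton.elim (k.hom ≫ d) (terminal.from _)]

end

end IsFS

lemma IsSimpleReflectiveFS.exists_prefibration [HasFiniteLimits C] {E M : MorphismProperty C}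
    (h : IsSimpleReflectiveFS E M) :
    ∃ (D : Cat.{v, u}) (P : C ⥤ D),
      IsPrefibration P ∧
      Nonempty (IsTerminal (P.obj (⊤_ C))) ∧
      (∀ {X Y : C} (f : X ⟶ Y), E f ↔ IsIso (P.map f)) ∧
      (∀ {X Y : C} (f : X ⟶ Y), M f ↔ PCart P f) := by
  obtain ⟨hFS, hcancel, R, ρ, Rmap, hR, hρ, huniv, hRmap, hpb⟩ := h
  have hext (X : C) {Y : C} (hY : M (terminal.from Y)) {g k : R X ⟶ Y}
      (hgk : ρ X ≫ g = ρ X ≫ k) : g = k := (huniv X hY (ρ X ≫ k)).unique hgk rfl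
  let P : C ⥤ (fibrantObjects M).FullSubcategory :=
    { obj X := ⟨R X, hR X⟩
      map {X Y} f := ObjectProperty.homMk (Rmap X Y f)
      map_id X := by
        ext
        exact hext X (hR X) (by simp [hRmap])
      map_comp {X Y Z} f g := by
        ext
        exact hext X (hR Z) (by simp [hRmap, reassoc_of% (hRmap f)]) }
  have hE {X Y : C} (f : X ⟶ Y) : E f ↔ IsIso (P.map f) :=
    hFS.mem_iff_isIso_reflector_map hcancel hρ hRmap f
  have hM {X Y : C} (f : X ⟶ Y) (hf : M f) : IsCart P f :=
    hFS.isCart_of_isPullback hρ hRmap ((hpb f).1 hf)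
  refine ⟨Cat.of (fibrantObjects M).FullSubcategory, P,
    hFS.isPrefibration_reflector hρ hRmap (fun f ↦ (hE f).1) hM,
    hFS.nonempty_isTerminal_reflector hρ, hE,
    fun f ↦ ⟨fun hf ↦ pcart_iff_isCart.2 (hM f hf), fun hf ↦ (hFS.right_iff f).2 fun e he ↦ ?_⟩⟩
  have : IsIso (P.map e) := (hE e).1 he
  exact IsCart.uniqueLift (P := P) (pcart_iff_isCart.1 hf) e

theorem statement11 [HasFiniteLimits C] (E M : MorphismProperty C) :
    IsSimpleReflectiveFS E M ↔
      ∃ (D : Cat.{v, u}) (P : C ⥤ D),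
        IsPrefibration P ∧
        Nonempty (IsTerminal (P.obj (⊤_ C))) ∧
        (∀ {X Y : C} (f : X ⟶ Y), E f ↔ IsIso (P.map f)) ∧
        (∀ {X Y : C} (f : X ⟶ Y), M f ↔ PCart P f) := by
  refine ⟨fun h ↦ h.exists_prefibration, ?_⟩
  rintro ⟨D, P, hP, -, hE, hM⟩
  exact hP.isSimpleReflectiveFS hE fun f ↦ (hM f).trans pcart_iff_isCart

end Stmt11
end

section
/- Let C be a pointed category (with zero object 0) and (E, M) a reflective factorization system of C; let S denote the coreflector of the M-coreflective subcategory T(E), with coreflections σ_B : SB → B obtained by (E, M)-factoring 0 → B. Then M = S⁻¹(Iso C) if, and only if, M satisfies the cancellation property: if gf ∈ M and f ∈ M, then g ∈ M. In this case F(M) = {B | SB ≅ 0} = {B | every morphism A → B with A ∈ T(E) is zero}. -/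
/-!
Statement 13 (Corollary 4.3): For a reflective factorization system (E, M) of a
pointed category C, with coreflector S of the M-coreflective subcategory T(E) and
coreflections σ_B : SB ⟶ B, one has M = S⁻¹(Iso C) iff M satisfies:
gf ∈ M and f ∈ M imply g ∈ M. In that case,
F(M) = {B | SB ≅ 0} = {B | every morphism A ⟶ B with A ∈ T(E) is zero}.
-/

open CategoryTheory CategoryTheory.Limits

open scoped ZeroObject

universe v u

namespace Stmt13

variable {C : Type u} [Category.{v} C]

def UniqueLift {A B X Y : C} (e : A ⟶ B) (m : X ⟶ Y) : Prop :=
  ∀ (u : A ⟶ X) (v : B ⟶ Y), u ≫ m = e ≫ v →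
    ∃! d : B ⟶ X, e ≫ d = u ∧ d ≫ m = v

structure IsFS (E M : MorphismProperty C) : Prop where
  factor : ∀ {X Y : C} (f : X ⟶ Y),
    ∃ (Z : C) (e : X ⟶ Z) (m : Z ⟶ Y), E e ∧ M m ∧ e ≫ m = f
  left_iff : ∀ {X Y : C} (f : X ⟶ Y),
    E f ↔ ∀ {A B : C} (m : A ⟶ B), M m → UniqueLift f m
  right_iff : ∀ {X Y : C} (g : X ⟶ Y),
    M g ↔ ∀ {A B : C} (e : A ⟶ B), E e → UniqueLift e g

namespace IsFS

variable {E M : MorphismProperty C}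

/-- A morphism in both classes of a factorization system is an isomorphism. -/
theorem isIso_of_left_right (h : IsFS E M) {X Y : C} {f : X ⟶ Y} (he : E f) (hm : M f) :
    IsIso f := by
  obtain ⟨d, ⟨h₁, h₂⟩, -⟩ := (h.left_iff f).1 he f hm (𝟙 X) (𝟙 Y) (by simp)
  exact ⟨d, h₁, h₂⟩

theorem right_of_isIso (h : IsFS E M) {X Y : C} (f : X ⟶ Y) [IsIso f] : M f := by
  refine (h.right_iff f).2 fun e _ a b w => ⟨b ≫ inv f, ⟨?_, by simp⟩, ?_⟩
  · rw [← Category.assoc, ← w]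
    simp
  · rintro d ⟨-, rfl⟩
    simp

theorem right_comp (h : IsFS E M) {X Y Z : C} {f : X ⟶ Y} {g : Y ⟶ Z} (hf : M f) (hg : M g) :
    M (f ≫ g) := by
  refine (h.right_iff _).2 fun e he a b w => ?_
  obtain ⟨d, ⟨h₁, h₂⟩, hd⟩ := (h.right_iff g).1 hg e he (a ≫ f) b (by simpa using w)
  obtain ⟨d', ⟨h₃, h₄⟩, hd'⟩ := (h.right_iff f).1 hf e he a d h₁.symm
  refine ⟨d', ⟨h₃, by rw [← Category.assoc, h₄, h₂]⟩, ?_⟩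
  rintro k ⟨rfl, hk⟩
  exact hd' k ⟨rfl, hd _ ⟨by simp, by simpa using hk⟩⟩

/-- Two fillers of the same square against an orthogonal pair agree. -/
theorem eq_of_fillers (h : IsFS E M) {A B X Y : C} {e : A ⟶ B} {m : X ⟶ Y} (he : E e) (hm : M m)
    {d d' : B ⟶ X} (h₁ : e ≫ d = e ≫ d') (h₂ : d ≫ m = d' ≫ m) : d = d' :=
  ((h.left_iff e).1 he m hm (e ≫ d) (d ≫ m) (by simp)).unique ⟨rfl, rfl⟩ ⟨h₁.symm, h₂.symm⟩

theorem right_of_comp_right (h : IsFS E M) {X Y Z : C} {f : X ⟶ Y} {g : Y ⟶ Z}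
    (hfg : M (f ≫ g)) (hg : M g) : M f := by
  refine (h.right_iff f).2 fun e he a b w => ?_
  obtain ⟨d, ⟨h₁, h₂⟩, -⟩ := (h.right_iff _).1 hfg e he a (b ≫ g)
    (by rw [← Category.assoc, w, Category.assoc])
  refine ⟨d, ⟨h₁, h.eq_of_fillers he hg ?_ (by simpa using h₂)⟩, ?_⟩
  · rw [← Category.assoc, h₁, w]
  · rintro k ⟨hk₁, hk₂⟩
    exact h.eq_of_fillers he hfg (hk₁.trans h₁.symm) (by rw [h₂, ← hk₂, Category.assoc])

theorem left_of_comp_left (h : IsFS E M) {X Y Z : C} {f : X ⟶ Y} {g : Y ⟶ Z}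
    (hfg : E (f ≫ g)) (hf : E f) : E g := by
  refine (h.left_iff g).2 fun m hm a b w => ?_
  obtain ⟨d, ⟨h₁, h₂⟩, -⟩ := (h.left_iff _).1 hfg m hm (f ≫ a) b
    (by rw [Category.assoc, w, Category.assoc])
  refine ⟨d, ⟨h.eq_of_fillers hf hm (by simpa using h₁) ?_, h₂⟩, ?_⟩
  · rw [Category.assoc, h₂, w]
  · rintro k ⟨hk₁, hk₂⟩
    exact h.eq_of_fillers hfg hm (by rw [h₁, ← hk₁, Category.assoc]) (hk₂.trans h₂.symm)

/-- Every morphism between objects of `T(E)` lies in `E`. -/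
theorem left_of_zero_left [HasZeroObject C] [HasZeroMorphisms C] (h : IsFS E M) {A B : C}
    (hA : E (0 : (0 : C) ⟶ A)) (hB : E (0 : (0 : C) ⟶ B)) (f : A ⟶ B) : E f :=
  h.left_of_comp_left (f := (0 : (0 : C) ⟶ A)) (by simpa using hB) hA

/-- Morphisms out of an object of `T(E)` are determined by their composite with a morphism
in `M`. -/
theorem eq_of_comp_right [HasZeroObject C] [HasZeroMorphisms C] (h : IsFS E M) {A X Y : C}
    (hA : E (0 : (0 : C) ⟶ A)) {m : X ⟶ Y} (hm : M m) {d d' : A ⟶ X} (w : d ≫ m = d' ≫ m) :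
    d = d' :=
  h.eq_of_fillers hA hm (by simp) w

end IsFS

theorem statement13 [HasZeroObject C] [HasZeroMorphisms C]
    (E M : MorphismProperty C) (hfs : IsFS E M)
    -- (E, M) is reflective
    (hrefl : ∀ {X Y Z : C} (f : X ⟶ Y) (g : Y ⟶ Z), E (f ≫ g) → E g → E f)
    -- S, σ : the coreflector of T(E), obtained by (E, M)-factoring 0 ⟶ X
    (S : C → C) (σ : ∀ X : C, S X ⟶ X)
    (Smap : ∀ (X Y : C), (X ⟶ Y) → (S X ⟶ S Y))
    (hTS : ∀ X : C, E (0 : (0 : C) ⟶ S X))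
    (hMσ : ∀ X : C, M (σ X))
    (hnat : ∀ {X Y : C} (f : X ⟶ Y), Smap X Y f ≫ σ Y = σ X ≫ f) :
    -- M = S⁻¹(Iso C) iff M satisfies the cancellation property (4ᵒᵖ)
    ((∀ {X Y : C} (f : X ⟶ Y), M f ↔ IsIso (Smap X Y f)) ↔
      (∀ {X Y Z : C} (f : X ⟶ Y) (g : Y ⟶ Z), M (f ≫ g) → M f → M g)) ∧
    -- in this case, F(M) = {B | SB ≅ 0} = {B | C(A, B) = {0} for all A ∈ T(E)}
    ((∀ {X Y Z : C} (f : X ⟶ Y) (g : Y ⟶ Z), M (f ≫ g) → M f → M g) →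
      ∀ B : C,
        (M (0 : B ⟶ (0 : C)) ↔ IsZero (S B)) ∧
        (M (0 : B ⟶ (0 : C)) ↔
          ∀ A : C, E (0 : (0 : C) ⟶ A) → ∀ f : A ⟶ B, f = 0)) := by
  have mapComp {X Y Z : C} (f : X ⟶ Y) (g : Y ⟶ Z) :
      Smap X Z (f ≫ g) = Smap X Y f ≫ Smap Y Z g :=
    hfs.eq_of_comp_right (hTS X) (hMσ Z) (by
      rw [hnat, Category.assoc, hnat, ← Category.assoc, ← Category.assoc, hnat])
  have isIso_iff (hc : ∀ {X Y Z : C} (f : X ⟶ Y) (g : Y ⟶ Z), M (f ≫ g) → M f → M g)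
      {X Y : C} (f : X ⟶ Y) : M f ↔ IsIso (Smap X Y f) := by
    constructor
    · intro hf
      refine hfs.isIso_of_left_right (hfs.left_of_zero_left (hTS X) (hTS Y) _) ?_
      refine hfs.right_of_comp_right (g := σ Y) ?_ (hMσ Y)
      rw [hnat]
      exact hfs.right_comp (hMσ X) hf
    · intro _
      refine hc (σ X) f ?_ (hMσ X)
      rw [← hnat]
      exact hfs.right_comp (hfs.right_of_isIso _) (hMσ Y)
  refine ⟨⟨fun hS X Y Z f g hfg hf => ?_, fun hc => isIso_iff hc⟩, fun hc B => ?_⟩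
  · rw [hS] at hfg hf ⊢
    rw [mapComp] at hfg
    exact IsIso.of_isIso_comp_left (Smap X Y f) (Smap Y Z g)
  have isZero_S_zero : IsZero (S (0 : C)) := by
    rw [IsZero.iff_id_eq_zero]
    exact hfs.eq_of_comp_right (hTS _) (hMσ _) ((isZero_zero C).eq_of_tgt _ _)
  have zero_iff : M (0 : B ⟶ (0 : C)) ↔ IsZero (S B) := by
    rw [isIso_iff hc]
    exact ⟨fun _ => isZero_S_zero.of_iso (asIso (Smap B 0 0)),
      fun hB => ⟨0, hB.eq_of_src _ _, isZero_S_zero.eq_of_src _ _⟩⟩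
  refine ⟨zero_iff, fun hB A hA f => ?_, fun hB => zero_iff.2 ?_⟩
  · exact hfs.eq_of_comp_right hA hB (by simp)
  · rw [IsZero.iff_id_eq_zero]
    exact hfs.eq_of_comp_right (hTS B) (hMσ B) (by simp [hB _ (hTS B) (σ B)])

end Stmt13
end

section
/- Let C be a category with zero object, and let T and F be full subcategories with T = F← := {A | every morphism from A to an object of F is zero} and F = T→ := {B | every morphism from an object of T to B is zero}. Then, for any morphisms k : A → B and p : B → C in C: (1) if k has zero kernel (e.g., if k is a kernel of some morphism, or more generally ker k = 0) and B ∈ F, then A ∈ F; (2) if p has zero cokernel and B ∈ T, then C ∈ T; (3) if k is the kernel of p and A, C ∈ F, then B ∈ F; (4) if p is the cokernel of k and A, C ∈ T, then B ∈ T. -/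
/-!
Statement 14 (Proposition 4.5): In a pointed category C, for full subcategories
T = F← and F = T→: (1) if k : A ⟶ B has zero kernel and B ∈ F then A ∈ F;
(2) if p : B ⟶ C has zero cokernel and B ∈ T then C ∈ T; (3) if k is the kernel
of p and A, C ∈ F then B ∈ F; (4) if p is the cokernel of k and A, C ∈ T then
B ∈ T.
-/

open CategoryTheory CategoryTheory.Limits

open scoped ZeroObject

universe v u

namespace Stmt14

variable {C : Type u} [Category.{v} C]

/-- `f` lies in 0Ker: its kernel exists and is a zero object. -/
def HasZeroKernel [HasZeroMorphisms C] {X Y : C} (f : X ⟶ Y) : Prop :=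
  ∃ (K : C) (ι : K ⟶ X) (w : ι ≫ f = 0),
    Nonempty (IsLimit (KernelFork.ofι ι w)) ∧ IsZero K

/-- `f` lies in 0Coker: its cokernel exists and is a zero object. -/
def HasZeroCokernel [HasZeroMorphisms C] {X Y : C} (f : X ⟶ Y) : Prop :=
  ∃ (Q : C) (π : Y ⟶ Q) (w : f ≫ π = 0),
    Nonempty (IsColimit (CokernelCofork.ofπ π w)) ∧ IsZero Q

theorem HasZeroKernel.eq_zero_of_comp_eq_zero [HasZeroMorphisms C] {X Y W : C} {f : X ⟶ Y}
    (hf : HasZeroKernel f) (g : W ⟶ X) (hg : g ≫ f = 0) : g = 0 := by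
  obtain ⟨K, ι, w, ⟨hι⟩, hK⟩ := hf
  obtain ⟨l, hl⟩ := KernelFork.IsLimit.lift' hι g hg
  rw [← hl, hK.eq_zero_of_tgt l, zero_comp]

theorem HasZeroCokernel.eq_zero_of_comp_eq_zero [HasZeroMorphisms C] {X Y W : C} {f : X ⟶ Y}
    (hf : HasZeroCokernel f) (g : Y ⟶ W) (hg : f ≫ g = 0) : g = 0 := by
  obtain ⟨Q, π, w, ⟨hπ⟩, hQ⟩ := hf
  obtain ⟨l, hl⟩ := CokernelCofork.IsColimit.desc' hπ g hg
  rw [← hl, hQ.eq_zero_of_src l, comp_zero]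

theorem statement14 [HasZeroObject C] [HasZeroMorphisms C]
    (T F : C → Prop)
    (hT : ∀ A : C, T A ↔ ∀ B : C, F B → ∀ f : A ⟶ B, f = 0)
    (hF : ∀ B : C, F B ↔ ∀ A : C, T A → ∀ f : A ⟶ B, f = 0) :
    -- (1) for k ∈ 0Ker, B ∈ F implies A ∈ F
    (∀ {A B : C} (k : A ⟶ B), HasZeroKernel k → F B → F A) ∧
    -- (2) for p ∈ 0Coker, B ∈ T implies C ∈ T
    (∀ {B Z : C} (p : B ⟶ Z), HasZeroCokernel p → T B → T Z) ∧
    -- (3) for k the kernel of p, A, C ∈ F imply B ∈ F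
    (∀ {A B Z : C} (k : A ⟶ B) (p : B ⟶ Z) (w : k ≫ p = 0),
      IsLimit (KernelFork.ofι k w) → F A → F Z → F B) ∧
    -- (4) for p the cokernel of k, A, C ∈ T imply B ∈ T
    (∀ {A B Z : C} (k : A ⟶ B) (p : B ⟶ Z) (w : k ≫ p = 0),
      IsColimit (CokernelCofork.ofπ p w) → T A → T Z → T B) := by
  refine ⟨fun k hk hB => (hF _).2 fun X hX f => ?_, fun p hp hB => (hT _).2 fun Y hY f => ?_,
    fun k p w hk hA hZ => (hF _).2 fun X hX f => ?_,
    fun k p w hp hA hZ => (hT _).2 fun Y hY f => ?_⟩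
  · exact hk.eq_zero_of_comp_eq_zero f ((hF _).1 hB X hX _)
  · exact hp.eq_zero_of_comp_eq_zero f ((hT _).1 hB Y hY _)
  · obtain ⟨l, hl⟩ := KernelFork.IsLimit.lift' hk f ((hF _).1 hZ X hX _)
    rw [← hl, (hF _).1 hA X hX l, zero_comp]
  · obtain ⟨l, hl⟩ := CokernelCofork.IsColimit.desc' hp f ((hT _).1 hA Y hY _)
    rw [← hl, (hT _).1 hZ Y hY l, comp_zero]

end Stmt14
end

section
/- Let (E, M) be a torsion theory in a pointed category C admitting (NormEpi, 0Ker)-factorizations, i.e., every morphism factors as a normal epimorphism followed by a morphism with zero kernel. Then every reflection morphism ρ_C : C → RC of the torsion-free subcategory F(M) is a normal epimorphism. Dually, if C admits (0Coker, NormMono)-factorizations (every morphism factors as a morphism with zero cokernel followed by a normal monomorphism), then every coreflection morphism σ_C : SC → C of the torsion subcategory T(E) is a normal monomorphism. -/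
/-!
Statement 15 (Corollary 4.7): For a torsion theory (E, M) in a pointed category C
with (NormEpi, 0Ker)-factorizations, the reflection morphisms of the torsion-free
subcategory F(M) are normal epimorphisms; dually, with (0Coker, NormMono)-
factorizations, the coreflection morphisms of the torsion subcategory T(E) are
normal monomorphisms. (The (co)reflection morphisms are exactly the E-morphisms
into F(M)-objects, resp. the M-morphisms out of T(E)-objects.)
-/

open CategoryTheory CategoryTheory.Limits

open scoped ZeroObject

universe v u

namespace Stmt15

variable {C : Type u} [Category.{v} C]

def UniqueLift {A B X Y : C} (e : A ⟶ B) (m : X ⟶ Y) : Prop :=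
  ∀ (u : A ⟶ X) (v : B ⟶ Y), u ≫ m = e ≫ v →
    ∃! d : B ⟶ X, e ≫ d = u ∧ d ≫ m = v

structure IsFS (E M : MorphismProperty C) : Prop where
  factor : ∀ {X Y : C} (f : X ⟶ Y),
    ∃ (Z : C) (e : X ⟶ Z) (m : Z ⟶ Y), E e ∧ M m ∧ e ≫ m = f
  left_iff : ∀ {X Y : C} (f : X ⟶ Y),
    E f ↔ ∀ {A B : C} (m : A ⟶ B), M m → UniqueLift f m
  right_iff : ∀ {X Y : C} (g : X ⟶ Y),
    M g ↔ ∀ {A B : C} (e : A ⟶ B), E e → UniqueLift e g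

/-- `f` is a normal epimorphism: it is a cokernel of some morphism. -/
def IsNormalEpi [HasZeroMorphisms C] {X Y : C} (f : X ⟶ Y) : Prop :=
  ∃ (W : C) (g : W ⟶ X) (w : g ≫ f = 0),
    Nonempty (IsColimit (CokernelCofork.ofπ f w))

/-- `f` is a normal monomorphism: it is a kernel of some morphism. -/
def IsNormalMono [HasZeroMorphisms C] {X Y : C} (f : X ⟶ Y) : Prop :=
  ∃ (W : C) (g : Y ⟶ W) (w : f ≫ g = 0),
    Nonempty (IsLimit (KernelFork.ofι f w))

/-- `f` has zero kernel. -/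
def HasZeroKernel [HasZeroMorphisms C] {X Y : C} (f : X ⟶ Y) : Prop :=
  ∃ (K : C) (ι : K ⟶ X) (w : ι ≫ f = 0),
    Nonempty (IsLimit (KernelFork.ofι ι w)) ∧ IsZero K

/-- `f` has zero cokernel. -/
def HasZeroCokernel [HasZeroMorphisms C] {X Y : C} (f : X ⟶ Y) : Prop :=
  ∃ (Q : C) (π : Y ⟶ Q) (w : f ≫ π = 0),
    Nonempty (IsColimit (CokernelCofork.ofπ π w)) ∧ IsZero Q

theorem UniqueLift.hom_ext {A B X Y : C} {e : A ⟶ B} {m : X ⟶ Y} (h : UniqueLift e m)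
    {d d' : B ⟶ X} (he : e ≫ d = e ≫ d') (hm : d ≫ m = d' ≫ m) : d = d' :=
  (h (e ≫ d') (d' ≫ m) (Category.assoc _ _ _)).unique ⟨he, hm⟩ ⟨rfl, rfl⟩

theorem IsFS.uniqueLift {E M : MorphismProperty C} (h : IsFS E M) {A B X Y : C}
    {e : A ⟶ B} {m : X ⟶ Y} (he : E e) (hm : M m) : UniqueLift e m :=
  (h.left_iff e).1 he m hm

section ZeroMorphisms

variable [HasZeroMorphisms C]

theorem HasZeroKernel.eq_zero {W X Y : C} {f : X ⟶ Y} (h : HasZeroKernel f) {g : W ⟶ X}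
    (hg : g ≫ f = 0) : g = 0 := by
  obtain ⟨K, ι, w, ⟨hl⟩, hK⟩ := h
  obtain ⟨l, hl'⟩ := KernelFork.IsLimit.lift' hl g hg
  rw [← hl', hK.eq_of_tgt l 0, zero_comp]

theorem HasZeroCokernel.eq_zero {X Y W : C} {f : X ⟶ Y} (h : HasZeroCokernel f) {g : Y ⟶ W}
    (hg : f ≫ g = 0) : g = 0 := by
  obtain ⟨Q, π, w, ⟨hl⟩, hQ⟩ := h
  obtain ⟨l, hl'⟩ := CokernelCofork.IsColimit.desc' hl g hg
  rw [← hl', hQ.eq_of_src l 0, comp_zero]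

theorem IsNormalEpi.epi {X Y : C} {f : X ⟶ Y} (h : IsNormalEpi f) : Epi f := by
  obtain ⟨W, g, w, ⟨hl⟩⟩ := h
  exact ⟨fun _ _ hab => Cofork.IsColimit.hom_ext hl hab⟩

theorem IsNormalMono.mono {X Y : C} {f : X ⟶ Y} (h : IsNormalMono f) : Mono f := by
  obtain ⟨W, g, w, ⟨hl⟩⟩ := h
  exact ⟨fun _ _ hab => Fork.IsLimit.hom_ext hl hab⟩

theorem IsNormalEpi.comp_iso {X Y Z : C} {f : X ⟶ Y} (h : IsNormalEpi f) (i : Y ≅ Z) :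
    IsNormalEpi (f ≫ i.hom) := by
  obtain ⟨W, g, w, ⟨hl⟩⟩ := h
  exact ⟨W, g, by rw [← Category.assoc, w, zero_comp],
    ⟨IsColimit.ofIsoColimit hl (Cofork.ext i rfl)⟩⟩

theorem IsNormalMono.iso_comp {X Y Z : C} {f : Y ⟶ Z} (h : IsNormalMono f) (i : X ≅ Y) :
    IsNormalMono (i.hom ≫ f) := by
  obtain ⟨W, g, w, ⟨hl⟩⟩ := h
  exact ⟨W, g, by rw [Category.assoc, w, comp_zero],
    ⟨IsLimit.ofIsoLimit hl (Fork.ext i.symm (by simp))⟩⟩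

variable [HasZeroObject C] {E M : MorphismProperty C}

/-- A morphism from a torsion object to a torsion-free object is zero. -/
theorem IsFS.eq_zero (hfs : IsFS E M) {X Y : C} (hX : E (0 : (0 : C) ⟶ X))
    (hY : M (0 : Y ⟶ (0 : C))) (f : X ⟶ Y) : f = 0 :=
  (hfs.uniqueLift hX hY).hom_ext (by simp) (by simp)

theorem IsFS.right_of_isZero (hfs : IsFS E M) {X : C} (hX : IsZero X) :
    M (0 : X ⟶ (0 : C)) :=
  (hfs.right_iff _).2 fun _ _ _ _ _ =>
    ⟨0, ⟨hX.eq_of_tgt _ _, HasZeroObject.to_zero_ext _ _⟩, fun _ _ => hX.eq_of_tgt _ _⟩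

theorem IsFS.left_of_isZero (hfs : IsFS E M) {X : C} (hX : IsZero X) :
    E (0 : (0 : C) ⟶ X) :=
  (hfs.left_iff _).2 fun _ _ _ _ _ =>
    ⟨0, ⟨HasZeroObject.from_zero_ext _ _, hX.eq_of_src _ _⟩, fun _ _ => hX.eq_of_src _ _⟩

/-- In a coreflective factorization system, an object receiving only zero morphisms from
torsion objects is torsion-free. -/
theorem IsFS.right_to_zero (hfs : IsFS E M)
    (hcorefl : ∀ {X Y Z : C} (f : X ⟶ Y) (g : Y ⟶ Z), M (f ≫ g) → M f → M g) {Z : C}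
    (h : ∀ {S : C} (s : S ⟶ Z), E (0 : (0 : C) ⟶ S) → s = 0) : M (0 : Z ⟶ (0 : C)) := by
  obtain ⟨S, e, s, he, hs, -⟩ := hfs.factor (0 : (0 : C) ⟶ Z)
  obtain rfl : e = 0 := HasZeroObject.from_zero_ext _ _
  have hS : IsZero S := (IsZero.iff_id_eq_zero S).2 <|
    (hfs.uniqueLift he hs).hom_ext (by simp) (by simp [h s he])
  exact hcorefl s 0 (by rw [comp_zero]; exact hfs.right_of_isZero hS) hs

/-- In a reflective factorization system, an object admitting only zero morphisms to
torsion-free objects is torsion. -/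
theorem IsFS.left_from_zero (hfs : IsFS E M)
    (hrefl : ∀ {X Y Z : C} (f : X ⟶ Y) (g : Y ⟶ Z), E (f ≫ g) → E g → E f) {Z : C}
    (h : ∀ {R : C} (r : Z ⟶ R), M (0 : R ⟶ (0 : C)) → r = 0) : E (0 : (0 : C) ⟶ Z) := by
  obtain ⟨R, r, m, hr, hm, -⟩ := hfs.factor (0 : Z ⟶ (0 : C))
  obtain rfl : m = 0 := HasZeroObject.to_zero_ext _ _
  have hR : IsZero R := (IsZero.iff_id_eq_zero R).2 <|
    (hfs.uniqueLift hr hm).hom_ext (by simp [h r hm]) (by simp)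
  exact hrefl 0 r (by rw [zero_comp]; exact hfs.left_of_isZero hR) hr

theorem isNormalEpi_of_left (hfs : IsFS E M)
    (hcorefl : ∀ {X Y Z : C} (f : X ⟶ Y) (g : Y ⟶ Z), M (f ≫ g) → M f → M g)
    (hfac : ∀ {X Y : C} (f : X ⟶ Y), ∃ (Z : C) (n : X ⟶ Z) (m : Z ⟶ Y),
      IsNormalEpi n ∧ HasZeroKernel m ∧ n ≫ m = f)
    {X Y : C} {ρ : X ⟶ Y} (hρ : E ρ) (hY : M (0 : Y ⟶ (0 : C))) : IsNormalEpi ρ := by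
  obtain ⟨Z, n, m, hn, hm, rfl⟩ := hfac ρ
  have hZ : M (0 : Z ⟶ (0 : C)) :=
    hfs.right_to_zero hcorefl fun s hS => hm.eq_zero (hfs.eq_zero hS hY _)
  obtain ⟨d, ⟨hd, -⟩, -⟩ := hfs.uniqueLift hρ hZ n 0 (by simp)
  have hdm : d ≫ m = 𝟙 Y := (hfs.uniqueLift hρ hY).hom_ext
    (by rw [← Category.assoc, hd, Category.comp_id]) (by simp)
  have := hn.epi
  have hmd : m ≫ d = 𝟙 Z := by
    rw [← cancel_epi n, ← Category.assoc, hd, Category.comp_id]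
  exact hn.comp_iso ⟨m, d, hmd, hdm⟩

theorem isNormalMono_of_right (hfs : IsFS E M)
    (hrefl : ∀ {X Y Z : C} (f : X ⟶ Y) (g : Y ⟶ Z), E (f ≫ g) → E g → E f)
    (hfac : ∀ {X Y : C} (f : X ⟶ Y), ∃ (Z : C) (e : X ⟶ Z) (m : Z ⟶ Y),
      HasZeroCokernel e ∧ IsNormalMono m ∧ e ≫ m = f)
    {X Y : C} {σ : X ⟶ Y} (hσ : M σ) (hX : E (0 : (0 : C) ⟶ X)) : IsNormalMono σ := by
  obtain ⟨Z, e, m, he, hm, rfl⟩ := hfac σ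
  have hZ : E (0 : (0 : C) ⟶ Z) :=
    hfs.left_from_zero hrefl fun r hR => he.eq_zero (hfs.eq_zero hX hR _)
  obtain ⟨d, ⟨-, hd⟩, -⟩ := hfs.uniqueLift hZ hσ 0 m (by simp)
  have hed : e ≫ d = 𝟙 X := (hfs.uniqueLift hX hσ).hom_ext
    (by simp) (by rw [Category.assoc, hd, Category.id_comp])
  have := hm.mono
  have hde : d ≫ e = 𝟙 Z := by
    rw [← cancel_mono m, Category.assoc, hd, Category.id_comp]
  exact hm.iso_comp ⟨e, d, hed, hde⟩

end ZeroMorphisms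

theorem statement15 [HasZeroObject C] [HasZeroMorphisms C]
    (E M : MorphismProperty C)
    -- (E, M) is a torsion theory: a reflective and coreflective fs
    (hfs : IsFS E M)
    (hrefl : ∀ {X Y Z : C} (f : X ⟶ Y) (g : Y ⟶ Z), E (f ≫ g) → E g → E f)
    (hcorefl : ∀ {X Y Z : C} (f : X ⟶ Y) (g : Y ⟶ Z), M (f ≫ g) → M f → M g) :
    -- if C has (NormEpi, 0Ker)-factorizations then each reflection into F(M)
    -- (i.e. each E-morphism with codomain in F(M)) is a normal epimorphism
    ((∀ {X Y : C} (f : X ⟶ Y), ∃ (Z : C) (n : X ⟶ Z) (m : Z ⟶ Y),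
        IsNormalEpi n ∧ HasZeroKernel m ∧ n ≫ m = f) →
      ∀ {X Y : C} (ρ : X ⟶ Y), E ρ → M (0 : Y ⟶ (0 : C)) → IsNormalEpi ρ) ∧
    -- dually, if C has (0Coker, NormMono)-factorizations then each coreflection
    -- from T(E) (i.e. each M-morphism with domain in T(E)) is a normal mono
    ((∀ {X Y : C} (f : X ⟶ Y), ∃ (Z : C) (e : X ⟶ Z) (m : Z ⟶ Y),
        HasZeroCokernel e ∧ IsNormalMono m ∧ e ≫ m = f) →
      ∀ {X Y : C} (σ : X ⟶ Y), M σ → E (0 : (0 : C) ⟶ X) → IsNormalMono σ) := by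
  exact ⟨fun hfac _ _ _ hρ hY => isNormalEpi_of_left hfs hcorefl hfac hρ hY,
    fun hfac _ _ _ hσ hX => isNormalMono_of_right hfs hrefl hfac hσ hX⟩

end Stmt15
end

section
/- Let (E, M) be a torsion theory in a pointed category C with kernels and cokernels, such that each reflection ρ_C : C → RC into F(M) is a normal epimorphism and each coreflection σ_C : SC → C from T(E) is a normal monomorphism; write κ_C = ker ρ_C : KC → C and π_C = coker σ_C : C → QC. Then for every object C the following are equivalent: (i) π_C ∘ κ_C = 0; (ii) ker ρ_{QC} = 0; (iii) π_{QC} is an isomorphism; (iv) QC ∈ F(M); (v) coker σ_{KC} = 0; (vi) κ_{KC} is an isomorphism; (vii) KC ∈ T(E); (viii) (0 → QC) ∈ M; (ix) (KC → 0) ∈ E. -/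
/-!
Statement 17 (Theorem 4.10): For a torsion theory (E, M) in a pointed category C
with kernels and cokernels, whose reflections ρ_C are normal epis and
coreflections σ_C are normal monos, with κ_C = ker ρ_C : KC ⟶ C and
π_C = coker σ_C : C ⟶ QC, TFAE for every object C:
(i) π_C κ_C = 0; (ii) ker ρ_{QC} = 0; (iii) π_{QC} iso; (iv) QC ∈ F(M);
(v) coker σ_{KC} = 0; (vi) κ_{KC} iso; (vii) KC ∈ T(E); (viii) (0 → QC) ∈ M;
(ix) (KC → 0) ∈ E.
-/

open CategoryTheory CategoryTheory.Limits List

open scoped ZeroObject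

universe v u

namespace Stmt17

variable {C : Type u} [Category.{v} C]

def UniqueLift {A B X Y : C} (e : A ⟶ B) (m : X ⟶ Y) : Prop :=
  ∀ (u : A ⟶ X) (v : B ⟶ Y), u ≫ m = e ≫ v →
    ∃! d : B ⟶ X, e ≫ d = u ∧ d ≫ m = v

structure IsFS (E M : MorphismProperty C) : Prop where
  factor : ∀ {X Y : C} (f : X ⟶ Y),
    ∃ (Z : C) (e : X ⟶ Z) (m : Z ⟶ Y), E e ∧ M m ∧ e ≫ m = f
  left_iff : ∀ {X Y : C} (f : X ⟶ Y),
    E f ↔ ∀ {A B : C} (m : A ⟶ B), M m → UniqueLift f m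
  right_iff : ∀ {X Y : C} (g : X ⟶ Y),
    M g ↔ ∀ {A B : C} (e : A ⟶ B), E e → UniqueLift e g

def IsNormalEpi [HasZeroMorphisms C] {X Y : C} (f : X ⟶ Y) : Prop :=
  ∃ (W : C) (g : W ⟶ X) (w : g ≫ f = 0),
    Nonempty (IsColimit (CokernelCofork.ofπ f w))

def IsNormalMono [HasZeroMorphisms C] {X Y : C} (f : X ⟶ Y) : Prop :=
  ∃ (W : C) (g : Y ⟶ W) (w : f ≫ g = 0),
    Nonempty (IsLimit (KernelFork.ofι f w))

section NormalMorphisms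

variable [HasZeroMorphisms C] {X Y : C} {f : X ⟶ Y}

theorem IsNormalEpi.exists_desc [HasKernel f] (hf : IsNormalEpi f) {Z : C} (k : X ⟶ Z)
    (hk : kernel.ι f ≫ k = 0) : ∃ d : Y ⟶ Z, f ≫ d = k := by
  obtain ⟨W, g, w, ⟨h⟩⟩ := hf
  have hg : g ≫ k = 0 := by
    rw [← kernel.lift_ι f g w, Category.assoc, hk, comp_zero]
  exact ⟨_, (CokernelCofork.IsColimit.desc' h k hg).2⟩

theorem IsNormalMono.exists_lift [HasCokernel f] (hf : IsNormalMono f) {Z : C} (k : Z ⟶ Y)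
    (hk : k ≫ cokernel.π f = 0) : ∃ d : Z ⟶ X, d ≫ f = k := by
  obtain ⟨W, g, w, ⟨h⟩⟩ := hf
  have hg : k ≫ g = 0 := by
    rw [← cokernel.π_desc f g w, reassoc_of% hk, zero_comp]
  exact ⟨_, (KernelFork.IsLimit.lift' h k hg).2⟩

end NormalMorphisms

section TorsionObjects

variable [HasZeroObject C] [HasZeroMorphisms C] {E M : MorphismProperty C}

/-- Torsion objects are those orthogonal to every morphism of the right class. -/
theorem IsFS.torsion_iff (hfs : IsFS E M) (A : C) :
    E (0 : (0 : C) ⟶ A) ↔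
      ∀ {X Y : C} (m : X ⟶ Y), M m → ∀ v : A ⟶ Y, ∃! d : A ⟶ X, d ≫ m = v := by
  rw [hfs.left_iff]
  constructor
  · intro h X Y m hm v
    obtain ⟨d, ⟨-, hd⟩, hu⟩ := h m hm 0 v (by simp)
    exact ⟨d, hd, fun y hy => hu y ⟨by simp, hy⟩⟩
  · intro h X Y m hm u v _
    obtain ⟨d, hd, hu⟩ := h m hm v
    exact ⟨d, ⟨(isZero_zero C).eq_of_src _ _, hd⟩, fun y hy => hu y hy.2⟩

/-- Torsion-free objects are those orthogonal to every morphism of the left class. -/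
theorem IsFS.torsionFree_iff (hfs : IsFS E M) (B : C) :
    M (0 : B ⟶ (0 : C)) ↔
      ∀ {X Y : C} (e : X ⟶ Y), E e → ∀ u : X ⟶ B, ∃! d : Y ⟶ B, e ≫ d = u := by
  rw [hfs.right_iff]
  constructor
  · intro h X Y e he u
    obtain ⟨d, ⟨hd, -⟩, hu⟩ := h e he u 0 (by simp)
    exact ⟨d, hd, fun y hy => hu y ⟨hy, by simp⟩⟩
  · intro h X Y e he u v _
    obtain ⟨d, hd, hu⟩ := h e he u
    exact ⟨d, ⟨hd, (isZero_zero C).eq_of_tgt _ _⟩, fun y hy => hu y hy.1⟩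

theorem IsFS.torsion_of_retract (hfs : IsFS E M) {A B : C} (i : A ⟶ B) (r : B ⟶ A)
    (hir : i ≫ r = 𝟙 A) (hB : E (0 : (0 : C) ⟶ B)) : E (0 : (0 : C) ⟶ A) := by
  rw [hfs.torsion_iff] at hB ⊢
  intro X Y m hm v
  obtain ⟨d, hd, -⟩ := hB m hm (r ≫ v)
  refine ⟨i ≫ d, by simp [hd, reassoc_of% hir], fun y hy => ?_⟩
  have := (hB m hm (r ≫ v)).unique (y₁ := r ≫ y) (by simp [hy]) hd
  rw [← this, reassoc_of% hir]

theorem IsFS.torsionFree_of_retract (hfs : IsFS E M) {A B : C} (i : A ⟶ B) (r : B ⟶ A)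
    (hir : i ≫ r = 𝟙 A) (hB : M (0 : B ⟶ (0 : C))) : M (0 : A ⟶ (0 : C)) := by
  rw [hfs.torsionFree_iff] at hB ⊢
  intro X Y e he u
  obtain ⟨d, hd, -⟩ := hB e he (u ≫ i)
  refine ⟨d ≫ r, by simp [reassoc_of% hd, hir], fun y hy => ?_⟩
  have := (hB e he (u ≫ i)).unique (y₁ := y ≫ i) (by simp [reassoc_of% hy]) hd
  rw [← this, Category.assoc, hir, Category.comp_id]

theorem IsFS.torsion_iff_to_zero (hfs : IsFS E M)
    (hrefl : ∀ {X Y Z : C} (f : X ⟶ Y) (g : Y ⟶ Z), E (f ≫ g) → E g → E f) (A : C) :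
    E (0 : (0 : C) ⟶ A) ↔ E (0 : A ⟶ (0 : C)) := by
  constructor
  · intro h
    rw [hfs.left_iff]
    intro X Y m hm u v huv
    have hu : u = 0 := ((hfs.torsion_iff A).1 h m hm 0).unique (by simpa using huv) (by simp)
    exact ⟨0, ⟨by simp [hu], (isZero_zero C).eq_of_src _ _⟩,
      fun _ _ => (isZero_zero C).eq_of_src _ _⟩
  · intro h
    refine hrefl _ _ ?_ h
    rw [zero_comp, hfs.torsion_iff]
    exact fun _ _ _ => ⟨0, (isZero_zero C).eq_of_src _ _,
      fun _ _ => (isZero_zero C).eq_of_src _ _⟩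

theorem IsFS.torsionFree_iff_from_zero (hfs : IsFS E M)
    (hcorefl : ∀ {X Y Z : C} (f : X ⟶ Y) (g : Y ⟶ Z), M (f ≫ g) → M f → M g) (B : C) :
    M (0 : B ⟶ (0 : C)) ↔ M (0 : (0 : C) ⟶ B) := by
  constructor
  · intro h
    rw [hfs.right_iff]
    intro X Y e he u v huv
    have hv : v = 0 :=
      ((hfs.torsionFree_iff B).1 h e he 0).unique (by simpa using huv.symm) (by simp)
    exact ⟨0, ⟨(isZero_zero C).eq_of_tgt _ _, by simp [hv]⟩,
      fun _ _ => (isZero_zero C).eq_of_tgt _ _⟩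
  · intro h
    refine hcorefl _ _ ?_ h
    rw [zero_comp, hfs.torsionFree_iff]
    exact fun _ _ _ => ⟨0, (isZero_zero C).eq_of_tgt _ _,
      fun _ _ => (isZero_zero C).eq_of_tgt _ _⟩

theorem IsFS.hom_eq_zero (hfs : IsFS E M) {A B : C} (hA : E (0 : (0 : C) ⟶ A))
    (hB : M (0 : B ⟶ (0 : C))) (f : A ⟶ B) : f = 0 :=
  ((hfs.torsion_iff A).1 hA _ hB 0).unique (by simp) (by simp)

theorem IsFS.from_zero_mem_of_zero_mem (hfs : IsFS E M) {A B : C}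
    (h : M (0 : A ⟶ B)) : M (0 : (0 : C) ⟶ B) := by
  rw [hfs.right_iff]
  intro X Y e he u v huv
  obtain ⟨d, ⟨-, hd⟩, -⟩ := (hfs.right_iff _).1 h e he 0 v (by simpa using huv)
  exact ⟨0, ⟨(isZero_zero C).eq_of_tgt _ _, by simpa using hd⟩,
    fun _ _ => (isZero_zero C).eq_of_tgt _ _⟩

theorem IsFS.to_zero_mem_of_zero_mem (hfs : IsFS E M) {A B : C}
    (h : E (0 : A ⟶ B)) : E (0 : A ⟶ (0 : C)) := by
  rw [hfs.left_iff]
  intro X Y m hm u v huv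
  obtain ⟨d, ⟨hd, -⟩, -⟩ := (hfs.left_iff _).1 h m hm u 0 (by simpa using huv)
  exact ⟨0, ⟨by simpa using hd, (isZero_zero C).eq_of_src _ _⟩,
    fun _ _ => (isZero_zero C).eq_of_src _ _⟩

end TorsionObjects

theorem statement17 [HasZeroObject C] [HasZeroMorphisms C]
    [HasKernels C] [HasCokernels C]
    (E M : MorphismProperty C)
    -- (E, M) is a torsion theory
    (hfs : IsFS E M)
    (hrefl : ∀ {X Y Z : C} (f : X ⟶ Y) (g : Y ⟶ Z), E (f ≫ g) → E g → E f)
    (hcorefl : ∀ {X Y Z : C} (f : X ⟶ Y) (g : Y ⟶ Z), M (f ≫ g) → M f → M g)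
    (R : C → C) (ρ : ∀ X : C, X ⟶ R X)
    (hEρ : ∀ X : C, E (ρ X)) (hRF : ∀ X : C, M (0 : R X ⟶ (0 : C)))
    (S : C → C) (σ : ∀ X : C, S X ⟶ X)
    (hMσ : ∀ X : C, M (σ X)) (hTS : ∀ X : C, E (0 : (0 : C) ⟶ S X))
    (hρepi : ∀ X : C, IsNormalEpi (ρ X))
    (hσmono : ∀ X : C, IsNormalMono (σ X))
    (X : C) :
    [ -- (i) π_C ∘ κ_C = 0
      kernel.ι (ρ X) ≫ cokernel.π (σ X) = 0,
      -- (ii) ker ρ_{QC} = 0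
      IsZero (kernel (ρ (cokernel (σ X)))),
      -- (iii) π_{QC} is an isomorphism
      IsIso (cokernel.π (σ (cokernel (σ X)))),
      -- (iv) QC ∈ F(M)
      M (0 : cokernel (σ X) ⟶ (0 : C)),
      -- (v) coker σ_{KC} = 0
      IsZero (cokernel (σ (kernel (ρ X)))),
      -- (vi) κ_{KC} is an isomorphism
      IsIso (kernel.ι (ρ (kernel (ρ X)))),
      -- (vii) KC ∈ T(E)
      E (0 : (0 : C) ⟶ kernel (ρ X)),
      -- (viii) (0 ⟶ QC) ∈ M
      M (0 : (0 : C) ⟶ cokernel (σ X)),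
      -- (ix) (KC ⟶ 0) ∈ E
      E (0 : kernel (ρ X) ⟶ (0 : C)) ].TFAE := by
  have hTF : ∀ A, σ A ≫ ρ A = 0 := fun A => hfs.hom_eq_zero (hTS A) (hRF A) _
  tfae_have 4 ↔ 8 := hfs.torsionFree_iff_from_zero hcorefl _
  tfae_have 7 ↔ 9 := hfs.torsion_iff_to_zero hrefl _
  tfae_have 2 → 4 := by
    intro h
    obtain ⟨d, hd⟩ := (hρepi (cokernel (σ X))).exists_desc (𝟙 _) (h.eq_of_src _ _)
    exact hfs.torsionFree_of_retract _ d hd (hRF _)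
  tfae_have 4 → 2 := by
    intro h
    obtain ⟨d, hd, -⟩ := (hfs.torsionFree_iff _).1 h _ (hEρ _) (𝟙 _)
    apply IsZero.of_mono_eq_zero (kernel.ι (ρ (cokernel (σ X))))
    rw [← Category.comp_id (kernel.ι _), ← hd, kernel.condition_assoc, zero_comp]
  tfae_have 3 → 8 := by
    intro h
    have h0 : σ (cokernel (σ X)) = 0 := by
      rw [← cancel_mono (cokernel.π (σ (cokernel (σ X)))), cokernel.condition, zero_comp]
    have hM := hMσ (cokernel (σ X))
    rw [h0] at hM
    exact hfs.from_zero_mem_of_zero_mem hM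
  tfae_have 4 → 3 := by
    intro h
    have h0 : σ (cokernel (σ X)) = 0 := hfs.hom_eq_zero (hTS _) h _
    refine ⟨cokernel.desc _ (𝟙 _) (by simp [h0]), by simp, ?_⟩
    rw [← cancel_epi (cokernel.π _)]
    simp
  tfae_have 5 → 7 := by
    intro h
    obtain ⟨d, hd⟩ := (hσmono (kernel (ρ X))).exists_lift (𝟙 _) (h.eq_of_tgt _ _)
    exact hfs.torsion_of_retract d _ hd (hTS _)
  tfae_have 7 → 5 := by
    intro h
    obtain ⟨d, hd, -⟩ := (hfs.torsion_iff _).1 h _ (hMσ _) (𝟙 _)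
    apply IsZero.of_epi_eq_zero (cokernel.π (σ (kernel (ρ X))))
    rw [← Category.id_comp (cokernel.π _), ← hd, Category.assoc, cokernel.condition, comp_zero]
  tfae_have 6 → 9 := by
    intro h
    have h0 : ρ (kernel (ρ X)) = 0 := by
      rw [← cancel_epi (kernel.ι (ρ (kernel (ρ X)))), kernel.condition, comp_zero]
    have hE := hEρ (kernel (ρ X))
    rw [h0] at hE
    exact hfs.to_zero_mem_of_zero_mem hE
  tfae_have 7 → 6 := by
    intro h
    have h0 : ρ (kernel (ρ X)) = 0 := hfs.hom_eq_zero h (hRF _) _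
    refine ⟨kernel.lift _ (𝟙 _) (by simp [h0]), ?_, by simp⟩
    rw [← cancel_mono (kernel.ι _)]
    simp
  tfae_have 1 → 7 := by
    intro h
    obtain ⟨d, hd⟩ := (hσmono X).exists_lift _ h
    refine hfs.torsion_of_retract d (kernel.lift _ (σ X) (hTF X)) ?_ (hTS X)
    rw [← cancel_mono (kernel.ι _)]
    simp [hd]
  tfae_have 7 → 1 := by
    intro h
    obtain ⟨d, hd, -⟩ := (hfs.torsion_iff _).1 h _ (hMσ X) (kernel.ι (ρ X))
    rw [← hd, Category.assoc, cokernel.condition, comp_zero]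
  tfae_have 1 → 4 := by
    intro h
    obtain ⟨d, hd⟩ := (hρepi X).exists_desc _ h
    refine hfs.torsionFree_of_retract (cokernel.desc _ (ρ X) (hTF X)) d ?_ (hRF X)
    rw [← cancel_epi (cokernel.π _)]
    simp [hd]
  tfae_have 4 → 1 := by
    intro h
    obtain ⟨d, hd, -⟩ := (hfs.torsionFree_iff _).1 h _ (hEρ X) (cokernel.π (σ X))
    rw [← hd, kernel.condition_assoc, zero_comp]
  tfae_finish

end Stmt17
end

section
/- Let (E, M) be a torsion theory in a pointed, finitely complete category C with kernels and cokernels, such that each reflection ρ_C : C → RC into F(M) is a normal epimorphism and each coreflection σ_C : SC → C from T(E) is a normal monomorphism. If (E, M) is simple (i.e., M = Cart(R, ρ), the class of morphisms whose ρ-naturality square is a pullback), then the torsion theory is normal: for every object C, with κ_C = ker ρ_C : KC → C and π_C = coker σ_C : C → QC, one has π_C ∘ κ_C = 0 (equivalently, KC ∈ T(E) and QC ∈ F(M)). -/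
/-!
Statement 18 (Theorem 4.10, last claim / Remark 4.11): A simple torsion theory
(E, M) in a pointed finitely complete category C with kernels and cokernels,
whose reflections are normal epis and coreflections are normal monos, is normal:
π_C ∘ κ_C = 0 (equivalently, KC ∈ T(E) and QC ∈ F(M)) for every object C.
-/

open CategoryTheory CategoryTheory.Limits

open scoped ZeroObject

universe v u

namespace Stmt18

variable {C : Type u} [Category.{v} C]

def UniqueLift {A B X Y : C} (e : A ⟶ B) (m : X ⟶ Y) : Prop :=
  ∀ (u : A ⟶ X) (v : B ⟶ Y), u ≫ m = e ≫ v →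
    ∃! d : B ⟶ X, e ≫ d = u ∧ d ≫ m = v

structure IsFS (E M : MorphismProperty C) : Prop where
  factor : ∀ {X Y : C} (f : X ⟶ Y),
    ∃ (Z : C) (e : X ⟶ Z) (m : Z ⟶ Y), E e ∧ M m ∧ e ≫ m = f
  left_iff : ∀ {X Y : C} (f : X ⟶ Y),
    E f ↔ ∀ {A B : C} (m : A ⟶ B), M m → UniqueLift f m
  right_iff : ∀ {X Y : C} (g : X ⟶ Y),
    M g ↔ ∀ {A B : C} (e : A ⟶ B), E e → UniqueLift e g

def IsNormalEpi [HasZeroMorphisms C] {X Y : C} (f : X ⟶ Y) : Prop :=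
  ∃ (W : C) (g : W ⟶ X) (w : g ≫ f = 0),
    Nonempty (IsColimit (CokernelCofork.ofπ f w))

def IsNormalMono [HasZeroMorphisms C] {X Y : C} (f : X ⟶ Y) : Prop :=
  ∃ (W : C) (g : Y ⟶ W) (w : f ≫ g = 0),
    Nonempty (IsLimit (KernelFork.ofι f w))

lemma IsFS.left_comp_iso {E M : MorphismProperty C} (h : IsFS E M) {A B B' : C}
    {e : A ⟶ B} (he : E e) (i : B ≅ B') : E (e ≫ i.hom) := by
  refine (h.left_iff _).2 fun m hm u v huv ↦ ?_
  obtain ⟨d, ⟨hd, hd'⟩, hu⟩ := (h.left_iff e).1 he m hm u (i.hom ≫ v) (by simpa using huv)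
  refine ⟨i.inv ≫ d, ⟨by simpa using hd, by simp [hd']⟩, fun y ⟨hy, hy'⟩ ↦ ?_⟩
  rw [← hu (i.hom ≫ y) ⟨by simpa using hy, by simp [hy']⟩]
  simp

lemma IsFS.right_iso_comp {E M : MorphismProperty C} (h : IsFS E M) {Y Y' Z : C}
    {m : Y ⟶ Z} (hm : M m) (i : Y' ≅ Y) : M (i.hom ≫ m) := by
  refine (h.right_iff _).2 fun e he u v huv ↦ ?_
  obtain ⟨d, ⟨hd, hd'⟩, hu⟩ := (h.right_iff m).1 hm e he (u ≫ i.hom) v (by simpa using huv)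
  refine ⟨d ≫ i.inv, ⟨by simp [reassoc_of% hd], by simpa using hd'⟩, fun y ⟨hy, hy'⟩ ↦ ?_⟩
  rw [← hu (y ≫ i.hom) ⟨by simp [reassoc_of% hy], by simpa using hy'⟩]
  simp

/-- A morphism from a torsion object to a torsion-free object is zero. -/
lemma IsFS.eq_zero_of_torsion [HasZeroObject C] [HasZeroMorphisms C]
    {E M : MorphismProperty C} (h : IsFS E M) {A B : C} (hA : E (0 : (0 : C) ⟶ A))
    (hB : M (0 : B ⟶ (0 : C))) (f : A ⟶ B) : f = 0 :=
  ((h.left_iff _).1 hA _ hB 0 0 (by simp)).unique ⟨by simp, by simp⟩ ⟨by simp, by simp⟩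

lemma IsNormalMono.mono [HasZeroMorphisms C] {X Y : C} {f : X ⟶ Y} (h : IsNormalMono f) :
    Mono f := by
  obtain ⟨W, g, w, ⟨hl⟩⟩ := h
  exact ⟨fun a b hab ↦ Fork.IsLimit.hom_ext hl hab⟩

lemma IsNormalEpi.epi [HasZeroMorphisms C] {X Y : C} {f : X ⟶ Y} (h : IsNormalEpi f) :
    Epi f := by
  obtain ⟨W, g, w, ⟨hl⟩⟩ := h
  exact ⟨fun a b hab ↦ Cofork.IsColimit.hom_ext hl hab⟩

/-- A normal epimorphism is the cokernel of its kernel. -/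
lemma IsNormalEpi.exists_desc [HasZeroMorphisms C] [HasKernels C] {X Y Z : C} {f : X ⟶ Y}
    (h : IsNormalEpi f) (k : X ⟶ Z) (hk : kernel.ι f ≫ k = 0) : ∃ d : Y ⟶ Z, f ≫ d = k := by
  obtain ⟨W, g, w, ⟨hl⟩⟩ := h
  have hg : g ≫ k = 0 := by
    rw [← kernel.lift_ι f g w, Category.assoc, hk, comp_zero]
  exact ⟨_, (CokernelCofork.IsColimit.desc' hl k hg).2⟩

theorem statement18 [HasFiniteLimits C] [HasZeroObject C] [HasZeroMorphisms C]
    [HasKernels C] [HasCokernels C]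
    (E M : MorphismProperty C)
    -- (E, M) is a torsion theory
    (hfs : IsFS E M)
    (hrefl : ∀ {X Y Z : C} (f : X ⟶ Y) (g : Y ⟶ Z), E (f ≫ g) → E g → E f)
    (hcorefl : ∀ {X Y Z : C} (f : X ⟶ Y) (g : Y ⟶ Z), M (f ≫ g) → M f → M g)
    -- the reflector R into F(M), with reflections ρ
    (R : C → C) (ρ : ∀ X : C, X ⟶ R X)
    (Rmap : ∀ (X Y : C), (X ⟶ Y) → (R X ⟶ R Y))
    (hEρ : ∀ X : C, E (ρ X)) (hRF : ∀ X : C, M (0 : R X ⟶ (0 : C)))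
    (hnat : ∀ {X Y : C} (f : X ⟶ Y), ρ X ≫ Rmap X Y f = f ≫ ρ Y)
    -- the coreflections σ from T(E)
    (S : C → C) (σ : ∀ X : C, S X ⟶ X)
    (hMσ : ∀ X : C, M (σ X)) (hTS : ∀ X : C, E (0 : (0 : C) ⟶ S X))
    -- reflections are normal epis, coreflections are normal monos
    (hρepi : ∀ X : C, IsNormalEpi (ρ X))
    (hσmono : ∀ X : C, IsNormalMono (σ X))
    -- (E, M) is simple: M = Cart(R, ρ)
    (hsimple : ∀ {X Y : C} (f : X ⟶ Y),
      M f ↔ IsPullback f (ρ X) (ρ Y) (Rmap X Y f))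
    (X : C) :
    kernel.ι (ρ X) ≫ cokernel.π (σ X) = 0 ∧
    E (0 : (0 : C) ⟶ kernel (ρ X)) ∧
    M (0 : cokernel (σ X) ⟶ (0 : C)) := by
  have := (hσmono X).mono
  have := (hρepi X).epi
  have hρS : ρ (S X) = 0 := hfs.eq_zero_of_torsion (hTS X) (hRF _) _
  have hσρ : σ X ≫ ρ X = 0 := by rw [← hnat (σ X), hρS, zero_comp]
  obtain ⟨l, hl⟩ : ∃ l : kernel (ρ X) ⟶ S X, l ≫ σ X = kernel.ι (ρ X) :=
    ⟨_, ((hsimple (σ X)).1 (hMσ X)).lift_fst (kernel.ι (ρ X)) 0 (by simp)⟩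
  have hκπ : kernel.ι (ρ X) ≫ cokernel.π (σ X) = 0 := by
    rw [← hl, Category.assoc, cokernel.condition, comp_zero]
  let i : S X ≅ kernel (ρ X) :=
    { hom := kernel.lift (ρ X) (σ X) hσρ
      inv := l
      hom_inv_id := by simp [← cancel_mono (σ X), hl]
      inv_hom_id := by simp [← cancel_mono (kernel.ι (ρ X)), hl] }
  obtain ⟨d, hd⟩ := (hρepi X).exists_desc (cokernel.π (σ X)) hκπ
  let j : cokernel (σ X) ≅ R X :=
    { hom := cokernel.desc (σ X) (ρ X) hσρ
      inv := d
      hom_inv_id := by simp [← cancel_epi (cokernel.π (σ X)), hd]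
      inv_hom_id := by simp [← cancel_epi (ρ X), reassoc_of% hd] }
  exact ⟨hκπ, by simpa using hfs.left_comp_iso (hTS X) i,
    by simpa using hfs.right_iso_comp (hRF X) j⟩

end Stmt18
end

section
/- Let C be a finitely complete pointed category with cokernels of kernels in which normal epimorphisms are stable under pullback, and let (T, F) be a standard torsion theory of C: T and F are full replete subcategories such that every morphism from an object of T to an object of F is zero, and every object C fits into a sequence A →k C →q B with A ∈ T, B ∈ F, k = ker q and q = coker k. Then (T, F) determines a simple reflective factorization system (E, M) of C — namely E = R⁻¹(Iso C) and M = Cart(R, ρ) for the reflector R of F with reflection ρ, and every morphism f : A → B factors as the comparison morphism A → B ×_{RB} RA (which lies in E) followed by the pullback projection (which lies in M) — such that F(M) = F is normal-epireflective (all reflections are normal epimorphisms) and T(E) = T is normal-mono-coreflective (all coreflections are normal monomorphisms). -/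
/-!
Statement 19 (Theorem 5.2, first statement): In a finitely complete pointed
category C with cokernels of kernels in which normal epimorphisms are stable
under pullback, every standard torsion theory (T, F) determines a simple
reflective factorization system (E, M) = (R⁻¹(Iso C), Cart(R, ρ)), where every
morphism factors as the comparison into the pullback of Rf along ρ (which lies
in E) followed by the pullback projection (which lies in M), with F(M) = F
normal-epireflective and T(E) = T normal-mono-coreflective.
-/

open CategoryTheory CategoryTheory.Limits

open scoped ZeroObject

universe v u

namespace Stmt19

variable {C : Type u} [Category.{v} C]

def UniqueLift {A B X Y : C} (e : A ⟶ B) (m : X ⟶ Y) : Prop :=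
  ∀ (u : A ⟶ X) (v : B ⟶ Y), u ≫ m = e ≫ v →
    ∃! d : B ⟶ X, e ≫ d = u ∧ d ≫ m = v

structure IsFS (E M : MorphismProperty C) : Prop where
  factor : ∀ {X Y : C} (f : X ⟶ Y),
    ∃ (Z : C) (e : X ⟶ Z) (m : Z ⟶ Y), E e ∧ M m ∧ e ≫ m = f
  left_iff : ∀ {X Y : C} (f : X ⟶ Y),
    E f ↔ ∀ {A B : C} (m : A ⟶ B), M m → UniqueLift f m
  right_iff : ∀ {X Y : C} (g : X ⟶ Y),
    M g ↔ ∀ {A B : C} (e : A ⟶ B), E e → UniqueLift e g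

def IsNormalEpi [HasZeroMorphisms C] {X Y : C} (f : X ⟶ Y) : Prop :=
  ∃ (W : C) (g : W ⟶ X) (w : g ≫ f = 0),
    Nonempty (IsColimit (CokernelCofork.ofπ f w))

def IsNormalMono [HasZeroMorphisms C] {X Y : C} (f : X ⟶ Y) : Prop :=
  ∃ (W : C) (g : Y ⟶ W) (w : f ≫ g = 0),
    Nonempty (IsLimit (KernelFork.ofι f w))

/-- A choice of reflections of all objects into the full subcategory of objects satisfying `F`. -/
structure Reflector (F : C → Prop) where
  obj : C → C
  unit : ∀ X : C, X ⟶ obj X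
  mem : ∀ X : C, F (obj X)
  existsUnique : ∀ (X : C) {Y : C}, F Y → ∀ f : X ⟶ Y, ∃! g : obj X ⟶ Y, unit X ≫ g = f

namespace Reflector

variable {F : C → Prop} (L : Reflector F)

theorem hom_ext {X Y : C} (hY : F Y) {g h : L.obj X ⟶ Y}
    (w : L.unit X ≫ g = L.unit X ≫ h) : g = h :=
  (L.existsUnique X hY (L.unit X ≫ h)).unique w rfl

noncomputable def map {X Y : C} (f : X ⟶ Y) : L.obj X ⟶ L.obj Y :=
  (L.existsUnique X (L.mem Y) (f ≫ L.unit Y)).choose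

theorem unit_map {X Y : C} (f : X ⟶ Y) : L.unit X ≫ L.map f = f ≫ L.unit Y :=
  (L.existsUnique X (L.mem Y) (f ≫ L.unit Y)).choose_spec.1

theorem unit_map_assoc {X Y Z : C} (f : X ⟶ Y) (g : L.obj Y ⟶ Z) :
    L.unit X ≫ L.map f ≫ g = f ≫ L.unit Y ≫ g := by
  rw [← Category.assoc, L.unit_map, Category.assoc]

theorem map_eq {X Y : C} {f : X ⟶ Y} {g : L.obj X ⟶ L.obj Y}
    (w : L.unit X ≫ g = f ≫ L.unit Y) : L.map f = g :=
  L.hom_ext (L.mem Y) ((L.unit_map f).trans w.symm)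

theorem map_id (X : C) : L.map (𝟙 X) = 𝟙 (L.obj X) :=
  L.map_eq (by simp)

theorem map_comp {X Y Z : C} (f : X ⟶ Y) (g : Y ⟶ Z) :
    L.map (f ≫ g) = L.map f ≫ L.map g :=
  L.map_eq (by rw [L.unit_map_assoc, L.unit_map, Category.assoc])

theorem isIso_map {X Y : C} (f : X ⟶ Y) [IsIso f] : IsIso (L.map f) :=
  ⟨L.map (inv f), by rw [← L.map_comp, IsIso.hom_inv_id, L.map_id],
    by rw [← L.map_comp, IsIso.inv_hom_id, L.map_id]⟩

theorem isIso_unit {X : C} (hX : F X) : IsIso (L.unit X) := by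
  obtain ⟨g, hg, -⟩ := L.existsUnique X hX (𝟙 X)
  exact ⟨g, hg, L.hom_ext (L.mem X) (by rw [reassoc_of% hg, Category.comp_id])⟩

/-- The morphisms inverted by the reflector. -/
def inverted : MorphismProperty C := fun _ _ f => IsIso (L.map f)

/-- The morphisms whose naturality square with respect to the unit is a pullback. -/
def cart : MorphismProperty C := fun X Y f => IsPullback f (L.unit X) (L.unit Y) (L.map f)

theorem inverted_unit (X : C) : L.inverted (L.unit X) := by
  have := L.isIso_unit (L.mem X)
  rw [inverted, L.map_eq (f := L.unit X) rfl]
  exact this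

theorem inverted_of_comp {X Y Z : C} (f : X ⟶ Y) (g : Y ⟶ Z)
    (hfg : L.inverted (f ≫ g)) (hg : L.inverted g) : L.inverted f := by
  rw [inverted, L.map_comp] at hfg
  have : IsIso (L.map g) := hg
  exact IsIso.of_isIso_comp_right (L.map f) (L.map g)

theorem uniqueLift {A B X Y : C} {e : A ⟶ B} {m : X ⟶ Y} (he : L.inverted e)
    (hm : L.cart m) : UniqueLift e m := by
  intro u v huv
  have : IsIso (L.map e) := he
  have hmap : L.map u ≫ L.map m = L.map e ≫ L.map v := by
    rw [← L.map_comp, huv, L.map_comp]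
  have w : v ≫ L.unit Y = (L.unit B ≫ inv (L.map e) ≫ L.map u) ≫ L.map m := by
    simp [hmap, L.unit_map]
  have hunit : e ≫ L.unit B ≫ inv (L.map e) = L.unit A := by
    rw [← L.unit_map_assoc, IsIso.hom_inv_id, Category.comp_id]
  refine ⟨hm.lift v _ w, ⟨hm.hom_ext ?_ ?_, hm.lift_fst _ _ _⟩, ?_⟩
  · rw [Category.assoc, hm.lift_fst, huv]
  · rw [Category.assoc, hm.lift_snd, reassoc_of% hunit, L.unit_map]
  · rintro d ⟨hd, hd'⟩
    refine hm.hom_ext (by rw [hm.lift_fst, hd']) ?_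
    rw [hm.lift_snd, ← L.unit_map, ← hd, L.map_comp, IsIso.inv_hom_id_assoc]

/-- If a pullback `P` of `L.map f` along the unit is reflected by its projection to `L.obj X`, then
this pullback gives an `(inverted, cart)`-factorization of `f`. -/
theorem inverted_and_cart_of_isPullback {X Y P : C} {f : X ⟶ Y} {e : X ⟶ P} {m : P ⟶ Y}
    {r : P ⟶ L.obj X} (h : IsPullback m r (L.unit Y) (L.map f))
    (hr : ∀ {Z : C}, F Z → ∀ g : P ⟶ Z, ∃! g' : L.obj X ⟶ Z, r ≫ g' = g)
    (hem : e ≫ m = f) (her : e ≫ r = L.unit X) : L.inverted e ∧ L.cart m := by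
  obtain ⟨a, ha, -⟩ := L.existsUnique P (L.mem X) r
  obtain ⟨b, hb, -⟩ := hr (L.mem P) (L.unit P)
  have hab : a ≫ b = 𝟙 _ := L.hom_ext (L.mem P) (by rw [reassoc_of% ha, hb, Category.comp_id])
  have hba : b ≫ a = 𝟙 _ :=
    (hr (L.mem X) r).unique (by rw [reassoc_of% hb, ha]) (Category.comp_id r)
  have hbe : L.map e = b := L.map_eq (by rw [← her, Category.assoc, hb])
  refine ⟨?_, ?_⟩
  · rw [inverted, hbe]
    exact ⟨a, hba, hab⟩
  · have hm : L.map m = a ≫ L.map f := by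
      rw [← hem, L.map_comp, hbe, reassoc_of% hab]
    exact h.of_iso (Iso.refl P) (Iso.refl Y) ⟨b, a, hba, hab⟩ (Iso.refl _)
      (by simp) (by simp [hb]) (by simp) (by simp [hm, reassoc_of% hba])

theorem isFS (hL : ∀ {X Y : C} (f : X ⟶ Y), ∃ (Z : C) (e : X ⟶ Z) (m : Z ⟶ Y),
    L.inverted e ∧ L.cart m ∧ e ≫ m = f) : IsFS L.inverted L.cart where
  factor := hL
  left_iff {X Y} f := by
    refine ⟨fun hf _ _ m hm => L.uniqueLift hf hm, fun hf => ?_⟩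
    obtain ⟨Z, e, m, he, hm, rfl⟩ := hL f
    obtain ⟨d, ⟨hd, hd'⟩, -⟩ := hf m hm e (𝟙 Y) (by simp)
    have hmd : m ≫ d = 𝟙 Z :=
      (L.uniqueLift he hm e m rfl).unique ⟨by simpa using hd, by simp [hd']⟩ ⟨by simp, by simp⟩
    have : IsIso m := ⟨d, hmd, hd'⟩
    have := L.isIso_map m
    have : IsIso (L.map e) := he
    rw [inverted, L.map_comp]
    infer_instance
  right_iff {X Y} g := by
    refine ⟨fun hg _ _ e he => L.uniqueLift he hg, fun hg => ?_⟩
    obtain ⟨Z, e, m, he, hm, rfl⟩ := hL g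
    obtain ⟨d, ⟨hd, hd'⟩, -⟩ := hg e he (𝟙 X) m (by simp)
    have hde : d ≫ e = 𝟙 Z :=
      (L.uniqueLift he hm e m rfl).unique ⟨by simp [reassoc_of% hd], by simpa using hd'⟩
        ⟨by simp, by simp⟩
    have : IsIso e := ⟨d, hd, hde⟩
    have := L.isIso_map e
    rw [cart, L.map_comp]
    exact (IsPullback.of_horiz_isIso ⟨(L.unit_map e).symm⟩).paste_horiz hm

end Reflector

/-- A normal epimorphism is the cokernel of each of its kernels. -/
theorem IsNormalEpi.existsUnique_desc [HasZeroMorphisms C] {K X Y Z : C} {f : X ⟶ Y}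
    (hf : IsNormalEpi f) {k : K ⟶ X} {w : k ≫ f = 0} (hk : IsLimit (KernelFork.ofι k w))
    (g : X ⟶ Z) (hg : k ≫ g = 0) : ∃! g' : Y ⟶ Z, f ≫ g' = g := by
  obtain ⟨W, c, wc, ⟨hc⟩⟩ := hf
  obtain ⟨l, hl⟩ := KernelFork.IsLimit.lift' hk c wc
  have hl : l ≫ k = c := hl
  obtain ⟨d, hd⟩ := CokernelCofork.IsColimit.desc' hc g
    (by rw [← hl, Category.assoc, hg, comp_zero])
  exact ⟨d, hd, fun y hy => Cofork.IsColimit.hom_ext hc (hy.trans hd.symm)⟩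

/-- The kernel of a morphism is also a kernel of its pullbacks. -/
theorem exists_isLimit_kernelFork_snd [HasZeroMorphisms C] {K P X Y Z : C} {m : P ⟶ Y}
    {r : P ⟶ X} {g : Y ⟶ Z} {h : X ⟶ Z} (sq : IsPullback m r g h) {k : K ⟶ Y} {w : k ≫ g = 0}
    (hk : IsLimit (KernelFork.ofι k w)) :
    ∃ (k' : K ⟶ P) (w' : k' ≫ r = 0), Nonempty (IsLimit (KernelFork.ofι k' w')) := by
  have : Mono k := mono_of_isLimit_fork hk
  have hk0 : k ≫ g = 0 ≫ h := by rw [w, zero_comp]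
  have : Mono (sq.lift k 0 hk0) := mono_of_mono_fac (sq.lift_fst _ _ _)
  refine ⟨sq.lift k 0 hk0, sq.lift_snd _ _ _, ⟨KernelFork.IsLimit.ofι' _ _ ?_⟩⟩
  intro A a ha
  have hl := KernelFork.IsLimit.lift' hk (a ≫ m)
    (by rw [Category.assoc, sq.w, reassoc_of% ha, zero_comp])
  refine ⟨hl.1, sq.hom_ext ?_ ?_⟩
  · rw [Category.assoc, sq.lift_fst]
    exact hl.2
  · rw [Category.assoc, sq.lift_snd, ha, comp_zero]

/-- The square exhibiting a kernel as a pullback along a morphism out of a zero object. -/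
theorem isPullback_of_isLimit_kernelFork [HasZeroMorphisms C] {K X Y Z : C} {f : X ⟶ Y}
    {k : K ⟶ X} {w : k ≫ f = 0} (hk : IsLimit (KernelFork.ofι k w)) (hZ : IsZero Z)
    (a : K ⟶ Z) (b : Z ⟶ Y) : IsPullback k a f b := by
  refine ⟨⟨by rw [w, hZ.eq_of_src b 0, comp_zero]⟩, ⟨PullbackCone.IsLimit.mk _
    (fun s => hk.lift (KernelFork.ofι s.fst
      (by rw [s.condition, hZ.eq_of_tgt s.snd 0, zero_comp])))
    (fun s => hk.fac (KernelFork.ofι s.fst _) WalkingParallelPair.zero)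
    (fun s => hZ.eq_of_tgt _ _)
    (fun s l hl _ => Fork.IsLimit.hom_ext hk
      (hl.trans (hk.fac (KernelFork.ofι s.fst _) WalkingParallelPair.zero).symm))⟩⟩

theorem statement19 [HasFiniteLimits C] [HasZeroObject C] [HasZeroMorphisms C]
    -- C has cokernels of kernels
    (hcoker : ∀ {X Y : C} (f : X ⟶ Y), IsNormalMono f → HasCokernel f)
    -- normal epimorphisms are stable under pullback
    (hstab : ∀ {P X Y Z : C} (p₁ : P ⟶ X) (p₂ : P ⟶ Y) (f : X ⟶ Z) (g : Y ⟶ Z),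
      IsPullback p₁ p₂ f g → IsNormalEpi g → IsNormalEpi p₁)
    -- (T, F) is a standard torsion theory: full replete subcategories with ...
    (T F : C → Prop)
    (hTrep : ∀ {A B : C}, (A ≅ B) → T A → T B)
    (hFrep : ∀ {A B : C}, (A ≅ B) → F A → F B)
    -- ... only zero morphisms from T to F, and ...
    (hTF0 : ∀ {A B : C}, T A → F B → ∀ f : A ⟶ B, f = 0)
    -- ... every object sits in a short exact sequence A → C → B, A ∈ T, B ∈ F
    (hseq : ∀ X : C, ∃ (A B : C) (k : A ⟶ X) (q : X ⟶ B) (w : k ≫ q = 0),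
      T A ∧ F B ∧ Nonempty (IsLimit (KernelFork.ofι k w)) ∧
        Nonempty (IsColimit (CokernelCofork.ofπ q w))) :
    ∃ (E M : MorphismProperty C),
      -- (E, M) is a reflective factorization system
      IsFS E M ∧
      (∀ {X Y Z : C} (f : X ⟶ Y) (g : Y ⟶ Z), E (f ≫ g) → E g → E f) ∧
      ∃ (R : C → C) (ρ : ∀ X : C, X ⟶ R X)
        (Rmap : ∀ (X Y : C), (X ⟶ Y) → (R X ⟶ R Y))
        (S : C → C) (σ : ∀ X : C, S X ⟶ X),
        -- R is the reflector of F with reflections ρ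
        (∀ X : C, F (R X)) ∧
        (∀ X : C, E (ρ X)) ∧
        (∀ (X : C) {Y : C}, F Y → ∀ f : X ⟶ Y, ∃! g : R X ⟶ Y, ρ X ≫ g = f) ∧
        (∀ {X Y : C} (f : X ⟶ Y), ρ X ≫ Rmap X Y f = f ≫ ρ Y) ∧
        -- E = R⁻¹(Iso C), and (E, M) is simple: M = Cart(R, ρ)
        (∀ {X Y : C} (f : X ⟶ Y), E f ↔ IsIso (Rmap X Y f)) ∧
        (∀ {X Y : C} (f : X ⟶ Y),
          M f ↔ IsPullback f (ρ X) (ρ Y) (Rmap X Y f)) ∧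
        -- every f : X ⟶ Y factors as the comparison morphism into the pullback
        -- of Rf along ρ_Y (which lies in E) followed by the pullback projection
        -- (which lies in M)
        (∀ {X Y : C} (f : X ⟶ Y),
          ∃ (P : C) (e : X ⟶ P) (m : P ⟶ Y) (r : P ⟶ R X),
            IsPullback m r (ρ Y) (Rmap X Y f) ∧
            E e ∧ M m ∧ e ≫ m = f ∧ e ≫ r = ρ X) ∧
        -- F(M) = F is normal-epireflective
        (∀ X : C, F X ↔ M (0 : X ⟶ (0 : C))) ∧
        (∀ X : C, IsNormalEpi (ρ X)) ∧
        -- T(E) = T is normal-mono-coreflective, with coreflector S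
        (∀ X : C, T X ↔ E (0 : (0 : C) ⟶ X)) ∧
        (∀ X : C, T (S X)) ∧
        (∀ X : C, M (σ X)) ∧
        (∀ (Y : C) {X : C}, T X → ∀ f : X ⟶ Y, ∃! g : X ⟶ S Y, g ≫ σ Y = f) ∧
        (∀ X : C, IsNormalMono (σ X)) := by
  choose S R σ ρ w hT hF hk hc using hseq
  have hk (X : C) : IsLimit (KernelFork.ofι (σ X) (w X)) := (hk X).some
  have hc (X : C) : IsColimit (CokernelCofork.ofπ (ρ X) (w X)) := (hc X).some
  have hσρ (X : C) : IsNormalEpi (ρ X) := ⟨S X, σ X, w X, ⟨hc X⟩⟩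
  have hρσ (X : C) : IsNormalMono (σ X) := ⟨R X, ρ X, w X, ⟨hk X⟩⟩
  let L : Reflector F :=
    { obj := R
      unit := ρ
      mem := hF
      existsUnique := fun X _ hY f =>
        (hσρ X).existsUnique_desc (hk X) f (hTF0 (hT X) hY _) }
  have hfact {X Y : C} (f : X ⟶ Y) :
      ∃ (P : C) (e : X ⟶ P) (m : P ⟶ Y) (r : P ⟶ R X),
        IsPullback m r (ρ Y) (L.map f) ∧
        L.inverted e ∧ L.cart m ∧ e ≫ m = f ∧ e ≫ r = ρ X := by
    have sq : IsPullback (pullback.fst (ρ Y) (L.map f)) (pullback.snd (ρ Y) (L.map f))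
      (ρ Y) (L.map f) := IsPullback.of_hasPullback _ _
    have hf : f ≫ ρ Y = ρ X ≫ L.map f := (L.unit_map f).symm
    obtain ⟨k', w', ⟨hk'⟩⟩ := exists_isLimit_kernelFork_snd sq (hk Y)
    obtain ⟨he, hm⟩ := L.inverted_and_cart_of_isPullback sq
      (fun hZ g => (hstab _ _ _ _ sq.flip (hσρ Y)).existsUnique_desc hk' g
        (hTF0 (hT Y) hZ _)) (sq.lift_fst f (ρ X) hf) (sq.lift_snd f (ρ X) hf)
    exact ⟨_, _, _, _, sq, he, hm, sq.lift_fst f (ρ X) hf, sq.lift_snd f (ρ X) hf⟩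
  have hzero {X : C} (hX : T X) : IsZero (R X) := by
    rw [IsZero.iff_id_eq_zero]
    exact L.hom_ext (hF X) (by rw [hTF0 hX (hF X) (L.unit X), zero_comp, zero_comp])
  have hR0 : IsZero (R (0 : C)) := by
    rw [IsZero.iff_id_eq_zero]
    exact L.hom_ext (hF _) ((isZero_zero C).eq_of_src _ _)
  have hρ0 : IsIso (ρ (0 : C)) := (isZero_zero C).isIso hR0 _
  refine ⟨L.inverted, L.cart, L.isFS fun f => ?_, L.inverted_of_comp, R, ρ,
    fun _ _ f => L.map f, S, σ, hF, L.inverted_unit, L.existsUnique, L.unit_map,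
    fun _ => Iff.rfl, fun _ => Iff.rfl, hfact, fun X => ⟨fun hX => ?_, fun hX => ?_⟩, hσρ,
    fun X => ⟨fun hX => ?_, fun hX => ?_⟩, hT, fun X => ?_, fun Y X hX f => ?_, hρσ⟩
  · obtain ⟨P, e, m, -, -, he, hm, hem, -⟩ := hfact f
    exact ⟨P, e, m, he, hm, hem⟩
  · have := L.isIso_unit hX
    exact IsPullback.of_vert_isIso ⟨(L.unit_map _).symm⟩
  · have hX : IsPullback _ (ρ X) (ρ (0 : C)) _ := hX
    have := hX.isIso_snd_of_isIso
    exact hFrep (asIso (ρ X)).symm (hF X)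
  · exact hR0.isIso (hzero hX) _
  · have : IsIso (L.map (0 : (0 : C) ⟶ X)) := hX
    have hRX : IsZero (R X) := hR0.of_iso (asIso (L.map (0 : (0 : C) ⟶ X))).symm
    obtain ⟨s, hs⟩ := KernelFork.IsLimit.lift' (hk X) (𝟙 X) (hRX.eq_of_tgt _ _)
    have hs : s ≫ σ X = 𝟙 X := hs
    exact hTrep ⟨σ X, s, Fork.IsLimit.hom_ext (hk X) (by simp [hs]), hs⟩ (hT X)
  · exact isPullback_of_isLimit_kernelFork (hk X) (hzero (hT X)) _ _
  · obtain ⟨g, hg⟩ := KernelFork.IsLimit.lift' (hk Y) f (hTF0 hX (hF Y) _)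
    exact ⟨g, hg, fun y hy => Fork.IsLimit.hom_ext (hk Y) (hy.trans hg.symm)⟩

end Stmt19
end
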